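/- arXiv:2509.01027 — 12 statements merged into one kernel-verified Lean document; each statement's English description precedes it below -/
import Mathlib

section
/- For every countable (finite or countably infinite) set A of positive real numbers, there exists a metric space (X,d) that is complete, separable, has the discrete topology, and whose metric is an ultrametric, such that the distance set of (X,d) equals A ∪ {0}. -/
open Classical in
/-- The distance on `A × Bool` for which the two points over `a` are at distance `a`, and points
over distinct `a`, `b` are at distance `max (max a b) c`. -/
noncomputable def pairDist (A : Set ℝ) (c : ℝ) (p q : A × Bool) : ℝ :=
  if p = q then 0 else if p.1 = q.1 then p.1 else max (max p.1 q.1) c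

theorem pairDist_self (A : Set ℝ) (c : ℝ) (p : A × Bool) : pairDist A c p p = 0 := by
  simp [pairDist]

theorem pairDist_comm (A : Set ℝ) (c : ℝ) (p q : A × Bool) :
    pairDist A c p q = pairDist A c q p := by
  unfold pairDist
  split_ifs <;> grind

theorem pairDist_nonneg {A : Set ℝ} (hpos : ∀ a ∈ A, 0 < a) (c : ℝ) (p q : A × Bool) :
    0 ≤ pairDist A c p q := by
  have := hpos _ p.1.2
  unfold pairDist
  split_ifs <;> grind

theorem pairDist_le_max {A : Set ℝ} (hpos : ∀ a ∈ A, 0 < a) (c : ℝ) (p q r : A × Bool) :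
    pairDist A c p r ≤ max (pairDist A c p q) (pairDist A c q r) := by
  have hp := hpos _ p.1.2
  have hq := hpos _ q.1.2
  have hr := hpos _ r.1.2
  unfold pairDist
  split_ifs <;> grind

theorem eq_of_pairDist_lt {A : Set ℝ} {c : ℝ} {p q : A × Bool}
    (h : pairDist A c p q < p.1) : p = q := by
  unfold pairDist at h
  split_ifs at h <;> grind

theorem fst_eq_of_pairDist_lt {A : Set ℝ} {c : ℝ} {p q : A × Bool}
    (h : pairDist A c p q < c) : p.1 = q.1 := by
  unfold pairDist at h
  split_ifs at h <;> grind

/-- A copy of `A × Bool` without the product topology, to carry the metric `pairDist`. -/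
def PairSpace (A : Set ℝ) : Type := A × Bool

/-- The metric space structure on `PairSpace A` with distance `pairDist A c`. -/
@[reducible]
noncomputable def pairMetricSpace {A : Set ℝ} (hpos : ∀ a ∈ A, 0 < a) (c : ℝ) :
    MetricSpace (PairSpace A) where
  dist := pairDist A c
  dist_self := pairDist_self A c
  dist_comm := pairDist_comm A c
  dist_triangle p q r := (pairDist_le_max hpos c p q r).trans
    (max_le_add_of_nonneg (pairDist_nonneg hpos c p q) (pairDist_nonneg hpos c q r))
  eq_of_dist_eq_zero {p q} h := eq_of_pairDist_lt (c := c) (h.trans_lt (hpos _ p.1.2))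

/-- Every countable set `A` of positive reals is `Dist(X,d) \ {0}` for some
discrete Polish ultrametric space, i.e. there is a complete separable metric space with
discrete topology whose metric is an ultrametric and whose distance set is `A ∪ {0}`. -/
theorem stmt_0 (A : Set ℝ) (hA : A.Countable) (hpos : ∀ a ∈ A, 0 < a) :
    ∃ (X : Type) (_ : MetricSpace X), CompleteSpace X ∧ TopologicalSpace.SeparableSpace X ∧
      DiscreteTopology X ∧ IsUltrametricDist X ∧
      {r : ℝ | ∃ x y : X, dist x y = r} = A ∪ {0} := by
  rcases A.eq_empty_or_nonempty with rfl | ⟨c, hc⟩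
  · refine ⟨Unit, inferInstance, inferInstance, inferInstance, inferInstance,
      ⟨fun _ _ _ => by simp⟩, ?_⟩
    ext r
    simp [eq_comm]
  have : Countable A := hA
  have : Countable (PairSpace A) := inferInstanceAs (Countable (A × Bool))
  let _ : MetricSpace (PairSpace A) := pairMetricSpace hpos c
  refine ⟨PairSpace A, pairMetricSpace hpos c, ?_, ?_, ?_, ⟨pairDist_le_max hpos c⟩, ?_⟩
  · refine Metric.complete_of_cauchySeq_tendsto fun u hu => ?_
    obtain ⟨N, hN⟩ := Metric.cauchySeq_iff.1 hu c (hpos c hc)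
    obtain ⟨M, hM⟩ := Metric.cauchySeq_iff.1 hu (u N).1 (hpos _ (u N).1.2)
    refine ⟨u (max M N), tendsto_const_nhds.congr' ?_⟩
    filter_upwards [Filter.eventually_ge_atTop M] with n hn
    have hfst : (u N).1 = (u (max M N)).1 :=
      fst_eq_of_pairDist_lt (hN N le_rfl _ (le_max_right M N))
    have hlt := hM _ (le_max_left M N) n hn
    rw [hfst] at hlt
    exact eq_of_pairDist_lt hlt
  · infer_instance
  · refine discreteTopology_iff_isOpen_singleton.2 fun p => Metric.isOpen_singleton_iff.2 ?_
    refine ⟨p.1, hpos _ p.1.2, fun q hq => ?_⟩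
    rw [dist_comm] at hq
    exact (eq_of_pairDist_lt hq).symm
  · ext r
    constructor
    · rintro ⟨p, q, rfl⟩
      change pairDist A c p q ∈ _
      have hp := p.1.2
      have hq := q.1.2
      unfold pairDist
      split_ifs <;> grind
    · rintro (hr | rfl)
      · exact ⟨(⟨r, hr⟩, false), (⟨r, hr⟩, true), by change pairDist A c _ _ = r; simp [pairDist]⟩
      · exact ⟨(⟨c, hc⟩, false), (⟨c, hc⟩, false), dist_self _⟩
end

section
/- The distance set of every separable ultrametric space is countable (finite or countably infinite). -/
/-- In an ultrametric space, moving both points by less than their distance preserves it. -/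
theorem IsUltrametricDist.dist_eq_of_dist_lt {X : Type*} [PseudoMetricSpace X]
    [IsUltrametricDist X] {x y a b : X} (ha : dist x a < dist x y) (hb : dist y b < dist x y) :
    dist a b = dist x y := by
  refine le_antisymm ?_ ?_
  · calc dist a b ≤ max (dist a x) (max (dist x y) (dist y b)) :=
          (dist_triangle_max a x b).trans (max_le_max_left _ (dist_triangle_max x y b))
      _ ≤ dist x y := max_le (by rw [dist_comm]; exact ha.le) (max_le le_rfl hb.le)
  · have h : dist x y ≤ max (dist x a) (max (dist a b) (dist b y)) :=
      (dist_triangle_max x a y).trans (max_le_max_left _ (dist_triangle_max a b y))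
    rw [dist_comm b y] at h
    simpa [le_max_iff, ha.not_ge, hb.not_ge] using h

/-- The distance set of every separable ultrametric space is countable. -/
theorem stmt_1 (X : Type*) [MetricSpace X] [TopologicalSpace.SeparableSpace X]
    [IsUltrametricDist X] :
    {r : ℝ | ∃ x y : X, dist x y = r}.Countable := by
  obtain ⟨s, hs, hd⟩ := TopologicalSpace.exists_countable_dense X
  refine ((hs.image2 hs dist).insert 0).mono ?_
  rintro _ ⟨x, y, rfl⟩
  rcases eq_or_ne x y with rfl | hxy
  · simp
  · obtain ⟨a, has, ha⟩ := hd.exists_dist_lt x (dist_pos.2 hxy)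
    obtain ⟨b, hbs, hb⟩ := hd.exists_dist_lt y (dist_pos.2 hxy)
    exact Or.inr ⟨a, has, b, hbs, IsUltrametricDist.dist_eq_of_dist_lt ha hb⟩
end

section
/- A set A of non-negative real numbers with 0 ∈ A is the distance set of some complete separable metric space whose topology is discrete if and only if A is countable (finite or countably infinite). -/
/-- Two copies of every element of a set of real numbers. -/
@[ext]
structure DoubledSet (S : Set ℝ) where
  val : ℝ
  side : Bool
  mem : val ∈ S

namespace DoubledSet

variable {S : Set ℝ}

theorem countable (hS : S.Countable) : Countable (DoubledSet S) := by
  have := hS.to_subtype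
  refine Function.Injective.countable (β := S × Bool)
    (f := fun x => (⟨x.val, x.mem⟩, x.side)) fun x y h => ?_
  simp only [Prod.mk.injEq, Subtype.mk.injEq] at h
  exact DoubledSet.ext h.1 h.2

open Classical in
/-- The two copies of `a` are at distance `a`; copies of distinct elements `a`, `b` are at
distance `max (max a b) c`. -/
noncomputable def pairDist (c : ℝ) (x y : DoubledSet S) : ℝ :=
  if x.val = y.val then (if x.side = y.side then 0 else x.val) else max (max x.val y.val) c

/-- The (ultra)metric `pairDist c` on the doubled set. -/
noncomputable abbrev metricSpace (hS : ∀ a ∈ S, 0 < a) (c : ℝ) : MetricSpace (DoubledSet S) where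
  dist := pairDist c
  dist_self x := by simp [pairDist]
  dist_comm x y := by
    simp only [pairDist]
    grind
  dist_triangle x y z := by
    have := hS _ x.mem
    have := hS _ y.mem
    have := hS _ z.mem
    have hside : ∀ p q : Bool, p = q ∨ p = !q := by decide
    have := hside x.side y.side
    have := hside y.side z.side
    simp only [pairDist]
    grind
  eq_of_dist_eq_zero {x y} h := by
    have := hS _ x.mem
    simp only [pairDist] at h
    ext <;> grind

theorem eq_of_pairDist_lt {c : ℝ} {x y : DoubledSet S} (hc : pairDist c x y < c)
    (hx : pairDist c x y < x.val) : x = y := by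
  simp only [pairDist] at hc hx
  ext <;> grind

theorem val_eq_of_pairDist_lt {c : ℝ} {x y : DoubledSet S} (hc : pairDist c x y < c) :
    x.val = y.val := by
  simp only [pairDist] at hc
  grind

theorem discreteTopology (hS : ∀ a ∈ S, 0 < a) {c : ℝ} (hc : 0 < c) :
    letI := metricSpace hS c
    DiscreteTopology (DoubledSet S) := by
  let := metricSpace hS c
  refine discreteTopology_iff_isOpen_singleton.2 fun x => Metric.isOpen_singleton_iff.2 ?_
  refine ⟨min c x.val, lt_min hc (hS _ x.mem), fun y hy => ?_⟩
  have h : pairDist c x y < min c x.val := by rwa [dist_comm] at hy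
  exact (eq_of_pairDist_lt (h.trans_le (min_le_left _ _)) (h.trans_le (min_le_right _ _))).symm

theorem completeSpace (hS : ∀ a ∈ S, 0 < a) {c : ℝ} (hc : 0 < c) :
    letI := metricSpace hS c
    CompleteSpace (DoubledSet S) := by
  let := metricSpace hS c
  refine Metric.complete_of_cauchySeq_tendsto fun u hu => ?_
  obtain ⟨N, hN⟩ := Metric.cauchySeq_iff.1 hu c hc
  obtain ⟨M, hM⟩ := Metric.cauchySeq_iff.1 hu (u N).val (hS _ (u N).mem)
  refine ⟨u (max M N), tendsto_atTop_of_eventually_const (i₀ := max M N) fun n hn => ?_⟩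
  have hval : (u N).val = (u n).val :=
    val_eq_of_pairDist_lt (hN N le_rfl n (le_of_max_le_right hn))
  refine eq_of_pairDist_lt (c := c) (hN n (le_of_max_le_right hn) _ (le_max_right _ _)) ?_
  rw [← hval]
  exact hM n (le_of_max_le_left hn) _ (le_max_left _ _)

theorem setOf_pairDist_eq {c : ℝ} (hc : c ∈ S) :
    {r : ℝ | ∃ x y : DoubledSet S, pairDist c x y = r} = insert 0 S := by
  ext r
  constructor
  · rintro ⟨x, y, rfl⟩
    have := x.mem
    have := y.mem
    simp only [pairDist, Set.mem_insert_iff]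
    grind
  · rintro (rfl | hr)
    · exact ⟨⟨c, true, hc⟩, ⟨c, true, hc⟩, by simp [pairDist]⟩
    · exact ⟨⟨r, true, hr⟩, ⟨r, false, hr⟩, by simp [pairDist]⟩

end DoubledSet

/-- A set `A ⊆ [0,∞)` with `0 ∈ A` is the distance set of some complete
separable metric space with discrete topology iff `A` is countable. -/
theorem stmt_2 (A : Set ℝ) (hnn : ∀ a ∈ A, 0 ≤ a) (h0 : (0 : ℝ) ∈ A) :
    (∃ (X : Type) (_ : MetricSpace X), CompleteSpace X ∧ TopologicalSpace.SeparableSpace X ∧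
      DiscreteTopology X ∧ {r : ℝ | ∃ x y : X, dist x y = r} = A) ↔ A.Countable := by
  constructor
  · rintro ⟨X, _, -, _, _, rfl⟩
    have : Countable X := TopologicalSpace.separableSpace_iff_countable.1 inferInstance
    convert Set.countable_range fun p : X × X => dist p.1 p.2 using 1
    ext r
    simp
  · intro hA
    by_cases h : ∃ c ∈ A, c ≠ 0
    · obtain ⟨c, hcA, hc0⟩ := h
      have hS : ∀ a ∈ A \ {0}, 0 < a := fun a ha => (hnn a ha.1).lt_of_ne' ha.2
      have hc : c ∈ A \ {0} := ⟨hcA, hc0⟩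
      have := DoubledSet.countable (hA.mono (Set.sdiff_subset (t := {0})))
      let := DoubledSet.metricSpace hS c
      refine ⟨DoubledSet (A \ {0}), this, DoubledSet.completeSpace hS (hS c hc), inferInstance,
        DoubledSet.discreteTopology hS (hS c hc), ?_⟩
      exact (DoubledSet.setOf_pairDist_eq hc).trans (by simp [h0])
    · push Not at h
      refine ⟨Unit, inferInstance, inferInstance, inferInstance, inferInstance, ?_⟩
      ext r
      simp only [dist_self, exists_const, Set.mem_ofPred_eq]
      exact ⟨fun hr => hr ▸ h0, fun hr => (h r hr).symm⟩
end

section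
/- Let (X,d) be a nonempty, compact, perfect (no isolated points) metric space whose metric is an ultrametric. Then there exists a strictly decreasing sequence (d_i)_{i∈ℕ} of positive real numbers converging to 0 such that the distance set of (X,d) equals {d_i : i ∈ ℕ} ∪ {0}. -/
/-- A set of positive reals that accumulates at `0` and has only finitely many elements above each
positive threshold is the range of a strictly decreasing sequence. -/
theorem exists_strictAnti_range_eq_of_finite_inter_Ici {S : Set ℝ}
    (hfin : ∀ ε > 0, (S ∩ Set.Ici ε).Finite) (hpos : ∀ r ∈ S, 0 < r)
    (hsmall : ∀ ε > 0, ∃ r ∈ S, r < ε) :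
    ∃ d : ℕ → ℝ, StrictAnti d ∧ Set.range d = S := by
  classical
  have hIcc (a b : Sᵒᵈ) : (Set.Icc a b).Finite := by
    refine Set.Finite.of_finite_image (f := fun s : Sᵒᵈ ↦ ((OrderDual.ofDual s : S) : ℝ))
      ((hfin _ (hpos _ (OrderDual.ofDual b).2)).subset ?_)
      (fun x _ y _ h ↦ OrderDual.ofDual.injective (Subtype.ext h))
    rintro _ ⟨s, hs, rfl⟩
    exact ⟨(OrderDual.ofDual s).2, hs.2⟩
  let _ : LocallyFiniteOrder Sᵒᵈ := LocallyFiniteOrder.ofFiniteIcc hIcc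
  let _ : SuccOrder Sᵒᵈ := LinearLocallyFiniteOrder.succOrder Sᵒᵈ
  have : NoMaxOrder Sᵒᵈ := ⟨fun a ↦ by
    obtain ⟨r, hr, hlt⟩ := hsmall _ (hpos _ (OrderDual.ofDual a).2)
    exact ⟨OrderDual.toDual ⟨r, hr⟩, hlt⟩⟩
  obtain ⟨r₀, hr₀, -⟩ := hsmall 1 one_pos
  obtain ⟨M, hM, hmax⟩ := Set.exists_max_image _ id (hfin r₀ (hpos _ hr₀)) ⟨r₀, hr₀, Set.self_mem_Ici⟩
  let _ : OrderBot Sᵒᵈ :=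
    { bot := OrderDual.toDual ⟨M, hM.1⟩
      bot_le := fun s ↦ by
        change ((OrderDual.ofDual s : S) : ℝ) ≤ M
        rcases le_total r₀ ((OrderDual.ofDual s : S) : ℝ) with h | h
        · exact hmax _ ⟨(OrderDual.ofDual s).2, h⟩
        · exact h.trans hM.2 }
  let _ : PredOrder Sᵒᵈ := LinearLocallyFiniteOrder.predOrder Sᵒᵈ
  let e : Sᵒᵈ ≃o ℕ := orderIsoNatOfLinearSuccPredArch
  refine ⟨fun n ↦ ((OrderDual.ofDual (e.symm n) : S) : ℝ), fun m n h ↦ e.symm.strictMono h, ?_⟩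
  ext r
  constructor
  · rintro ⟨n, rfl⟩
    exact (OrderDual.ofDual (e.symm n)).2
  · intro hr
    exact ⟨e (OrderDual.toDual ⟨r, hr⟩), by simp⟩

/-- In an ultrametric space, the distance of two points at distance at least `ε` does not change
when both points move by less than `ε`. -/
theorem IsUltrametricDist.dist_eq_dist_of_dist_lt {X : Type*} [PseudoMetricSpace X]
    [IsUltrametricDist X] {x y a b : X} {ε : ℝ} (h : ε ≤ dist x y) (ha : dist x a < ε)
    (hb : dist y b < ε) : dist a b = dist x y := by
  have h₁ := dist_triangle_max x a y
  have h₂ := dist_triangle_max a b y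
  have h₃ := dist_triangle_max a x y
  have h₄ := dist_triangle_max a y b
  rw [dist_comm b y] at h₂
  rw [dist_comm a x] at h₃
  grind

/-- A compact ultrametric space has finitely many distances above each positive threshold. -/
theorem IsUltrametricDist.finite_dist_inter_Ici {X : Type*} [PseudoMetricSpace X] [CompactSpace X]
    [IsUltrametricDist X] {ε : ℝ} (hε : 0 < ε) :
    ({r : ℝ | ∃ x y : X, dist x y = r} ∩ Set.Ici ε).Finite := by
  obtain ⟨t, -, ht, hcover⟩ :=
    (isCompact_univ (X := X)).finite_cover_balls hε
  refine (ht.image2 dist ht).subset ?_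
  rintro _ ⟨⟨x, y, rfl⟩, h⟩
  obtain ⟨a, ha, hxa⟩ := Set.mem_iUnion₂.1 (hcover (Set.mem_univ x))
  obtain ⟨b, hb, hyb⟩ := Set.mem_iUnion₂.1 (hcover (Set.mem_univ y))
  exact ⟨a, ha, b, hb, dist_eq_dist_of_dist_lt h hxa hyb⟩

/-- The distance set of a nonempty compact perfect ultrametric space can be
enumerated as a strictly decreasing sequence of positive reals tending to `0`
(together with `0`). -/
theorem stmt_5 (X : Type*) [MetricSpace X] [Nonempty X] [CompactSpace X] [PerfectSpace X]
    [IsUltrametricDist X] :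
    ∃ d : ℕ → ℝ, StrictAnti d ∧ (∀ i, 0 < d i) ∧
      Filter.Tendsto d Filter.atTop (nhds 0) ∧
      {r : ℝ | ∃ x y : X, dist x y = r} = Set.range d ∪ {0} := by
  obtain ⟨p⟩ := ‹Nonempty X›
  set S : Set ℝ := {r : ℝ | ∃ x y : X, dist x y = r} ∩ Set.Ioi 0 with hS
  have hsmall (ε : ℝ) (hε : 0 < ε) : ∃ r ∈ S, r < ε := by
    have hp : AccPt p (Filter.principal Set.univ) := PerfectSpace.univ_preperfect p trivial
    obtain ⟨y, ⟨hy, -⟩, hne⟩ := accPt_iff_nhds.1 hp _ (Metric.ball_mem_nhds p hε)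
    exact ⟨dist y p, ⟨⟨y, p, rfl⟩, dist_pos.2 hne⟩, hy⟩
  obtain ⟨d, hd, hrange⟩ := exists_strictAnti_range_eq_of_finite_inter_Ici (S := S)
    (fun ε hε ↦ (IsUltrametricDist.finite_dist_inter_Ici hε).subset
      (Set.inter_subset_inter_left _ Set.inter_subset_left))
    (fun r hr ↦ hr.2) hsmall
  have hdpos (i : ℕ) : 0 < d i := (hrange.subset ⟨i, rfl⟩).2
  refine ⟨d, hd, hdpos, ?_, ?_⟩
  · rw [Metric.tendsto_atTop]
    intro ε hε
    obtain ⟨r, hr, hlt⟩ := hsmall ε hε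
    obtain ⟨N, rfl⟩ := hrange.superset hr
    refine ⟨N, fun n hn ↦ ?_⟩
    rw [Real.dist_0_eq_abs, abs_of_pos (hdpos n)]
    exact (hd.antitone hn).trans_lt hlt
  · rw [hrange]
    ext r
    constructor
    · rintro ⟨x, y, rfl⟩
      rcases (dist_nonneg (x := x) (y := y)).eq_or_lt with h | h
      · exact Or.inr h.symm
      · exact Or.inl ⟨⟨x, y, rfl⟩, h⟩
    · rintro (h | rfl)
      · exact h.1
      · exact ⟨p, p, dist_self p⟩
end

section
/- Let A be a set of non-negative real numbers with 0 ∈ A such that A is an analytic subset of ℝ and 0 is a limit point of A. Then there exists a complete separable metric space (X,d) whose distance set equals A. -/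
open Filter Topology

namespace DistanceSet

/-- Sequences encoding a block label `w 0`, a point of the Baire space (the first coordinates of
the later terms) and integer approximations (the second coordinates). -/
abbrev Code : Type := ℕ → ℕ × ℤ

/-- The point of the Baire space encoded by `w`. -/
def shift (w : Code) : ℕ → ℕ := fun n => (w (n + 1)).1

/-- The value of `f` encoded by `w`; codes with label `0` have height `0`. -/
noncomputable def height (f : (ℕ → ℕ) → ℝ) (w : Code) : ℝ :=
  if (w 0).1 = 0 then 0 else f (shift w)

/-- The admissible codes: the zero code, and those codes whose height is at least `a k`, where `k`
is the label, and is approximated by the encoded integers at scales `a (k + n + 1)`. -/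
def admissible (a : ℕ → ℝ) (f : (ℕ → ℕ) → ℝ) : Set Code :=
  {w | ((w 0).1 = 0 → w = 0) ∧ ((w 0).1 ≠ 0 → a (w 0).1 ≤ f (shift w) ∧
    ∀ n, |2 * f (shift w) - (w n).2 * a ((w 0).1 + n + 1)| ≤ a ((w 0).1 + n + 1))}

open Classical in
/-- The ultrametric used between codes with the same initial term. -/
noncomputable def blockDist (a : ℕ → ℝ) (v w : Code) : ℝ :=
  if v = w then 0 else a ((v 0).1 + PiNat.firstDiff v w)

/-- The block ultrametric inside a block, the maximum of the heights across blocks. -/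
noncomputable def glueDist (a : ℕ → ℝ) (f : (ℕ → ℕ) → ℝ) (v w : Code) : ℝ :=
  if v 0 = w 0 then blockDist a v w else max (height f v) (height f w)

/-- The set of admissible codes, without its product topology. -/
def Glued (a : ℕ → ℝ) (f : (ℕ → ℕ) → ℝ) : Type := admissible a f

/-- The identity map from the admissible codes with the product topology. -/
def toGlued {a : ℕ → ℝ} {f : (ℕ → ℕ) → ℝ} (x : admissible a f) : Glued a f := x

variable {a : ℕ → ℝ} {f : (ℕ → ℕ) → ℝ} {u v w : Code}

theorem continuous_shift : Continuous shift := by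
  unfold shift
  fun_prop

theorem isClosed_admissible (hf : Continuous f) : IsClosed (admissible a f) := by
  have hfs : Continuous fun w : Code => f (shift w) := hf.comp continuous_shift
  have hk : Continuous fun w : Code => (w 0).1 := by fun_prop
  have hak (n : ℕ) : Continuous fun w : Code => a ((w 0).1 + n) :=
    (continuous_of_discreteTopology (f := fun k : ℕ => a (k + n))).comp hk
  have hs (n : ℕ) : Continuous fun w : Code => ((w n).2 : ℝ) :=
    (continuous_of_discreteTopology (f := fun k : ℤ => (k : ℝ))).comp (by fun_prop)
  refine IsClosed.and (isClosed_imp ?_ ?_) (isClosed_imp ?_ (IsClosed.and ?_ ?_))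
  · exact (isOpen_discrete {0}).preimage hk
  · exact isClosed_eq continuous_id continuous_const
  · exact (isOpen_discrete {0}ᶜ).preimage hk
  · exact isClosed_le (hak 0) hfs
  · simp only [Set.ofPred_forall]
    refine isClosed_iInter fun n => isClosed_le ?_ (hak (n + 1))
    exact ((continuous_const.mul hfs).sub ((hs n).mul (hak (n + 1)))).abs

theorem zero_mem_admissible : (0 : Code) ∈ admissible a f := by
  simp [admissible]

theorem blockDist_self : blockDist a v v = 0 := if_pos rfl

theorem glueDist_self : glueDist a f v v = 0 := by
  simp [glueDist, blockDist]

theorem blockDist_comm (h : v 0 = w 0) : blockDist a v w = blockDist a w v := by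
  by_cases hvw : v = w
  · rw [hvw]
  · rw [blockDist, blockDist, if_neg hvw, if_neg (Ne.symm hvw), h, PiNat.firstDiff_comm]

theorem glueDist_comm : glueDist a f v w = glueDist a f w v := by
  by_cases h : v 0 = w 0
  · simp only [glueDist, h, if_true, blockDist_comm h]
  · simp only [glueDist, h, Ne.symm h, if_false, max_comm]

theorem blockDist_nonneg (hpos : ∀ n, 0 < a n) : 0 ≤ blockDist a v w := by
  unfold blockDist
  split_ifs
  · exact le_rfl
  · exact (hpos _).le

theorem blockDist_triangle (hanti : Antitone a) (hpos : ∀ n, 0 < a n) (huv : u 0 = v 0) :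
    blockDist a u w ≤ blockDist a u v + blockDist a v w := by
  have h₁ := blockDist_nonneg hpos (v := u) (w := v)
  have h₂ := blockDist_nonneg hpos (v := v) (w := w)
  by_cases h : u = v
  · subst h
    linarith
  by_cases h' : v = w
  · subst h'
    linarith
  by_cases h'' : u = w
  · subst h''
    rw [blockDist_self]
    linarith
  have hm := PiNat.min_firstDiff_le u v w h''
  rw [blockDist, if_neg h'']
  rcases min_le_iff.1 hm with hm | hm
  · have : a ((u 0).1 + PiNat.firstDiff u w) ≤ blockDist a u v := by
      rw [blockDist, if_neg h]
      exact hanti (by omega)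
    linarith
  · have : a ((u 0).1 + PiNat.firstDiff u w) ≤ blockDist a v w := by
      rw [blockDist, if_neg h', huv]
      exact hanti (by omega)
    linarith

theorem blockDist_le_of_forall_eq (hanti : Antitone a) (hpos : ∀ n, 0 < a n) {N : ℕ}
    (h : ∀ i < N, v i = w i) : blockDist a v w ≤ a N := by
  unfold blockDist
  split_ifs with hvw
  · exact (hpos _).le
  · have : N ≤ PiNat.firstDiff v w := by
      by_contra! hlt
      exact PiNat.apply_firstDiff_ne hvw (h _ hlt)
    exact hanti (by omega)

theorem apply_eq_of_blockDist_lt (hanti : Antitone a) {n : ℕ}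
    (h : blockDist a v w < a ((v 0).1 + n)) : v n = w n := by
  by_cases hvw : v = w
  · rw [hvw]
  · rw [blockDist, if_neg hvw] at h
    have := hanti.reflect_lt h
    exact PiNat.apply_eq_of_lt_firstDiff (by omega)

theorem le_height (hv : v ∈ admissible a f) (h : (v 0).1 ≠ 0) : a (v 0).1 ≤ height f v := by
  rw [height, if_neg h]
  exact (hv.2 h).1

theorem height_nonneg (hpos : ∀ n, 0 < a n) (hv : v ∈ admissible a f) : 0 ≤ height f v := by
  by_cases h : (v 0).1 = 0
  · simp [height, h]
  · exact (hpos _).le.trans (le_height hv h)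

theorem blockDist_le_height (hanti : Antitone a) (hpos : ∀ n, 0 < a n)
    (hv : v ∈ admissible a f) (hw : w ∈ admissible a f) (hvw : v 0 = w 0) :
    blockDist a v w ≤ height f v := by
  by_cases h : v = w
  · subst h
    rw [blockDist_self]
    exact height_nonneg hpos hv
  · have hk : (v 0).1 ≠ 0 := fun hk => h ((hv.1 hk).trans (hw.1 (hvw ▸ hk)).symm)
    rw [blockDist, if_neg h]
    exact (hanti (Nat.le_add_right _ _)).trans (le_height hv hk)

theorem height_le_add_blockDist (hv : v ∈ admissible a f) (hw : w ∈ admissible a f)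
    (hvw : v 0 = w 0) : height f v ≤ height f w + blockDist a v w := by
  by_cases h : v = w
  · subst h
    simp [blockDist_self]
  · have hk : (v 0).1 ≠ 0 := fun hk => h ((hv.1 hk).trans (hw.1 (hvw ▸ hk)).symm)
    have hk' : (w 0).1 ≠ 0 := hvw ▸ hk
    rw [blockDist, if_neg h, height, if_neg hk, height, if_neg hk']
    obtain ⟨n, hn⟩ : ∃ n, PiNat.firstDiff v w = n + 1 := by
      refine Nat.exists_eq_succ_of_ne_zero fun h0 => PiNat.apply_firstDiff_ne h ?_
      rw [h0, hvw]
    have hvn := (hv.2 hk).2 n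
    have hwn := (hw.2 hk').2 n
    rw [← hvw, ← PiNat.apply_eq_of_lt_firstDiff (x := v) (y := w) (n := n) (by omega)] at hwn
    rw [hn, ← add_assoc]
    rw [abs_le] at hvn hwn
    linarith [hvn.2, hwn.1]

theorem glueDist_triangle (hanti : Antitone a) (hpos : ∀ n, 0 < a n)
    (hu : u ∈ admissible a f) (hv : v ∈ admissible a f) (hw : w ∈ admissible a f) :
    glueDist a f u w ≤ glueDist a f u v + glueDist a f v w := by
  have gu := height_nonneg hpos hu
  have gv := height_nonneg hpos hv
  have gw := height_nonneg hpos hw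
  have m₁ := le_max_left (height f u) (height f v)
  have m₂ := le_max_right (height f u) (height f v)
  have m₃ := le_max_left (height f v) (height f w)
  have m₄ := le_max_right (height f v) (height f w)
  by_cases huv : u 0 = v 0
  · by_cases hvw : v 0 = w 0
    · simp only [glueDist, huv, hvw, if_true]
      exact blockDist_triangle hanti hpos huv
    · have := height_le_add_blockDist hu hv huv
      have := blockDist_nonneg hpos (v := u) (w := v)
      simp only [glueDist, huv, hvw, if_true, if_false]
      exact max_le (by linarith) (by linarith)
  · by_cases hvw : v 0 = w 0
    · have := height_le_add_blockDist hw hv hvw.symm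
      rw [blockDist_comm hvw.symm] at this
      have := blockDist_nonneg hpos (v := v) (w := w)
      have huw : u 0 ≠ w 0 := hvw ▸ huv
      simp only [glueDist, huw, hvw, if_true, if_false]
      exact max_le (by linarith) (by linarith)
    · by_cases huw : u 0 = w 0
      · have := blockDist_le_height hanti hpos hu hw huw
        rw [glueDist, if_pos huw, glueDist, if_neg huv, glueDist, if_neg hvw]
        linarith
      · simp only [glueDist, huv, huw, hvw, if_false]
        exact max_le (by linarith) (by linarith)

theorem eq_of_glueDist_eq_zero (hpos : ∀ n, 0 < a n)
    (hv : v ∈ admissible a f) (hw : w ∈ admissible a f) (h : glueDist a f v w = 0) : v = w := by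
  by_cases hvw : v 0 = w 0
  · rw [glueDist, if_pos hvw, blockDist] at h
    by_contra hne
    rw [if_neg hne] at h
    exact (hpos _).ne' h
  · rw [glueDist, if_neg hvw] at h
    have hkv : (v 0).1 = 0 := by
      by_contra hk
      linarith [hpos (v 0).1, le_height hv hk, le_max_left (height f v) (height f w)]
    have hkw : (w 0).1 = 0 := by
      by_contra hk
      linarith [hpos (w 0).1, le_height hw hk, le_max_right (height f v) (height f w)]
    rw [hv.1 hkv, hw.1 hkw]

theorem glueDist_zero_right (hpos : ∀ n, 0 < a n) (hv : v ∈ admissible a f) :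
    glueDist a f v 0 = height f v := by
  by_cases hk : (v 0).1 = 0
  · rw [hv.1 hk, glueDist_self]
    simp [height]
  · have h0 : v 0 ≠ (0 : Code) 0 := fun h => hk (by rw [h]; rfl)
    rw [glueDist, if_neg h0]
    simpa [height] using height_nonneg hpos hv

/-- The glued metric on the admissible codes. -/
@[reducible]
noncomputable def gluedMetric (hanti : Antitone a) (hpos : ∀ n, 0 < a n) :
    MetricSpace (Glued a f) where
  dist x y := glueDist a f x.1 y.1
  dist_self _ := glueDist_self
  dist_comm _ _ := glueDist_comm
  dist_triangle x y z := glueDist_triangle hanti hpos x.2 y.2 z.2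
  eq_of_dist_eq_zero {x y} h := Subtype.ext (eq_of_glueDist_eq_zero hpos x.2 y.2 h)

theorem continuous_toGlued (hanti : Antitone a) (hpos : ∀ n, 0 < a n)
    (hlim : Tendsto a atTop (𝓝 0)) :
    letI := gluedMetric (f := f) hanti hpos
    Continuous (toGlued (a := a) (f := f)) := by
  let := gluedMetric (f := f) hanti hpos
  refine continuous_iff_continuousAt.2 fun x => Metric.tendsto_nhds.2 fun ε hε => ?_
  obtain ⟨N, hN⟩ := (hlim.eventually (gt_mem_nhds hε)).exists
  have hev : ∀ i ∈ Set.Iio (N + 1), ∀ᶠ y : admissible a f in 𝓝 x, y.1 i = x.1 i := fun i _ =>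
    ((continuous_apply i).comp continuous_subtype_val).continuousAt.eventually
      (mem_nhds_discrete.2 (Set.mem_singleton (x.1 i)))
  filter_upwards [(eventually_all_finite (Set.finite_Iio (N + 1))).2 hev] with y hy
  change glueDist a f y.1 x.1 < ε
  rw [glueDist, if_pos (hy 0 (Nat.succ_pos N))]
  exact (blockDist_le_of_forall_eq hanti hpos fun i hi => hy i (Nat.lt_succ_of_lt hi)).trans_lt hN

theorem separableSpace_glued (hanti : Antitone a) (hpos : ∀ n, 0 < a n)
    (hlim : Tendsto a atTop (𝓝 0)) :
    letI := gluedMetric (f := f) hanti hpos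
    TopologicalSpace.SeparableSpace (Glued a f) := by
  let := gluedMetric (f := f) hanti hpos
  exact Function.Surjective.denseRange (f := toGlued (a := a) (f := f))
    (fun x => ⟨x, rfl⟩) |>.separableSpace (continuous_toGlued hanti hpos hlim)

theorem completeSpace_glued (hf : Continuous f) (hanti : Antitone a) (hpos : ∀ n, 0 < a n)
    (hlim : Tendsto a atTop (𝓝 0)) :
    letI := gluedMetric (f := f) hanti hpos
    CompleteSpace (Glued a f) := by
  let := gluedMetric (f := f) hanti hpos
  refine Metric.complete_of_cauchySeq_tendsto fun x hx => ?_
  rw [Metric.cauchySeq_iff] at hx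
  by_cases hzero : ∀ ε > 0, ∃ N, ∀ n ≥ N, height f (x n).1 < ε
  · refine ⟨⟨0, zero_mem_admissible⟩, Metric.tendsto_atTop.2 fun ε hε => ?_⟩
    obtain ⟨N, hN⟩ := hzero ε hε
    refine ⟨N, fun n hn => ?_⟩
    change glueDist a f (x n).1 0 < ε
    rw [glueDist_zero_right hpos (x n).2]
    exact hN n hn
  push Not at hzero
  obtain ⟨ε, hε, hfar⟩ := hzero
  obtain ⟨N, hN⟩ := hx ε hε
  obtain ⟨m, hmN, hm⟩ := hfar N
  have hblock : ∀ n ≥ N, (x n).1 0 = (x m).1 0 := fun n hn => by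
    have hd : glueDist a f (x n).1 (x m).1 < ε := hN n hn m hmN
    by_contra hne
    rw [glueDist, if_neg hne] at hd
    exact absurd (hm.trans (le_max_right _ _)) hd.not_ge
  have hstab (i : ℕ) : ∃ M, ∀ n ≥ M, (x n).1 i = (x M).1 i := by
    obtain ⟨M, hM⟩ := hx _ (hpos (((x m).1 0).1 + i))
    refine ⟨max M N, fun n hn => ?_⟩
    have hd : glueDist a f (x n).1 (x (max M N)).1 < a (((x m).1 0).1 + i) :=
      hM n (le_of_max_le_left hn) _ (le_max_left _ _)
    have hbn := hblock n (le_of_max_le_right hn)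
    rw [glueDist, if_pos (hbn.trans (hblock _ (le_max_right _ _)).symm), ← hbn] at hd
    exact apply_eq_of_blockDist_lt hanti hd
  choose M hM using hstab
  have htend : Tendsto (fun n => (x n).1) atTop (𝓝 fun i => (x (M i)).1 i) := by
    refine tendsto_pi_nhds.2 fun i => tendsto_const_nhds.congr' ?_
    filter_upwards [eventually_ge_atTop (M i)] with n hn
    exact (hM i n hn).symm
  have hmem := (isClosed_admissible hf).mem_of_tendsto htend (Eventually.of_forall fun n => (x n).2)
  exact ⟨⟨_, hmem⟩, ((continuous_toGlued hanti hpos hlim).tendsto ⟨_, hmem⟩).comp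
    (tendsto_subtype_rng.2 htend)⟩

theorem glueDist_mem {A : Set ℝ} (h0 : (0 : ℝ) ∈ A) (ha : ∀ n, a n ∈ A) (hf : ∀ z, f z ∈ A) :
    glueDist a f v w ∈ A := by
  have hh (v : Code) : height f v ∈ A := by
    unfold height
    split_ifs
    exacts [h0, hf _]
  unfold glueDist blockDist
  split_ifs
  · exact h0
  · exact ha _
  · rcases max_choice (height f v) (height f w) with h | h <;> rw [h] <;> exact hh _

theorem exists_height_eq (hpos : ∀ n, 0 < a n) (hlim : Tendsto a atTop (𝓝 0)) {z : ℕ → ℕ}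
    (hz : 0 < f z) : ∃ w ∈ admissible a f, height f w = f z := by
  obtain ⟨k, hk, hk0⟩ := ((hlim.eventually (gt_mem_nhds hz)).and (eventually_ne_atTop 0)).exists
  let w : Code := fun n => (Nat.casesOn n k z, ⌊2 * f z / a (k + n + 1)⌋)
  have hw : shift w = z := rfl
  have hwk : (w 0).1 = k := rfl
  refine ⟨w, ⟨fun h => absurd h hk0, fun _ => ?_⟩, by rw [height, hwk, if_neg hk0, hw]⟩
  rw [hw, hwk]
  refine ⟨hk.le, fun n => ?_⟩
  have hp := hpos (k + n + 1)
  have h₁ := (le_div_iff₀ hp).1 (Int.floor_le (2 * f z / a (k + n + 1)))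
  have h₂ := (div_lt_iff₀ hp).1 (Int.lt_floor_add_one (2 * f z / a (k + n + 1)))
  change |2 * f z - (⌊2 * f z / a (k + n + 1)⌋ : ℝ) * a (k + n + 1)| ≤ _
  rw [abs_le]
  constructor <;> linarith

end DistanceSet

open DistanceSet in
/-- If `A ⊆ [0,∞)` with `0 ∈ A` is analytic and has `0` as a limit point, then
`A` is the distance set of some complete separable metric space. -/
theorem stmt_9 (A : Set ℝ) (hnn : ∀ a ∈ A, 0 ≤ a) (h0 : (0 : ℝ) ∈ A)
    (hAn : MeasureTheory.AnalyticSet A)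
    (hlim : ∀ ε > 0, ∃ a ∈ A, a ≠ 0 ∧ |a| < ε) :
    ∃ (X : Type) (_ : MetricSpace X), CompleteSpace X ∧ TopologicalSpace.SeparableSpace X ∧
      {r : ℝ | ∃ x y : X, dist x y = r} = A := by
  rw [MeasureTheory.AnalyticSet] at hAn
  obtain ⟨f, hf, hfA⟩ := hAn.resolve_left (Set.nonempty_of_mem h0).ne_empty
  have hglb : IsGLB (A \ {0}) 0 := by
    refine ⟨fun r hr => hnn r hr.1, fun b hb => le_of_forall_pos_le_add fun ε hε => ?_⟩
    obtain ⟨r, hrA, hr0, hr⟩ := hlim ε hε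
    have := hb (show r ∈ A \ {0} from ⟨hrA, hr0⟩)
    linarith [le_abs_self r]
  obtain ⟨r, hrA, hr0, -⟩ := hlim 1 one_pos
  obtain ⟨a, hanti, hpos, hatend, haA⟩ :=
    hglb.exists_seq_strictAnti_tendsto_of_notMem (by simp) ⟨r, hrA, hr0⟩
  refine ⟨Glued a f, gluedMetric hanti.antitone hpos,
    completeSpace_glued hf hanti.antitone hpos hatend,
    separableSpace_glued hanti.antitone hpos hatend, Set.Subset.antisymm ?_ fun r hr => ?_⟩
  · rintro _ ⟨x, y, rfl⟩
    exact glueDist_mem h0 (fun n => (haA n).1) fun z => hfA ▸ Set.mem_range_self z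
  · rcases (hnn r hr).eq_or_lt with rfl | hr0
    · exact ⟨⟨0, zero_mem_admissible⟩, ⟨0, zero_mem_admissible⟩, glueDist_self⟩
    · obtain ⟨z, rfl⟩ := hfA.symm ▸ hr
      obtain ⟨w, hw, hwz⟩ := exists_height_eq hpos hatend hr0
      exact ⟨⟨w, hw⟩, ⟨0, zero_mem_admissible⟩, (glueDist_zero_right hpos hw).trans hwz⟩
end

section
/- A set A of non-negative real numbers with 0 ∈ A is the distance set of some complete separable metric space if and only if A is countable, or A is an analytic subset of ℝ and 0 is a limit point of A. -/
open Set Filter Topology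

section Construction

variable {X S : Type}

open Classical in
/-- Points are coded by sequences `s x`. Two points whose codes differ at the first entry are at
distance `max (f x) (f y)`; otherwise their distance is `b` evaluated at the common first entry
and at the first index where the codes differ. -/
noncomputable def codeDist (s : X → ℕ → S) (f : X → ℝ) (b : S → ℕ → ℝ) (x y : X) : ℝ :=
  if x = y then 0
  else if s x 0 = s y 0 then b (s x 0) (PiNat.firstDiff (s x) (s y)) else max (f x) (f y)

/-- Compatibility conditions making `codeDist s f b` a complete metric with base point `p`. -/
structure CodeData (s : X → ℕ → S) (f : X → ℝ) (b : S → ℕ → ℝ) (p : X) : Prop where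
  inj : Function.Injective s
  nonneg : ∀ x, 0 ≤ f x
  eq_zero : ∀ x, f x = 0 → x = p
  base : f p = 0
  anti : ∀ a, Antitone (b a)
  pos : ∀ a n, 0 < b a n
  lim : ∀ a, Tendsto (b a) atTop (𝓝 0)
  lip : ∀ x y, x ≠ y → s x 0 = s y 0 → |f x - f y| ≤ b (s x 0) (PiNat.firstDiff (s x) (s y))
  le : ∀ x y, x ≠ y → s x 0 = s y 0 → b (s x 0) (PiNat.firstDiff (s x) (s y)) ≤ f x

variable {s : X → ℕ → S} {f : X → ℝ} {b : S → ℕ → ℝ} {p : X}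

lemma codeDist_self (x : X) : codeDist s f b x x = 0 := by simp [codeDist]

lemma codeDist_of_eq {x y : X} (h : x ≠ y) (h0 : s x 0 = s y 0) :
    codeDist s f b x y = b (s x 0) (PiNat.firstDiff (s x) (s y)) := by
  simp [codeDist, h, h0]

lemma codeDist_of_ne {x y : X} (h0 : s x 0 ≠ s y 0) :
    codeDist s f b x y = max (f x) (f y) := by
  have h : x ≠ y := fun h => h0 (by rw [h])
  simp [codeDist, h, h0]

lemma codeDist_comm (x y : X) : codeDist s f b x y = codeDist s f b y x := by
  by_cases h : x = y
  · rw [h]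
  by_cases h0 : s x 0 = s y 0
  · rw [codeDist_of_eq h h0, codeDist_of_eq (Ne.symm h) h0.symm, PiNat.firstDiff_comm, h0]
  · rw [codeDist_of_ne h0, codeDist_of_ne (Ne.symm h0), max_comm]

namespace CodeData

variable (H : CodeData s f b p)
include H

lemma dist_nonneg (x y : X) : 0 ≤ codeDist s f b x y := by
  by_cases h : x = y
  · rw [h, codeDist_self]
  by_cases h0 : s x 0 = s y 0
  · rw [codeDist_of_eq h h0]; exact (H.pos _ _).le
  · rw [codeDist_of_ne h0]; exact le_max_of_le_left (H.nonneg x)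

lemma dist_le_max (x y : X) : codeDist s f b x y ≤ max (f x) (f y) := by
  by_cases h : x = y
  · rw [h, codeDist_self]; exact le_max_of_le_left (H.nonneg y)
  by_cases h0 : s x 0 = s y 0
  · rw [codeDist_of_eq h h0]; exact le_max_of_le_left (H.le x y h h0)
  · rw [codeDist_of_ne h0]

lemma le_add_dist (x y : X) : f x ≤ f y + codeDist s f b x y := by
  by_cases h : x = y
  · rw [h, codeDist_self, add_zero]
  by_cases h0 : s x 0 = s y 0
  · rw [codeDist_of_eq h h0]
    linarith [le_abs_self (f x - f y), H.lip x y h h0]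
  · rw [codeDist_of_ne h0]
    linarith [le_max_left (f x) (f y), H.nonneg y]

lemma dist_triangle (x y z : X) :
    codeDist s f b x z ≤ codeDist s f b x y + codeDist s f b y z := by
  by_cases hxz : s x 0 = s z 0
  · by_cases hxy : s x 0 = s y 0
    · by_cases exz : x = z
      · rw [exz, codeDist_self]; exact add_nonneg (H.dist_nonneg _ _) (H.dist_nonneg _ _)
      by_cases exy : x = y
      · rw [exy, codeDist_self, zero_add]
      by_cases eyz : y = z
      · rw [eyz, codeDist_self, add_zero]
      rw [codeDist_of_eq exz hxz, codeDist_of_eq exy hxy,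
        codeDist_of_eq eyz (hxy.symm.trans hxz), ← hxy]
      have hm := PiNat.min_firstDiff_le (s x) (s y) (s z) (H.inj.ne exz)
      have p1 := H.pos (s x 0) (PiNat.firstDiff (s x) (s y))
      have p2 := H.pos (s x 0) (PiNat.firstDiff (s y) (s z))
      rcases min_le_iff.1 hm with h | h
      · linarith [H.anti (s x 0) h]
      · linarith [H.anti (s x 0) h]
    · rw [codeDist_of_ne hxy, codeDist_of_ne (fun h => hxy (hxz.trans h.symm))]
      refine (H.dist_le_max x z).trans (max_le ?_ ?_)
      · linarith [le_max_left (f x) (f y), le_max_left (f y) (f z), H.nonneg y]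
      · linarith [le_max_right (f x) (f y), le_max_right (f y) (f z), H.nonneg y]
  · rw [codeDist_of_ne hxz]
    have hx := H.le_add_dist x y
    have hz := H.le_add_dist z y
    rw [codeDist_comm z y] at hz
    have n1 := H.dist_nonneg x y
    have n2 := H.dist_nonneg y z
    by_cases hxy : s x 0 = s y 0
    · have e := codeDist_of_ne (f := f) (b := b) (fun h => hxz (hxy.trans h) : s y 0 ≠ s z 0)
      have := le_max_left (f y) (f z)
      have := le_max_right (f y) (f z)
      apply max_le <;> linarith
    · have e := codeDist_of_ne (f := f) (b := b) hxy
      have := le_max_left (f x) (f y)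
      have := le_max_right (f x) (f y)
      apply max_le <;> linarith

lemma eq_of_dist_eq_zero {x y : X} (h : codeDist s f b x y = 0) : x = y := by
  by_contra hne
  by_cases h0 : s x 0 = s y 0
  · rw [codeDist_of_eq hne h0] at h
    exact (H.pos _ _).ne' h
  · rw [codeDist_of_ne h0] at h
    have hx := H.eq_zero x (le_antisymm (h ▸ le_max_left _ _) (H.nonneg x))
    have hy := H.eq_zero y (le_antisymm (h ▸ le_max_right _ _) (H.nonneg y))
    exact hne (hx.trans hy.symm)

/-- The metric space structure given by `codeDist`. -/
noncomputable abbrev metricSpace : MetricSpace X where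
  dist := codeDist s f b
  dist_self := codeDist_self
  dist_comm := codeDist_comm
  dist_triangle := H.dist_triangle
  eq_of_dist_eq_zero := H.eq_of_dist_eq_zero

lemma dist_le_of_mem_cylinder {x y : X} {n : ℕ} (hn : 0 < n) (h : s y ∈ PiNat.cylinder (s x) n) :
    codeDist s f b y x ≤ b (s x 0) n := by
  by_cases hne : y = x
  · rw [hne, codeDist_self]; exact (H.pos _ _).le
  have h0 := h 0 hn
  rw [codeDist_of_eq hne h0, h0]
  exact H.anti _ ((PiNat.mem_cylinder_iff_le_firstDiff (H.inj.ne hne) n).1 h)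

lemma mem_cylinder_of_dist_lt {x y : X} {n : ℕ} (h0 : s x 0 = s y 0)
    (h : codeDist s f b x y < b (s x 0) n) : s x ∈ PiNat.cylinder (s y) n := by
  by_cases hne : x = y
  · rw [hne]; exact PiNat.self_mem_cylinder _ _
  rw [codeDist_of_eq hne h0] at h
  rw [PiNat.mem_cylinder_iff_le_firstDiff (H.inj.ne hne)]
  by_contra! hlt
  exact absurd (H.anti (s x 0) hlt.le) (not_le.2 h)

lemma exists_cylinder (x : X) {ε : ℝ} (hε : 0 < ε) :
    ∃ n, ∀ y, s y ∈ PiNat.cylinder (s x) n → codeDist s f b y x < ε := by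
  obtain ⟨n, hn, hn0⟩ :=
    (((H.lim (s x 0)).eventually (gt_mem_nhds hε)).and (eventually_gt_atTop 0)).exists
  exact ⟨n, fun y hy => (H.dist_le_of_mem_cylinder hn0 hy).trans_lt hn⟩

variable [TopologicalSpace S] [DiscreteTopology S]

lemma separableSpace [Countable S] :
    letI := H.metricSpace
    TopologicalSpace.SeparableSpace X := by
  let _ := H.metricSpace
  let e := Equiv.ofInjective s H.inj
  have hs : ∀ z : range s, s (e.symm z) = z := Equiv.apply_ofInjective_symm H.inj
  refine DenseRange.separableSpace (α := range s) e.symm.surjective.denseRange ?_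
  rw [continuous_iff_continuousAt]
  intro z
  rw [ContinuousAt, Metric.tendsto_nhds]
  intro ε hε
  obtain ⟨n, hn⟩ := H.exists_cylinder (e.symm z) hε
  have ho : IsOpen {w : range s | (w : ℕ → S) ∈ PiNat.cylinder (z : ℕ → S) n} :=
    (PiNat.isOpen_cylinder _ _ _).preimage continuous_subtype_val
  filter_upwards [ho.mem_nhds (PiNat.self_mem_cylinder _ _)] with w hw
  exact hn _ (by rw [hs, hs]; exact hw)

lemma completeSpace (hc : IsClosed (range s)) :
    letI := H.metricSpace
    CompleteSpace X := by
  let _ := H.metricSpace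
  refine Metric.complete_of_cauchySeq_tendsto fun u hu => ?_
  rw [Metric.cauchySeq_iff] at hu
  by_cases hconst : ∃ N, ∀ n ≥ N, s (u n) 0 = s (u N) 0
  · obtain ⟨N, hN⟩ := hconst
    have key : ∀ k, ∃ M, ∀ m ≥ M, ∀ n ≥ M, s (u m) ∈ PiNat.cylinder (s (u n)) k := by
      intro k
      obtain ⟨M, hM⟩ := hu _ (H.pos (s (u N) 0) k)
      refine ⟨max M N, fun m hm n hn => ?_⟩
      have h1 := hN m (le_of_max_le_right hm)
      have h2 := hN n (le_of_max_le_right hn)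
      refine H.mem_cylinder_of_dist_lt (h1.trans h2.symm) ?_
      rw [h1]
      exact hM m (le_of_max_le_left hm) n (le_of_max_le_left hn)
    choose M hM using key
    let z : ℕ → S := fun k => s (u (M (k + 1))) k
    have hz : ∀ k, ∀ n ≥ M (k + 1), s (u n) k = z k := fun k n hn =>
      hM (k + 1) n hn _ le_rfl k k.lt_succ_self
    have hlim : Tendsto (fun n => s (u n)) atTop (𝓝 z) := by
      rw [tendsto_pi_nhds]
      intro k
      refine tendsto_const_nhds.congr' ?_
      filter_upwards [eventually_ge_atTop (M (k + 1))] with n hn using (hz k n hn).symm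
    obtain ⟨x, hx⟩ := hc.mem_of_tendsto hlim (Eventually.of_forall fun n => mem_range_self (u n))
    refine ⟨x, ?_⟩
    rw [Metric.tendsto_nhds]
    intro ε hε
    obtain ⟨k, hk⟩ := H.exists_cylinder x hε
    have hev := hlim.eventually ((PiNat.isOpen_cylinder _ z k).mem_nhds (PiNat.self_mem_cylinder _ _))
    filter_upwards [hev] with n hn
    exact hk _ (by rw [hx]; exact hn)
  · push Not at hconst
    refine ⟨p, ?_⟩
    rw [Metric.tendsto_atTop]
    intro ε hε
    obtain ⟨M, hM⟩ := hu ε hε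
    refine ⟨M, fun n hn => ?_⟩
    obtain ⟨m, hm, hne⟩ := hconst n
    have h1 : codeDist s f b (u n) (u m) < ε := hM n hn m (hn.trans hm)
    rw [codeDist_of_ne hne.symm] at h1
    refine (H.dist_le_max (u n) p).trans_lt ?_
    rw [H.base, max_eq_left (H.nonneg _)]
    exact (le_max_left _ _).trans_lt h1

lemma exists_metricSpace [Countable S] (hc : IsClosed (range s)) {A : Set ℝ} (hA : range f = A)
    (hb : ∀ x y, x ≠ y → s x 0 = s y 0 → b (s x 0) (PiNat.firstDiff (s x) (s y)) ∈ A) :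
    ∃ (X : Type) (_ : MetricSpace X), CompleteSpace X ∧ TopologicalSpace.SeparableSpace X ∧
      {r : ℝ | ∃ x y : X, dist x y = r} = A := by
  refine ⟨X, H.metricSpace, H.completeSpace hc, H.separableSpace, ?_⟩
  ext r
  constructor
  · rintro ⟨x, y, rfl⟩
    change codeDist s f b x y ∈ A
    have hf : ∀ x, f x ∈ A := fun x => hA ▸ mem_range_self x
    by_cases h : x = y
    · rw [h, codeDist_self, ← H.base]; exact hf p
    by_cases h0 : s x 0 = s y 0
    · rw [codeDist_of_eq h h0]; exact hb x y h h0
    · rw [codeDist_of_ne h0]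
      rcases max_choice (f x) (f y) with e | e <;> rw [e] <;> exact hf _
  · intro hr
    rw [← hA] at hr
    obtain ⟨x, rfl⟩ := hr
    refine ⟨x, p, ?_⟩
    have h1 := H.dist_le_max x p
    have h2 := H.le_add_dist x p
    rw [H.base, max_eq_left (H.nonneg x)] at h1
    rw [H.base, zero_add] at h2
    exact le_antisymm h1 h2

end CodeData

end Construction

lemma exists_metricSpace_of_countable {A : Set ℝ} (hnn : ∀ a ∈ A, 0 ≤ a) (h0 : (0 : ℝ) ∈ A)
    (hA : A.Countable) :
    ∃ (X : Type) (_ : MetricSpace X), CompleteSpace X ∧ TopologicalSpace.SeparableSpace X ∧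
      {r : ℝ | ∃ x y : X, dist x y = r} = A := by
  have : Countable A := hA
  let S : Type := A
  let _ : TopologicalSpace S := ⊥
  have : DiscreteTopology S := ⟨rfl⟩
  have : Countable S := hA
  have H : CodeData (fun (a : S) (_ : ℕ) => a) (fun a : S => (a : ℝ))
      (fun _ n => 1 / ((n : ℝ) + 1)) (⟨0, h0⟩ : A) :=
    { inj := fun x y h => congrFun h 0
      nonneg := fun x => hnn x x.2
      eq_zero := fun x hx => Subtype.ext hx
      base := rfl
      anti := fun _ m n h => Nat.one_div_le_one_div h
      pos := fun _ n => Nat.one_div_pos_of_nat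
      lim := fun _ => tendsto_one_div_add_atTop_nhds_zero_nat
      lip := fun x y h h' => absurd h' h
      le := fun x y h h' => absurd h' h }
  refine H.exists_metricSpace ?_ Subtype.range_coe fun x y h h' => absurd h' h
  have : range (fun (a : S) (_ : ℕ) => a) = ⋂ n, {z : ℕ → S | z n = z 0} := by
    ext z
    simp only [mem_range, mem_iInter, mem_ofPred_eq]
    constructor
    · rintro ⟨a, rfl⟩ n
      rfl
    · exact fun h => ⟨z 0, funext fun n => (h n).symm⟩
  rw [this]
  exact isClosed_iInter fun n => isClosed_eq (continuous_apply n) (continuous_apply 0)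

/-- Codes of points of the Baire space together with approximations of `F` along the scales `a`,
with one extra constant code for the base point. -/
def approxCodes (F : (ℕ → ℕ) → ℝ) (a : ℕ → ℝ) : Set (ℕ → ℕ × ℤ) :=
  {fun _ => (0, 0)} ∪ {z | 1 ≤ (z 0).2 ∧ ∀ n,
    a ((z 0).1 + n) * (z n).2 ≤ F (fun i => (z (i + 1)).1) ∧
    F (fun i => (z (i + 1)).1) ≤ a ((z 0).1 + n) * ((z n).2 + 1)}

lemma isClosed_approxCodes {F : (ℕ → ℕ) → ℝ} (hF : Continuous F) (a : ℕ → ℝ) :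
    IsClosed (approxCodes F a) := by
  refine isClosed_singleton.union ?_
  have hFc : Continuous fun z : ℕ → ℕ × ℤ => F (fun i => (z (i + 1)).1) :=
    hF.comp (by fun_prop)
  have ha : ∀ n, Continuous fun z : ℕ → ℕ × ℤ => a ((z 0).1 + n) := fun n =>
    (continuous_of_discreteTopology (f := fun q : ℕ × ℤ => a (q.1 + n))).comp (continuous_apply 0)
  have hc : ∀ n, Continuous fun z : ℕ → ℕ × ℤ => ((z n).2 : ℝ) := fun n =>
    (continuous_of_discreteTopology (f := fun q : ℕ × ℤ => (q.2 : ℝ))).comp (continuous_apply n)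
  have h0 : Continuous fun z : ℕ → ℕ × ℤ => (z 0).2 := (continuous_apply 0).snd
  refine IsClosed.inter (isClosed_le continuous_const h0) ?_
  change IsClosed {z : ℕ → ℕ × ℤ | ∀ n, a ((z 0).1 + n) * (z n).2 ≤ F (fun i => (z (i + 1)).1) ∧
    F (fun i => (z (i + 1)).1) ≤ a ((z 0).1 + n) * ((z n).2 + 1)}
  rw [ofPred_forall]
  exact isClosed_iInter fun n => (isClosed_le ((ha n).mul (hc n)) hFc).inter
    (isClosed_le hFc ((ha n).mul ((hc n).add continuous_const)))

lemma exists_metricSpace_of_analyticSet {A : Set ℝ} (hnn : ∀ a ∈ A, 0 ≤ a) (h0 : (0 : ℝ) ∈ A)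
    (hA : MeasureTheory.AnalyticSet A) (hlim : ∀ ε > 0, ∃ a ∈ A, a ≠ 0 ∧ |a| < ε) :
    ∃ (X : Type) (_ : MetricSpace X), CompleteSpace X ∧ TopologicalSpace.SeparableSpace X ∧
      {r : ℝ | ∃ x y : X, dist x y = r} = A := by
  obtain ⟨F, hF, hFA⟩ : ∃ F : (ℕ → ℕ) → ℝ, Continuous F ∧ range F = A := by
    rw [MeasureTheory.AnalyticSet] at hA
    rcases hA with rfl | h
    · exact absurd h0 (notMem_empty _)
    · exact h
  obtain ⟨a, ha_anti, ha_pos, ha_lim, haA⟩ :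
      ∃ a : ℕ → ℝ, Antitone a ∧ (∀ n, 0 < a n) ∧ Tendsto a atTop (𝓝 0) ∧ ∀ n, a n ∈ A := by
    have hglb : IsGLB (A ∩ Ioi 0) (0 : ℝ) := by
      refine ⟨fun x hx => le_of_lt hx.2, fun c hc => ?_⟩
      by_contra! hpos
      obtain ⟨x, hx, hx0, hxc⟩ := hlim c hpos
      have := hc ⟨hx, lt_of_le_of_ne (hnn x hx) hx0.symm⟩
      linarith [le_abs_self x]
    have hne : (A ∩ Ioi (0 : ℝ)).Nonempty := by
      obtain ⟨x, hx, hx0, -⟩ := hlim 1 one_pos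
      exact ⟨x, hx, lt_of_le_of_ne (hnn x hx) hx0.symm⟩
    obtain ⟨a, h1, -, h3, h4⟩ :=
      hglb.exists_seq_strictAnti_tendsto_of_notMem (fun h => lt_irrefl (0 : ℝ) h.2) hne
    exact ⟨a, h1.antitone, fun n => (h4 n).2, h3, fun n => (h4 n).1⟩
  let T := approxCodes F a
  let α : (ℕ → ℕ × ℤ) → ℕ → ℕ := fun z i => (z (i + 1)).1
  let f : T → ℝ := fun z => if 1 ≤ (z.1 0).2 then F (α z.1) else 0
  let b : ℕ × ℤ → ℕ → ℝ := fun q n => a (q.1 + (n - 1))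
  let p : T := ⟨fun _ => (0, 0), Or.inl rfl⟩
  have hbase : ∀ z : T, ¬ 1 ≤ (z.1 0).2 → z = p := fun z hz =>
    Subtype.ext (z.2.resolve_right fun h => hz h.1)
  have hmain : ∀ z : T, 1 ≤ (z.1 0).2 → f z = F (α z.1) ∧ ∀ n,
      a ((z.1 0).1 + n) * (z.1 n).2 ≤ f z ∧ f z ≤ a ((z.1 0).1 + n) * ((z.1 n).2 + 1) := by
    intro z hz
    have hfz : f z = F (α z.1) := if_pos hz
    refine ⟨hfz, fun n => ?_⟩
    rcases z.2 with h | h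
    · have h' : z.1 = fun _ => (0, 0) := h
      rw [h'] at hz
      norm_num at hz
    · rw [hfz]; exact h.2 n
  have hge : ∀ z : T, 1 ≤ (z.1 0).2 → a (z.1 0).1 ≤ f z := by
    intro z hz
    have h1 := ((hmain z hz).2 0).1
    have h2 : (1 : ℝ) ≤ (z.1 0).2 := by exact_mod_cast hz
    have := le_mul_of_one_le_right (ha_pos (z.1 0).1).le h2
    simpa using this.trans h1
  have hp : f p = 0 := if_neg (by norm_num [p])
  have hone : ∀ x y : T, x ≠ y → x.1 0 = y.1 0 → 1 ≤ (x.1 0).2 := by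
    intro x y hxy h
    by_contra hx
    exact hxy ((hbase x hx).trans (hbase y (h ▸ hx)).symm)
  have H : CodeData (fun z : T => z.1) f b p :=
    { inj := Subtype.val_injective
      nonneg := fun z => by
        by_cases hz : 1 ≤ (z.1 0).2
        · exact (ha_pos _).le.trans (hge z hz)
        · rw [hbase z hz, hp]
      eq_zero := fun z h => by
        by_contra hne
        have hz : 1 ≤ (z.1 0).2 := by
          by_contra hz
          exact hne (hbase z hz)
        linarith [hge z hz, ha_pos (z.1 0).1]
      base := hp
      anti := fun q m n h => ha_anti (by omega)
      pos := fun q n => ha_pos _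
      lim := fun q => ha_lim.comp <| tendsto_atTop_mono (fun n => by omega : ∀ n, n - 1 ≤ _)
        (tendsto_sub_atTop_nat 1)
      lip := fun x y hxy h => by
        have hx := hone x y hxy h
        have hy : 1 ≤ (y.1 0).2 := h ▸ hx
        have hpos : PiNat.firstDiff x.1 y.1 ≠ 0 := fun hd => by
          have := PiNat.apply_firstDiff_ne (Subtype.val_injective.ne hxy)
          rw [hd] at this
          exact this h
        have hagree := PiNat.apply_eq_of_lt_firstDiff
          (show PiNat.firstDiff x.1 y.1 - 1 < PiNat.firstDiff x.1 y.1 by omega)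
        have h1 := (hmain x hx).2 (PiNat.firstDiff x.1 y.1 - 1)
        have h2 := (hmain y hy).2 (PiNat.firstDiff x.1 y.1 - 1)
        rw [← h, ← hagree] at h2
        change _ ≤ a ((x.1 0).1 + (PiNat.firstDiff x.1 y.1 - 1))
        rw [abs_le]
        constructor <;> linarith [h1.1, h1.2, h2.1, h2.2]
      le := fun x y hxy h => (ha_anti (Nat.le_add_right _ _)).trans (hge x (hone x y hxy h)) }
  refine H.exists_metricSpace ?_ ?_ fun x y _ _ => haA _
  · rw [Subtype.range_coe]
    exact isClosed_approxCodes hF a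
  · ext r
    constructor
    · rintro ⟨z, rfl⟩
      by_cases hz : 1 ≤ (z.1 0).2
      · rw [(hmain z hz).1, ← hFA]; exact mem_range_self _
      · rw [hbase z hz, hp]; exact h0
    · intro hr
      by_cases hr0 : r = 0
      · exact ⟨p, hp.trans hr0.symm⟩
      have hrpos : 0 < r := lt_of_le_of_ne (hnn r hr) (Ne.symm hr0)
      rw [← hFA] at hr
      obtain ⟨β, hβ⟩ := hr
      obtain ⟨k, hk⟩ := (ha_lim.eventually (gt_mem_nhds hrpos)).exists
      let z : ℕ → ℕ × ℤ := fun n => (n.casesOn k β, ⌊r / a (k + n)⌋)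
      have hz0 : 1 ≤ (z 0).2 := by
        change 1 ≤ ⌊r / a k⌋
        rw [Int.le_floor, Int.cast_one, one_le_div (ha_pos k)]
        exact hk.le
      have hz : z ∈ T := by
        refine Or.inr ⟨hz0, fun n => ?_⟩
        change a (k + n) * (⌊r / a (k + n)⌋ : ℝ) ≤ F β ∧
          F β ≤ a (k + n) * ((⌊r / a (k + n)⌋ : ℝ) + 1)
        have hpos := ha_pos (k + n)
        rw [hβ, mul_comm, ← le_div_iff₀ hpos, mul_comm, ← div_le_iff₀ hpos]
        exact ⟨Int.floor_le _, (Int.lt_floor_add_one _).le⟩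
      exact ⟨⟨z, hz⟩, (hmain ⟨z, hz⟩ hz0).1.trans hβ⟩

lemma analyticSet_range_dist (X : Type) [MetricSpace X] [CompleteSpace X]
    [TopologicalSpace.SeparableSpace X] :
    MeasureTheory.AnalyticSet {r : ℝ | ∃ x y : X, dist x y = r} := by
  have := UniformSpace.secondCountable_of_separable X
  have : {r : ℝ | ∃ x y : X, dist x y = r} = range fun q : X × X => dist q.1 q.2 := by
    ext r
    simp
  rw [this]
  exact MeasureTheory.analyticSet_range_of_polishSpace (by fun_prop)

lemma countable_range_dist (X : Type) [MetricSpace X] [TopologicalSpace.SeparableSpace X]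
    {ε : ℝ} (hε : 0 < ε) (h : ∀ x y : X, x ≠ y → ε ≤ dist x y) :
    {r : ℝ | ∃ x y : X, dist x y = r}.Countable := by
  have : DiscreteTopology X := by
    rw [discreteTopology_iff_isOpen_singleton]
    intro x
    rw [Metric.isOpen_singleton_iff]
    refine ⟨ε, hε, fun y hy => ?_⟩
    by_contra hne
    exact absurd (h y x hne) (not_le.2 hy)
  have : Countable X := TopologicalSpace.separableSpace_iff_countable.1 inferInstance
  have : {r : ℝ | ∃ x y : X, dist x y = r} = range fun q : X × X => dist q.1 q.2 := by
    ext r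
    simp
  rw [this]
  exact countable_range _

/-- A set `A ⊆ [0,∞)` with `0 ∈ A` is the distance set of some complete
separable metric space iff `A` is countable, or `A` is analytic and `0` is a limit point
of `A`. -/
theorem stmt_10 (A : Set ℝ) (hnn : ∀ a ∈ A, 0 ≤ a) (h0 : (0 : ℝ) ∈ A) :
    (∃ (X : Type) (_ : MetricSpace X), CompleteSpace X ∧ TopologicalSpace.SeparableSpace X ∧
      {r : ℝ | ∃ x y : X, dist x y = r} = A) ↔
    (A.Countable ∨
      (MeasureTheory.AnalyticSet A ∧ ∀ ε > 0, ∃ a ∈ A, a ≠ 0 ∧ |a| < ε)) := by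
  constructor
  · rintro ⟨X, _, _, _, rfl⟩
    by_cases hl : ∀ ε > 0, ∃ a ∈ {r : ℝ | ∃ x y : X, dist x y = r}, a ≠ 0 ∧ |a| < ε
    · exact Or.inr ⟨analyticSet_range_dist X, hl⟩
    · push Not at hl
      obtain ⟨ε, hε, h⟩ := hl
      refine Or.inl (countable_range_dist X hε fun x y hxy => ?_)
      simpa using h (dist x y) ⟨x, y, rfl⟩ (dist_ne_zero.2 hxy)
  · rintro (hA | ⟨hA, hl⟩)
    · exact exists_metricSpace_of_countable hnn h0 hA
    · exact exists_metricSpace_of_analyticSet hnn h0 hA hl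
end

section
/- A set A of non-negative real numbers with 0 ∈ A is the distance set of some complete separable metric space that is zero-dimensional (i.e., the clopen sets form a basis for its topology) if and only if A is countable, or A is an analytic subset of ℝ and 0 is a limit point of A. -/
open Set Filter Topology TopologicalSpace

/-- A complete separable metric space in which the small distances from any given point form a
countable set. Such spaces are zero-dimensional. -/
structure IsThinPolish (X : Type) [MetricSpace X] : Prop where
  complete : CompleteSpace X
  separable : SeparableSpace X
  thin : ∀ x : X, ∃ δ > 0, {r : ℝ | r < δ ∧ ∃ y, dist y x = r}.Countable

theorem IsThinPolish.isTopologicalBasis_isClopen {X : Type} [MetricSpace X] (h : IsThinPolish X) :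
    IsTopologicalBasis {s : Set X | IsClopen s} := by
  refine isTopologicalBasis_of_isOpen_of_nhds (fun u hu => hu.isOpen) fun x u hx hu => ?_
  obtain ⟨ε, hε, hεu⟩ := Metric.isOpen_iff.1 hu x hx
  obtain ⟨δ, hδ, hc⟩ := h.thin x
  obtain ⟨r, ⟨hr0, hr⟩, hrc⟩ : ∃ r ∈ Ioo 0 (min ε δ), r ∉ {r : ℝ | r < δ ∧ ∃ y, dist y x = r} := by
    by_contra! hcon
    have hIoo : (Ioo 0 (min ε δ)).Countable := hc.mono hcon
    have := hIoo.measure_zero MeasureTheory.volume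
    simp only [Real.volume_Ioo, sub_zero, ENNReal.ofReal_eq_zero] at this
    exact absurd (lt_min hε hδ) this.not_gt
  have hball : Metric.ball x r = Metric.closedBall x r := by
    ext y
    simp only [Metric.mem_ball, Metric.mem_closedBall]
    refine ⟨le_of_lt, fun hy => lt_of_le_of_ne hy fun heq => ?_⟩
    exact hrc ⟨hr.trans_le (min_le_right _ _), y, heq⟩
  refine ⟨Metric.ball x r, ⟨hball ▸ Metric.isClosed_closedBall, Metric.isOpen_ball⟩,
    Metric.mem_ball_self hr0, ?_⟩
  exact (Metric.ball_subset_ball (hr.le.trans (min_le_left _ _))).trans hεu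

/-- A set of nonnegative reals carries the ultrametric `max a b` for `a ≠ b`. -/
theorem exists_max_metric (A : Set ℝ) (hnn : ∀ a ∈ A, 0 ≤ a) :
    ∃ (X : Type) (_ : MetricSpace X) (e : X ≃ A),
      ∀ x y, x ≠ y → dist x y = max (e x : ℝ) (e y) := by
  classical
  let D : A → A → ℝ := fun a b => if a = b then 0 else max (a : ℝ) b
  have hpos : ∀ a b : A, a ≠ b → 0 < max (a : ℝ) b := by
    intro a b hab
    rcases lt_or_gt_of_ne (fun h => hab (Subtype.ext h)) with h | h
    · exact lt_max_of_lt_right ((hnn a a.2).trans_lt h)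
    · exact lt_max_of_lt_left ((hnn b b.2).trans_lt h)
  let m : MetricSpace A :=
    { dist := D
      dist_self := fun a => by simp [D]
      dist_comm := fun a b => by simp only [D, eq_comm (a := a), max_comm]
      dist_triangle := fun a b c => by
        have hb := hnn b b.2
        by_cases hab : a = b
        · simp [D, hab]
        by_cases hbc : b = c
        · simp [D, hbc]
        simp only [D, if_neg hab, if_neg hbc]
        split_ifs
        · positivity
        refine max_le ?_ ?_
        · linarith [le_max_left (a : ℝ) b, hb.trans (le_max_left (b : ℝ) c)]
        · linarith [le_max_right (b : ℝ) c, hb.trans (le_max_right (a : ℝ) b)]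
      eq_of_dist_eq_zero := fun {a b} h => by
        by_contra hab
        have h' : D a b = 0 := h
        simp only [D, if_neg hab] at h'
        exact (hpos a b hab).ne' h' }
  exact ⟨A, m, Equiv.refl _, fun x y hxy => if_neg hxy⟩

theorem exists_isThinPolish_of_countable {A : Set ℝ} (hnn : ∀ a ∈ A, 0 ≤ a) (h0 : (0 : ℝ) ∈ A)
    (hA : A.Countable) :
    ∃ (X : Type) (_ : MetricSpace X), IsThinPolish X ∧ {r : ℝ | ∃ x y : X, dist x y = r} = A := by
  obtain ⟨X, _, e, he⟩ := exists_max_metric A hnn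
  have hX : Countable X := by
    have := hA.to_subtype
    exact e.injective.countable
  have hzero : ∀ x, dist x (e.symm ⟨0, h0⟩) = e x := by
    intro x
    by_cases hx : x = e.symm ⟨0, h0⟩
    · simp [hx]
    · rw [he _ _ hx]
      simpa using hnn _ (e x).2
  refine ⟨X, inferInstance, ⟨?_, inferInstance, ?_⟩, ?_⟩
  · refine Metric.complete_of_cauchySeq_tendsto fun u hu => ?_
    by_cases hconst : ∃ N, ∀ n ≥ N, u n = u N
    · obtain ⟨N, hN⟩ := hconst
      exact ⟨u N, tendsto_const_nhds.congr' (eventually_atTop.2 ⟨N, fun n hn => (hN n hn).symm⟩)⟩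
    · push Not at hconst
      refine ⟨e.symm ⟨0, h0⟩, Metric.tendsto_atTop.2 fun ε hε => ?_⟩
      obtain ⟨N, hN⟩ := Metric.cauchySeq_iff.1 hu ε hε
      obtain ⟨k, hk, hne⟩ := hconst N
      refine ⟨N, fun n hn => ?_⟩
      rw [hzero]
      by_cases hnN : u n = u N
      · have := hN k hk N le_rfl
        rw [he _ _ hne] at this
        rw [hnN]
        exact (le_max_right _ _).trans_lt this
      · have := hN n hn N le_rfl
        rw [he _ _ hnN] at this
        exact (le_max_left _ _).trans_lt this
  · intro x
    refine ⟨1, one_pos, (countable_range fun y : X => dist y x).mono ?_⟩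
    rintro r ⟨-, y, rfl⟩
    exact mem_range_self y
  · ext r
    constructor
    · rintro ⟨x, y, rfl⟩
      by_cases hxy : x = y
      · simpa [hxy] using h0
      · rw [he _ _ hxy]
        rcases max_choice (e x : ℝ) (e y) with h | h <;> rw [h] <;> exact Subtype.coe_prop _
    · intro hr
      exact ⟨e.symm ⟨r, hr⟩, e.symm ⟨0, h0⟩, by simp [hzero]⟩

/-- A decreasing sequence of equivalence relations with trivial intersection is the sequence of
closed-ball relations, of radii `r n`, of an ultrametric. -/
theorem exists_metric_dist_le_iff {Q : Type} {r : ℕ → ℝ} (hr : StrictAnti r) (hr0 : ∀ n, 0 < r n)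
    (E : ℕ → Q → Q → Prop) (hE0 : ∀ x y, E 0 x y) (hE : ∀ n x y, E (n + 1) x y → E n x y)
    (hrefl : ∀ n x, E n x x) (hsymm : ∀ n x y, E n x y → E n y x)
    (htrans : ∀ n x y z, E n x y → E n y z → E n x z) (hsep : ∀ x y, (∀ n, E n x y) → x = y) :
    ∃ (P : Type) (_ : MetricSpace P) (e : P ≃ Q), (∀ x y : P, x ≠ y → ∃ n, dist x y = r n) ∧
      ∀ n (x y : P), dist x y ≤ r n ↔ E n (e x) (e y) := by
  classical
  have hanti : ∀ {m n x y}, m ≤ n → E n x y → E m x y := by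
    intro m n x y hmn
    induction n, hmn using Nat.le_induction with
    | base => exact id
    | succ n _ ih => exact fun h => ih (hE n x y h)
  let D : Q → Q → ℝ := fun x y =>
    if h : ∃ n, ¬ E (n + 1) x y then r (Nat.find h) else 0
  have hself : ∀ x, D x x = 0 := fun x => dif_neg (by simp [hrefl])
  have hrange : ∀ x y, x ≠ y → ∃ n, D x y = r n := by
    intro x y hxy
    have h : ∃ n, ¬ E (n + 1) x y := by
      by_contra! h
      refine hxy (hsep x y fun n => ?_)
      cases n with
      | zero => exact hE0 x y
      | succ n => exact h n
    exact ⟨Nat.find h, dif_pos h⟩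
  have hle : ∀ n x y, D x y ≤ r n ↔ E n x y := by
    intro n x y
    by_cases h : ∃ n, ¬ E (n + 1) x y
    · simp only [D, dif_pos h, hr.le_iff_ge]
      constructor
      · intro hn
        cases n with
        | zero => exact hE0 x y
        | succ n => exact not_not.1 (Nat.find_min h hn)
      · intro hEn
        by_contra! hlt
        exact Nat.find_spec h (hanti hlt hEn)
    · simp only [D, dif_neg h, (hr0 n).le, true_iff]
      push Not at h
      cases n with
      | zero => exact hE0 x y
      | succ n => exact h n
  have hnonneg : ∀ x y, 0 ≤ D x y := by
    intro x y
    by_cases hxy : x = y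
    · rw [hxy, hself]
    · obtain ⟨n, hn⟩ := hrange x y hxy
      exact hn ▸ (hr0 n).le
  have hsymmle : ∀ x y, D x y ≤ D y x := by
    intro x y
    by_cases hxy : x = y
    · rw [hxy]
    · obtain ⟨n, hn⟩ := hrange y x (Ne.symm hxy)
      rw [hn]
      exact (hle _ _ _).2 (hsymm _ _ _ ((hle _ _ _).1 hn.le))
  let m : MetricSpace Q :=
    { dist := D
      dist_self := hself
      dist_comm := fun x y => le_antisymm (hsymmle x y) (hsymmle y x)
      dist_triangle := fun x y z => by
        by_cases hxy : x = y
        · subst hxy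
          linarith [hself x]
        by_cases hyz : y = z
        · subst hyz
          linarith [hself y]
        obtain ⟨n, hn⟩ := hrange x y hxy
        obtain ⟨k, hk⟩ := hrange y z hyz
        have h1 := (hle _ _ _).1 hn.le
        have h2 := (hle _ _ _).1 hk.le
        rcases le_total n k with hnk | hnk
        · linarith [(hle _ _ _).2 (htrans _ _ _ _ h1 (hanti hnk h2)), hnonneg y z]
        · linarith [(hle _ _ _).2 (htrans _ _ _ _ (hanti hnk h1) h2), hnonneg x y]
      eq_of_dist_eq_zero := fun {x y} h => by
        by_contra hxy
        obtain ⟨n, hn⟩ := hrange x y hxy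
        exact (hr0 n).ne' (hn.symm.trans h) }
  exact ⟨Q, m, Equiv.refl _, hrange, hle⟩

/-- Any continuous function of small oscillation on the Baire space is `1`-Lipschitz for some
complete separable ultrametric whose positive distances lie in a given null sequence. -/
theorem exists_metric_lipschitz {r : ℕ → ℝ} (hr : StrictAnti r) (hr0 : ∀ n, 0 < r n)
    (hlim : Tendsto r atTop (𝓝 0)) {φ : (ℕ → ℕ) → ℝ} (hφ : Continuous φ)
    (hosc : ∀ x y, |φ x - φ y| ≤ r 0) :
    ∃ (P : Type) (_ : MetricSpace P) (e : P ≃ (ℕ → ℕ)), CompleteSpace P ∧ SeparableSpace P ∧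
      (∀ x y : P, x ≠ y → ∃ n, dist x y = r n) ∧ ∀ x y : P, |φ (e x) - φ (e y)| ≤ dist x y := by
  let E : ℕ → (ℕ → ℕ) → (ℕ → ℕ) → Prop := fun n x y => ∃ m ≥ n, y ∈ PiNat.cylinder x m ∧
    ∀ z ∈ PiNat.cylinder x m, ∀ w ∈ PiNat.cylinder x m, |φ z - φ w| ≤ r n
  have hnhds : ∀ n x, ∃ m ≥ n, ∀ y ∈ PiNat.cylinder x m, E n x y := by
    intro n x
    have hU : φ ⁻¹' Metric.ball (φ x) (r n / 2) ∈ 𝓝 x :=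
      hφ.continuousAt (Metric.ball_mem_nhds _ (half_pos (hr0 n)))
    obtain ⟨V, ⟨z, k, rfl⟩, hxV, hV⟩ :=
      (PiNat.isTopologicalBasis_cylinders fun _ : ℕ => ℕ).mem_nhds_iff.1 hU
    rw [← PiNat.mem_cylinder_iff_eq.1 hxV] at hV
    refine ⟨max n k, le_max_left _ _, fun y hy => ⟨max n k, le_max_left _ _, hy, ?_⟩⟩
    intro z hz w hw
    have h1 := hV (PiNat.cylinder_anti x (le_max_right n k) hz)
    have h2 := hV (PiNat.cylinder_anti x (le_max_right n k) hw)
    simp only [mem_preimage, Metric.mem_ball, Real.dist_eq] at h1 h2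
    rw [abs_lt] at h1 h2
    rw [abs_le]
    constructor <;> linarith
  have hmem : ∀ n x y, E n x y → y ∈ PiNat.cylinder x n := fun n x y ⟨m, hm, hy, _⟩ =>
    PiNat.cylinder_anti x hm hy
  obtain ⟨P, _, e, hrange, hle⟩ := exists_metric_dist_le_iff hr hr0 E
    (fun x y => ⟨0, le_rfl, by simp, fun z _ w _ => hosc z w⟩)
    (fun n x y ⟨m, hm, hy, h⟩ => ⟨m, by omega, hy,
      fun z hz w hw => (h z hz w hw).trans (hr.antitone n.le_succ)⟩)
    (fun n x => by
      obtain ⟨m, -, hm⟩ := hnhds n x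
      exact hm x (PiNat.self_mem_cylinder x m))
    (fun n x y ⟨m, hm, hy, h⟩ => by
      rw [← PiNat.mem_cylinder_iff_eq.1 hy] at h
      exact ⟨m, hm, (PiNat.mem_cylinder_comm _ _ _).1 hy, h⟩)
    (by
      rintro n x y z ⟨m, hm, hy, h⟩ ⟨k, hk, hz, h'⟩
      have hxy := PiNat.mem_cylinder_iff_eq.1 hy
      rcases le_total m k with hmk | hmk
      · exact ⟨m, hm, hxy ▸ PiNat.cylinder_anti y hmk hz, h⟩
      · refine ⟨k, hk, ?_, ?_⟩ <;>
          rw [← PiNat.mem_cylinder_iff_eq.1 (PiNat.cylinder_anti x hmk hy)] <;> assumption)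
    (fun x y h => by
      ext i
      exact (PiNat.mem_cylinder_iff.1 (hmem _ _ _ (h (i + 1))) i i.lt_succ_self).symm)
  have hsmall : ∀ ε > 0, ∃ n, r n < ε := fun ε hε => (hlim.eventually_lt_const hε).exists
  have hcont : Continuous e.symm := by
    rw [continuous_iff_continuousAt]
    intro x
    rw [ContinuousAt, Metric.tendsto_nhds]
    intro ε hε
    obtain ⟨n, hn⟩ := hsmall ε hε
    obtain ⟨m, -, hm⟩ := hnhds n x
    filter_upwards [(PiNat.isOpen_cylinder _ x m).mem_nhds (PiNat.self_mem_cylinder x m)] with y hy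
    rw [dist_comm]
    refine lt_of_le_of_lt ?_ hn
    rw [hle]
    simpa using hm y hy
  refine ⟨P, inferInstance, e, ?_, ?_, hrange, ?_⟩
  · refine Metric.complete_of_cauchySeq_tendsto fun u hu => ?_
    have hstab : ∀ n, ∃ N, ∀ k ≥ N, ∀ i < n, e (u k) i = e (u N) i := by
      intro n
      obtain ⟨N, hN⟩ := Metric.cauchySeq_iff'.1 hu (r n) (hr0 n)
      refine ⟨N, fun k hk => PiNat.mem_cylinder_iff.1 (hmem _ _ _ ((hle _ _ _).1 ?_))⟩
      rw [dist_comm]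
      exact (hN k hk).le
    choose N hN using hstab
    have hlim' : Tendsto (fun k => e (u k)) atTop (𝓝 fun i => e (u (N (i + 1))) i) := by
      rw [tendsto_pi_nhds]
      intro i
      exact tendsto_const_nhds.congr' (eventually_atTop.2
        ⟨N (i + 1), fun k hk => (hN (i + 1) k hk i i.lt_succ_self).symm⟩)
    refine ⟨_, ((hcont.tendsto _).comp hlim').congr fun k => ?_⟩
    simp
  · exact e.symm.surjective.denseRange.separableSpace hcont
  · intro x y
    by_cases hxy : x = y
    · simp [hxy]
    · obtain ⟨n, hn⟩ := hrange x y hxy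
      obtain ⟨m, -, hy, h⟩ := (hle _ _ _).1 hn.le
      rw [hn]
      exact h _ (PiNat.self_mem_cylinder _ m) _ hy

/-- One-point extension of a metric space by a Katětov function. -/
theorem exists_metric_cone {P : Type} [MetricSpace P] {f : P → ℝ} (hf : ∀ x, 0 < f x)
    (h1 : ∀ x y, |f x - f y| ≤ dist x y) (h2 : ∀ x y, dist x y ≤ f x + f y) :
    ∃ (X : Type) (_ : MetricSpace X) (i : P → X) (q : X), Isometry i ∧ (∀ x, dist q (i x) = f x) ∧
      ∀ x, x = q ∨ ∃ p, i p = x := by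
  let D : Option P → Option P → ℝ
    | none, none => 0
    | none, some x => f x
    | some x, none => f x
    | some x, some y => dist x y
  let m : MetricSpace (Option P) :=
    { dist := D
      dist_self := by rintro (_ | x) <;> simp [D]
      dist_comm := by rintro (_ | x) (_ | y) <;> simp [D, dist_comm]
      dist_triangle := by
        rintro (_ | x) (_ | y) (_ | z) <;> simp only [D]
        · simp
        · simp
        · linarith [hf y]
        · linarith [(abs_le.1 (h1 y z)).1]
        · simp
        · exact h2 x z
        · linarith [(abs_le.1 (h1 x y)).2]
        · exact dist_triangle x y z
      eq_of_dist_eq_zero := by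
        rintro (_ | x) (_ | y) h
        · rfl
        · exact absurd h (hf y).ne'
        · exact absurd h (hf x).ne'
        · exact congrArg some (dist_eq_zero.1 h) }
  refine ⟨Option P, m, some, none, Isometry.of_dist_eq fun _ _ => rfl, fun _ => rfl, ?_⟩
  rintro (_ | x)
  · exact Or.inl rfl
  · exact Or.inr ⟨x, rfl⟩

/-- The disjoint union of metric spaces, points of distinct pieces `i`, `j` being at distance
`max (c i) (c j)`. -/
theorem exists_metric_glue {ι : Type} {X : ι → Type} [∀ i, MetricSpace (X i)] {c : ι → ℝ}
    (hc : ∀ i, 0 < c i) (hX : ∀ i (x y : X i), dist x y ≤ 2 * c i) :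
    ∃ (Y : Type) (_ : MetricSpace Y) (j : ∀ i, X i → Y), (∀ i, Isometry (j i)) ∧
      (∀ i k x y, i ≠ k → dist (j i x) (j k y) = max (c i) (c k)) ∧ ∀ y, ∃ i x, j i x = y := by
  classical
  let D : (Σ i, X i) → (Σ i, X i) → ℝ := fun x y =>
    if h : x.1 = y.1 then dist (h ▸ x.2 : X y.1) y.2 else max (c x.1) (c y.1)
  have hsame : ∀ i (x y : X i), D ⟨i, x⟩ ⟨i, y⟩ = dist x y := fun i x y => dif_pos rfl
  have hdiff : ∀ i k (x : X i) (y : X k), i ≠ k → D ⟨i, x⟩ ⟨k, y⟩ = max (c i) (c k) :=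
    fun i k x y h => dif_neg h
  let m : MetricSpace (Σ i, X i) :=
    { dist := D
      dist_self := fun x => by simp [D]
      dist_comm := by
        rintro ⟨i, x⟩ ⟨k, y⟩
        by_cases h : i = k
        · subst h
          rw [hsame, hsame, dist_comm]
        · rw [hdiff _ _ _ _ h, hdiff _ _ _ _ (Ne.symm h), max_comm]
      dist_triangle := by
        rintro ⟨i, x⟩ ⟨k, y⟩ ⟨l, z⟩
        by_cases hik : i = k
        · subst hik
          by_cases hil : i = l
          · subst hil
            simp only [hsame]
            exact dist_triangle x y z
          · rw [hsame, hdiff _ _ _ _ hil, hdiff _ _ _ _ hil]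
            linarith [dist_nonneg (x := x) (y := y)]
        · by_cases hil : i = l
          · subst hil
            rw [hsame, hdiff _ _ _ _ hik, hdiff _ _ _ _ (Ne.symm hik)]
            linarith [hX i x z, le_max_left (c i) (c k), le_max_right (c k) (c i)]
          · rw [hdiff _ _ _ _ hik, hdiff _ _ _ _ hil]
            by_cases hkl : k = l
            · subst hkl
              rw [hsame]
              linarith [dist_nonneg (x := y) (y := z)]
            · rw [hdiff _ _ _ _ hkl]
              refine max_le ?_ ?_
              · linarith [hc k, le_max_left (c i) (c k), le_max_left (c k) (c l)]
              · linarith [hc k, le_max_right (c i) (c k), le_max_right (c k) (c l)]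
      eq_of_dist_eq_zero := by
        rintro ⟨i, x⟩ ⟨k, y⟩ h
        by_cases hik : i = k
        · subst hik
          rw [dist_eq_zero.1 ((hsame i x y).symm.trans h)]
        · exact absurd ((hdiff i k x y hik).symm.trans h) (lt_max_of_lt_left (hc i)).ne' }
  exact ⟨Σ i, X i, m, Sigma.mk, fun i => Isometry.of_dist_eq (hsame i), hdiff,
    fun y => ⟨y.1, y.2, rfl⟩⟩

theorem exists_isThinPolish_glue {ι : Type} [Countable ι] {X : ι → Type}
    [∀ i, MetricSpace (X i)] (hthin : ∀ i, IsThinPolish (X i)) {c : ι → ℝ} {s : ℝ} (hs : 0 < s)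
    (hc : ∀ i, s ≤ c i) (hX : ∀ i (x y : X i), dist x y ≤ 2 * c i) :
    ∃ (Y : Type) (_ : MetricSpace Y) (j : ∀ i, X i → Y), IsThinPolish Y ∧ (∀ i, Isometry (j i)) ∧
      (∀ i k x y, i ≠ k → dist (j i x) (j k y) = max (c i) (c k)) ∧ ∀ y, ∃ i x, j i x = y := by
  obtain ⟨Y, _, j, hj, hdist, hsurj⟩ :=
    exists_metric_glue (X := X) (fun i => hs.trans_le (hc i)) hX
  have huniv : ⋃ i, range (j i) = univ := by
    refine eq_univ_of_forall fun y => ?_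
    obtain ⟨i, x, rfl⟩ := hsurj y
    exact mem_iUnion.2 ⟨i, mem_range_self x⟩
  refine ⟨Y, inferInstance, j, ⟨?_, ?_, ?_⟩, hj, hdist, hsurj⟩
  · refine completeSpace_of_isComplete_univ ?_
    rw [← huniv]
    refine isComplete_iUnion_separated (fun i => ?_) (Metric.dist_mem_uniformity hs) ?_
    · have := (hthin i).complete
      exact (hj i).isUniformInducing.isComplete_range
    · rintro i k _ ⟨x, rfl⟩ _ ⟨y, rfl⟩ hxy
      by_contra hik
      have hxy : dist (j i x) (j k y) < s := hxy
      rw [hdist _ _ _ _ hik] at hxy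
      exact absurd ((hc i).trans (le_max_left _ (c k))) hxy.not_ge
  · rw [← isSeparable_univ_iff, ← huniv]
    refine IsSeparable.iUnion fun i => ?_
    have := (hthin i).separable
    exact isSeparable_range (hj i).continuous
  · intro y
    obtain ⟨i, x, rfl⟩ := hsurj y
    obtain ⟨δ, hδ, hcount⟩ := (hthin i).thin x
    refine ⟨min δ s, lt_min hδ hs, hcount.mono ?_⟩
    rintro _ ⟨hlt, z, rfl⟩
    obtain ⟨k, z, rfl⟩ := hsurj z
    by_cases hki : k = i
    · subst hki
      rw [(hj k).dist_eq] at hlt ⊢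
      exact ⟨hlt.trans_le (min_le_left _ _), z, rfl⟩
    · rw [hdist _ _ _ _ hki] at hlt
      exact absurd ((hc k).trans (le_max_left _ (c i))) (hlt.trans_le (min_le_right _ _)).not_ge

/-- A short interval of an analytic set is covered by the distances of one metric space. -/
theorem exists_isThinPolish_of_range {A : Set ℝ} (h0 : (0 : ℝ) ∈ A) {r : ℕ → ℝ} (hr : StrictAnti r)
    (hr0 : ∀ n, 0 < r n) (hlim : Tendsto r atTop (𝓝 0)) (hrA : ∀ n, r n ∈ A)
    {φ : (ℕ → ℕ) → ℝ} (hφ : Continuous φ) (hφA : ∀ x, φ x ∈ A) {l : ℝ} (hl : r 0 ≤ l)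
    (hφl : ∀ x, φ x ∈ Ico l (l + r 0)) :
    ∃ (X : Type) (_ : MetricSpace X), IsThinPolish X ∧ (∀ x y : X, dist x y ∈ A) ∧
      (∀ x y : X, dist x y ≤ l + r 0) ∧ ∀ z, ∃ x y : X, dist x y = φ z := by
  obtain ⟨P, _, e, _, _, hrange, hlip⟩ := exists_metric_lipschitz hr hr0 hlim hφ fun x y => by
    have hx := hφl x
    have hy := hφl y
    rw [abs_le]
    constructor <;> linarith [hx.1, hx.2, hy.1, hy.2]
  have hl0 : 0 < l := (hr0 0).trans_le hl
  have hP : ∀ x y : P, dist x y ≤ r 0 := by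
    intro x y
    by_cases hxy : x = y
    · simp [hxy, (hr0 0).le]
    · obtain ⟨n, hn⟩ := hrange x y hxy
      exact hn ▸ hr.antitone n.zero_le
  have hPA : ∀ x y : P, dist x y ∈ insert 0 (range r) := by
    intro x y
    by_cases hxy : x = y
    · simp [hxy]
    · obtain ⟨n, hn⟩ := hrange x y hxy
      exact Or.inr ⟨n, hn.symm⟩
  have hsub : insert 0 (range r) ⊆ A := insert_subset h0 (range_subset_iff.2 hrA)
  obtain ⟨X, _, i, q, hi, hq, hcases⟩ := exists_metric_cone (P := P) (f := fun x => φ (e x))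
    (fun x => hl0.trans_le (hφl _).1) hlip
    (fun x y => by linarith [hP x y, (hφl (e x)).1, (hφl (e y)).1])
  have hdist : ∀ x y : X, dist x y ∈ insert 0 (range r) ∨ ∃ z, dist x y = φ z := by
    intro x y
    rcases hcases x with rfl | ⟨p, rfl⟩ <;> rcases hcases y with rfl | ⟨p', rfl⟩
    · simp
    · exact Or.inr ⟨_, hq p'⟩
    · exact Or.inr ⟨_, (dist_comm _ _).trans (hq p)⟩
    · exact Or.inl (hi.dist_eq p p' ▸ hPA p p')
  have huniv : range i ∪ {q} = univ := by
    refine eq_univ_of_forall fun x => ?_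
    rcases hcases x with rfl | ⟨p, rfl⟩
    · exact Or.inr rfl
    · exact Or.inl (mem_range_self p)
  refine ⟨X, inferInstance, ⟨?_, ?_, ?_⟩, ?_, ?_, ?_⟩
  · refine completeSpace_of_isComplete_univ ?_
    rw [← huniv]
    exact hi.isUniformInducing.isComplete_range.union isCompact_singleton.isComplete
  · rw [← isSeparable_univ_iff, ← huniv]
    exact (isSeparable_range hi.continuous).union (countable_singleton q).isSeparable
  · intro x
    refine ⟨l, hl0, ((countable_range r).insert 0).mono ?_⟩
    rintro _ ⟨hlt, y, rfl⟩
    rcases hdist y x with h | ⟨z, hz⟩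
    · exact h
    · exact absurd (hφl z).1 (hz ▸ hlt).not_ge
  · intro x y
    rcases hdist x y with h | ⟨z, hz⟩
    · exact hsub h
    · exact hz ▸ hφA z
  · intro x y
    rcases hdist x y with h | ⟨z, hz⟩
    · rcases h with h | ⟨n, hn⟩
      · rw [h]
        linarith [hr0 0]
      · rw [← hn]
        linarith [hr.antitone n.zero_le]
    · exact hz ▸ (hφl z).2.le
  · intro z
    exact ⟨q, i (e.symm z), by simp [hq]⟩

theorem exists_isThinPolish_of_analytic {A : Set ℝ} (hnn : ∀ a ∈ A, 0 ≤ a) (h0 : (0 : ℝ) ∈ A)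
    (hA : MeasureTheory.AnalyticSet A) (hlim : ∀ ε > 0, ∃ a ∈ A, a ≠ 0 ∧ |a| < ε) :
    ∃ (X : Type) (_ : MetricSpace X), IsThinPolish X ∧ {r : ℝ | ∃ x y : X, dist x y = r} = A := by
  obtain ⟨r, hr, hr0, hrlim, hrA⟩ : ∃ r : ℕ → ℝ, StrictAnti r ∧ (∀ n, 0 < r n) ∧
      Tendsto r atTop (𝓝 0) ∧ ∀ n, r n ∈ A ∩ Ioi 0 := by
    have hpos : ∀ ε > 0, ∃ a ∈ A ∩ Ioi 0, a < ε := fun ε hε => by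
      obtain ⟨a, ha, hne, hlt⟩ := hlim ε hε
      exact ⟨a, ⟨ha, lt_of_le_of_ne (hnn a ha) hne.symm⟩, (le_abs_self a).trans_lt hlt⟩
    refine IsGLB.exists_seq_strictAnti_tendsto_of_notMem (t := A ∩ Ioi 0)
      ⟨fun a ha => le_of_lt ha.2, fun b hb => ?_⟩ (by simp) ?_
    · by_contra! hb0
      obtain ⟨a, ha, hlt⟩ := hpos b hb0
      exact hlt.not_ge (hb ha)
    · obtain ⟨a, ha, -⟩ := hpos 1 one_pos
      exact ⟨a, ha⟩
  let B : ℕ × ℕ → Set ℝ := fun p => A ∩ Ico ((p.2 + 1) * r p.1) ((p.2 + 1) * r p.1 + r p.1)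
  let ι := {p : ℕ × ℕ // (B p).Nonempty}
  have hcover : ∀ a ∈ A, a ≠ 0 → ∃ i : ι, a ∈ B i.1 := by
    intro a ha hne
    have ha0 : 0 < a := lt_of_le_of_ne (hnn a ha) hne.symm
    obtain ⟨n, hn⟩ := (hrlim.eventually_lt_const ha0).exists
    have h1 : 1 ≤ ⌊a / r n⌋₊ := by
      rw [Nat.one_le_floor_iff, one_le_div (hr0 n)]
      exact hn.le
    obtain ⟨m, hm⟩ := Nat.exists_eq_add_of_le' h1
    have hle := Nat.floor_le (div_nonneg ha0.le (hr0 n).le)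
    have hlt := Nat.lt_floor_add_one (a / r n)
    rw [hm, le_div_iff₀ (hr0 n)] at hle
    rw [hm, div_lt_iff₀ (hr0 n)] at hlt
    push_cast at hle hlt
    have haB : a ∈ B (n, m) := ⟨ha, hle, by linarith⟩
    exact ⟨⟨(n, m), ⟨a, haB⟩⟩, haB⟩
  have hpiece : ∀ i : ι, ∃ (X : Type) (_ : MetricSpace X), IsThinPolish X ∧
      (∀ x y : X, dist x y ∈ A) ∧
      (∀ x y : X, dist x y ≤ (i.1.2 + 1) * r i.1.1 + r i.1.1) ∧
      ∀ a ∈ B i.1, ∃ x y : X, dist x y = a := by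
    rintro ⟨⟨n, m⟩, hne⟩
    have hB : MeasureTheory.AnalyticSet (B (n, m)) := by
      have hI : ∀ b : Bool, MeasureTheory.AnalyticSet
          (cond b A (Ico (((m : ℝ) + 1) * r n) ((m + 1) * r n + r n))) := by
        rintro (_ | _)
        · exact measurableSet_Ico.analyticSet
        · exact hA
      have := MeasureTheory.AnalyticSet.iInter hI
      rwa [← inter_eq_iInter] at this
    rw [MeasureTheory.AnalyticSet] at hB
    obtain ⟨φ, hφ, hφB⟩ := hB.resolve_left hne.ne_empty
    have hmem : ∀ x, φ x ∈ B (n, m) := fun x => hφB ▸ mem_range_self x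
    obtain ⟨X, _, hX, hXA, hXle, hXφ⟩ := exists_isThinPolish_of_range h0
      (r := fun k => r (k + n)) (fun a b hab => hr (by omega)) (fun k => hr0 _)
      (hrlim.comp (tendsto_add_atTop_nat n)) (fun k => (hrA _).1) hφ (fun x => (hmem x).1)
      (l := (m + 1) * r n) (by simp only [zero_add]; nlinarith [hr0 n, m.cast_nonneg (α := ℝ)])
      (fun x => by simpa only [zero_add] using (hmem x).2)
    refine ⟨X, inferInstance, hX, hXA, by simpa only [zero_add] using hXle, fun a ha => ?_⟩
    obtain ⟨z, rfl⟩ := hφB.symm ▸ ha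
    exact hXφ z
  choose X instX hthin hXA hXle hXB using hpiece
  choose b hb using fun i : ι => i.2
  have hcA : ∀ i, max (b i) (r 0) ∈ A := fun i => by
    rcases max_choice (b i) (r 0) with h | h <;> rw [h]
    exacts [(hb i).1, (hrA 0).1]
  obtain ⟨Y, _, j, hY, hj, hdist, hsurj⟩ := exists_isThinPolish_glue hthin (hr0 0)
    (c := fun i => max (b i) (r 0)) (fun i => le_max_right _ _) (fun i x y => by
      have h1 := hXle i x y
      have h2 := (hb i).2.1
      have h3 := le_max_left (b i) (r 0)
      nlinarith [hr0 i.1.1, i.1.2.cast_nonneg (α := ℝ)])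
  refine ⟨Y, inferInstance, hY, ?_⟩
  have hmem : ∀ a ∈ A, a ≠ 0 → ∃ x y : Y, dist x y = a := by
    intro a ha hne
    obtain ⟨i, hi⟩ := hcover a ha hne
    obtain ⟨x, y, hxy⟩ := hXB i a hi
    exact ⟨j i x, j i y, (hj i).dist_eq x y ▸ hxy⟩
  ext a
  constructor
  · rintro ⟨x, y, rfl⟩
    obtain ⟨i, x, rfl⟩ := hsurj x
    obtain ⟨k, y, rfl⟩ := hsurj y
    by_cases hik : i = k
    · subst hik
      rw [(hj i).dist_eq]
      exact hXA i x y
    · rw [hdist _ _ _ _ hik]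
      rcases max_choice (max (b i) (r 0)) (max (b k) (r 0)) with h | h <;> rw [h]
      exacts [hcA i, hcA k]
  · intro ha
    by_cases hne : a = 0
    · obtain ⟨x, -, -⟩ := hmem (r 0) (hrA 0).1 (hr0 0).ne'
      exact ⟨x, x, by simp [hne]⟩
    · exact hmem a ha hne

theorem countable_or_analytic_of_polish {X : Type} [MetricSpace X] [CompleteSpace X]
    [SeparableSpace X] :
    {r : ℝ | ∃ x y : X, dist x y = r}.Countable ∨
      (MeasureTheory.AnalyticSet {r : ℝ | ∃ x y : X, dist x y = r} ∧
        ∀ ε > 0, ∃ a ∈ {r : ℝ | ∃ x y : X, dist x y = r}, a ≠ 0 ∧ |a| < ε) := by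
  have hrange : {r : ℝ | ∃ x y : X, dist x y = r} = range fun p : X × X => dist p.1 p.2 := by
    ext r
    simp
  have : SecondCountableTopology X := UniformSpace.secondCountable_of_separable X
  by_cases hlim : ∀ ε > 0, ∃ a ∈ {r : ℝ | ∃ x y : X, dist x y = r}, a ≠ 0 ∧ |a| < ε
  · refine Or.inr ⟨?_, hlim⟩
    rw [hrange]
    exact MeasureTheory.analyticSet_range_of_polishSpace continuous_dist
  · left
    push Not at hlim
    obtain ⟨ε, hε, h⟩ := hlim
    have : DiscreteTopology X := DiscreteTopology.of_forall_le_dist hε fun x y hxy => by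
      simpa using h _ ⟨x, y, rfl⟩ (dist_ne_zero.2 hxy)
    have : Countable X := separableSpace_iff_countable.1 inferInstance
    rw [hrange]
    exact countable_range _

/-- A set `A ⊆ [0,∞)` with `0 ∈ A` is the distance set of some
zero-dimensional complete separable metric space (the clopen sets form a basis for the
topology) iff `A` is countable, or `A` is analytic and `0` is a limit point of `A`. -/
theorem stmt_11 (A : Set ℝ) (hnn : ∀ a ∈ A, 0 ≤ a) (h0 : (0 : ℝ) ∈ A) :
    (∃ (X : Type) (_ : MetricSpace X), CompleteSpace X ∧ TopologicalSpace.SeparableSpace X ∧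
      TopologicalSpace.IsTopologicalBasis {s : Set X | IsClopen s} ∧
      {r : ℝ | ∃ x y : X, dist x y = r} = A) ↔
    (A.Countable ∨
      (MeasureTheory.AnalyticSet A ∧ ∀ ε > 0, ∃ a ∈ A, a ≠ 0 ∧ |a| < ε)) := by
  constructor
  · rintro ⟨X, _, _, _, -, rfl⟩
    exact countable_or_analytic_of_polish
  · intro h
    obtain ⟨X, _, hX, hXA⟩ := h.elim (exists_isThinPolish_of_countable hnn h0)
      fun h => exists_isThinPolish_of_analytic hnn h0 h.1 h.2
    exact ⟨X, inferInstance, hX.complete, hX.separable, hX.isTopologicalBasis_isClopen, hXA⟩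
end

section
/- Let A be a compact set of non-negative real numbers with 0 ∈ A such that 0 is a limit point of A. Then there exists a compact metric space (X,d) whose distance set equals A. -/
/-- The distance set of a totally bounded metric space, if closed, is the distance set of a
compact metric space, namely of the completion. -/
theorem exists_compactSpace_of_totallyBounded {T : Type} [MetricSpace T]
    (htb : TotallyBounded (Set.univ : Set T))
    (hcl : IsClosed {r : ℝ | ∃ x y : T, dist x y = r}) :
    ∃ (X : Type) (_ : MetricSpace X), CompactSpace X ∧
      {r : ℝ | ∃ x y : X, dist x y = r} = {r : ℝ | ∃ x y : T, dist x y = r} := by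
  refine ⟨UniformSpace.Completion T, inferInstance, ?_, ?_⟩
  · rw [← isCompact_univ_iff, isCompact_iff_totallyBounded_isComplete]
    refine ⟨?_, isClosed_univ.isComplete⟩
    have h := (htb.image (UniformSpace.Completion.uniformContinuous_coe T)).closure
    rwa [Set.image_univ, UniformSpace.Completion.denseRange_coe.closure_range] at h
  · refine Set.Subset.antisymm ?_ ?_
    · rintro r ⟨x, y, rfl⟩
      induction x, y using UniformSpace.Completion.induction_on₂ with
      | hp => exact hcl.preimage (continuous_fst.dist continuous_snd)
      | ih x y => exact ⟨x, y, (UniformSpace.Completion.dist_eq x y).symm⟩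
    · rintro r ⟨x, y, rfl⟩
      exact ⟨x, y, UniformSpace.Completion.dist_eq x y⟩

/-- The contribution of the `k`-th level to `gridDist v x y`: it is `v k` if `x` and `y` lie in
different cells of the grid of mesh `v (k + 1)`, and `0` otherwise. -/
noncomputable def gridTerm (v : ℕ → ℝ) (x y : ℝ) (k : ℕ) : ℝ :=
  if ⌊x / v (k + 1)⌋₊ = ⌊y / v (k + 1)⌋₊ then 0 else v k

/-- The ultrametric on `[0, v 0]` associated with a sequence of grids of mesh `v (k + 1)`. -/
noncomputable def gridDist (v : ℕ → ℝ) (x y : ℝ) : ℝ := ⨆ k, gridTerm v x y k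

theorem abs_sub_lt_of_floor_eq {x y w : ℝ} (hw : 0 < w) (hx : 0 ≤ x) (hy : 0 ≤ y)
    (h : ⌊x / w⌋₊ = ⌊y / w⌋₊) : |x - y| < w := by
  have hx1 := Nat.floor_le (div_nonneg hx hw.le)
  have hy1 := Nat.floor_le (div_nonneg hy hw.le)
  have hx2 := Nat.lt_floor_add_one (x / w)
  have hy2 := Nat.lt_floor_add_one (y / w)
  rw [h] at hx1 hx2
  rw [le_div_iff₀ hw] at hx1 hy1
  rw [div_lt_iff₀ hw] at hx2 hy2
  rw [abs_lt]
  constructor <;> linarith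

section gridDist

variable {v : ℕ → ℝ}

theorem gridTerm_nonneg (hpos : ∀ k, 0 < v k) (x y : ℝ) (k : ℕ) : 0 ≤ gridTerm v x y k := by
  unfold gridTerm
  split_ifs
  exacts [le_rfl, (hpos k).le]

theorem gridTerm_le (hpos : ∀ k, 0 < v k) (x y : ℝ) (k : ℕ) : gridTerm v x y k ≤ v k := by
  unfold gridTerm
  split_ifs
  exacts [(hpos k).le, le_rfl]

theorem gridTerm_le_gridDist (hpos : ∀ k, 0 < v k) (hv : Antitone v) (x y : ℝ) (k : ℕ) :
    gridTerm v x y k ≤ gridDist v x y :=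
  le_ciSup (f := gridTerm v x y)
    ⟨v 0, Set.forall_mem_range.2 fun k => (gridTerm_le hpos x y k).trans (hv k.zero_le)⟩ k

theorem gridDist_nonneg (hpos : ∀ k, 0 < v k) (x y : ℝ) : 0 ≤ gridDist v x y :=
  Real.iSup_nonneg (gridTerm_nonneg hpos x y)

theorem gridDist_self (x : ℝ) : gridDist v x x = 0 := by
  simp [gridDist, gridTerm]

theorem gridDist_comm (x y : ℝ) : gridDist v x y = gridDist v y x := by
  simp only [gridDist, gridTerm, eq_comm]

theorem gridDist_triangle_max (hpos : ∀ k, 0 < v k) (hv : Antitone v) (x y z : ℝ) :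
    gridDist v x z ≤ max (gridDist v x y) (gridDist v y z) := by
  refine ciSup_le fun k => ?_
  have h : gridTerm v x z k ≤ max (gridTerm v x y k) (gridTerm v y z k) := by
    have := hpos k
    unfold gridTerm
    split_ifs <;> simp_all [this.le]
  exact h.trans (max_le_max (gridTerm_le_gridDist hpos hv x y k)
    (gridTerm_le_gridDist hpos hv y z k))

theorem gridDist_le_of_floor_eq (hpos : ∀ k, 0 < v k) (hv : Antitone v) {x y : ℝ} {n : ℕ}
    (h : ∀ k < n, ⌊x / v (k + 1)⌋₊ = ⌊y / v (k + 1)⌋₊) : gridDist v x y ≤ v n := by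
  refine ciSup_le fun k => ?_
  rcases lt_or_ge k n with hk | hk
  · rw [gridTerm, if_pos (h k hk)]
    exact (hpos n).le
  · exact (gridTerm_le hpos x y k).trans (hv hk)

/-- The grid distance of distinct points is one of the `v n`, and dominates the usual distance. -/
theorem exists_gridDist_eq (hpos : ∀ k, 0 < v k) (hv : Antitone v)
    (hlim : Filter.Tendsto v Filter.atTop (nhds 0)) {x y : ℝ} (hx : x ∈ Set.Icc 0 (v 0))
    (hy : y ∈ Set.Icc 0 (v 0)) (hxy : x ≠ y) :
    ∃ n, gridDist v x y = v n ∧ |x - y| ≤ v n := by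
  classical
  have hex : ∃ k, ⌊x / v (k + 1)⌋₊ ≠ ⌊y / v (k + 1)⌋₊ := by
    by_contra! h
    have hle : |x - y| ≤ 0 := ge_of_tendsto' ((Filter.tendsto_add_atTop_iff_nat 1).2 hlim)
      fun k => (abs_sub_lt_of_floor_eq (hpos _) hx.1 hy.1 (h k)).le
    exact hxy (sub_eq_zero.1 (abs_nonpos_iff.1 hle))
  have hmin : ∀ k < Nat.find hex, ⌊x / v (k + 1)⌋₊ = ⌊y / v (k + 1)⌋₊ :=
    fun k hk => not_not.1 (Nat.find_min hex hk)
  refine ⟨Nat.find hex, le_antisymm (gridDist_le_of_floor_eq hpos hv hmin) ?_, ?_⟩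
  · have h := gridTerm_le_gridDist hpos hv x y (Nat.find hex)
    rwa [gridTerm, if_neg (Nat.find_spec hex)] at h
  · rcases hn : Nat.find hex with _ | m
    · rw [abs_le]
      constructor <;> linarith [hx.1, hx.2, hy.1, hy.2]
    · exact (abs_sub_lt_of_floor_eq (hpos _) hx.1 hy.1 (hmin m (by omega))).le

theorem abs_sub_le_gridDist (hpos : ∀ k, 0 < v k) (hv : Antitone v)
    (hlim : Filter.Tendsto v Filter.atTop (nhds 0)) {x y : ℝ} (hx : x ∈ Set.Icc 0 (v 0))
    (hy : y ∈ Set.Icc 0 (v 0)) : |x - y| ≤ gridDist v x y := by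
  rcases eq_or_ne x y with rfl | hxy
  · simp [gridDist_self]
  · obtain ⟨n, hn, hle⟩ := exists_gridDist_eq hpos hv hlim hx hy hxy
    rwa [hn]

/-- The metric `min (gridDist v x y) (max x y)` on a subset of `[0, v 0]`. -/
noncomputable abbrev gridMetricSpace (hpos : ∀ k, 0 < v k) (hv : Antitone v)
    (hlim : Filter.Tendsto v Filter.atTop (nhds 0)) (A : Set ℝ) (hA : A ⊆ Set.Icc 0 (v 0)) :
    MetricSpace A where
  dist x y := min (gridDist v x y) (max x y)
  dist_self x := by simp [gridDist_self, (hA x.2).1]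
  dist_comm x y := by simp only [gridDist_comm, max_comm]
  dist_triangle x y z := by
    have hx := (hA x.2).1
    have hy := (hA y.2).1
    have hz := (hA z.2).1
    have hxy := abs_le.1 (abs_sub_le_gridDist hpos hv hlim (hA x.2) (hA y.2))
    have hyz := abs_le.1 (abs_sub_le_gridDist hpos hv hlim (hA y.2) (hA z.2))
    have hu := gridDist_triangle_max hpos hv x y z
    have h1 := gridDist_nonneg hpos x y
    have h2 := gridDist_nonneg hpos y z
    have hsum := hu.trans (max_le_add_of_nonneg h1 h2)
    rcases min_cases (gridDist v x y) (max (x : ℝ) y) with h | h <;>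
    rcases min_cases (gridDist v y z) (max (y : ℝ) z) with h' | h' <;>
    rw [h.1, h'.1]
    · exact (min_le_left _ _).trans hsum
    all_goals
      refine (min_le_right _ _).trans (max_le ?_ ?_) <;>
      linarith [le_max_left (x : ℝ) y, le_max_right (x : ℝ) y, le_max_left (y : ℝ) z,
        le_max_right (y : ℝ) z]
  eq_of_dist_eq_zero {x y} h := by
    have hle := abs_sub_le_gridDist hpos hv hlim (hA x.2) (hA y.2)
    have hx := (hA x.2).1
    have hy := (hA y.2).1
    have hle' : |(x : ℝ) - y| ≤ max (x : ℝ) y := by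
      rw [abs_le]
      constructor <;> linarith [le_max_left (x : ℝ) y, le_max_right (x : ℝ) y]
    have h0 : |(x : ℝ) - y| ≤ 0 := (le_min hle hle').trans_eq h
    exact Subtype.ext (sub_eq_zero.1 (abs_nonpos_iff.1 h0))

theorem totallyBounded_gridMetricSpace (hpos : ∀ k, 0 < v k) (hv : Antitone v)
    (hlim : Filter.Tendsto v Filter.atTop (nhds 0)) (A : Set ℝ) (hA : A ⊆ Set.Icc 0 (v 0)) :
    letI := gridMetricSpace hpos hv hlim A hA
    @TotallyBounded A this.toUniformSpace Set.univ := by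
  let inst := gridMetricSpace hpos hv hlim A hA
  refine @Metric.totallyBounded_of_finite_discretization A inst.toPseudoMetricSpace _
    fun ε hε => ?_
  obtain ⟨n, hn⟩ := (hlim.eventually (gt_mem_nhds hε)).exists
  refine ⟨∀ k : Fin n, Fin (⌊v 0 / v (k + 1)⌋₊ + 1), inferInstance,
    fun x k => ⟨⌊(x.1 : ℝ) / v (k + 1)⌋₊, Nat.lt_succ_of_le (Nat.floor_le_floor
      (div_le_div_of_nonneg_right (hA x.1.2).2 (hpos _).le))⟩, fun x y hxy => ?_⟩
  refine lt_of_le_of_lt ((min_le_left _ _).trans (gridDist_le_of_floor_eq hpos hv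
    fun k hk => ?_)) hn
  exact Fin.val_eq_of_eq (congrFun hxy ⟨k, hk⟩)

theorem distSet_gridMetricSpace (hpos : ∀ k, 0 < v k) (hv : Antitone v)
    (hlim : Filter.Tendsto v Filter.atTop (nhds 0)) (A : Set ℝ) (hA : A ⊆ Set.Icc 0 (v 0))
    (h0 : (0 : ℝ) ∈ A) (hvA : ∀ k, v k ∈ A) :
    letI := gridMetricSpace hpos hv hlim A hA
    {r : ℝ | ∃ x y : A, this.dist x y = r} = A := by
  ext r
  constructor
  · rintro ⟨x, y, rfl⟩
    change min (gridDist v x y) (max (x : ℝ) y) ∈ A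
    have hmax : max (x : ℝ) y ∈ A := by
      rcases max_choice (x : ℝ) y with h | h <;> rw [h]
      exacts [x.2, y.2]
    have hgrid : gridDist v x y ∈ A := by
      rcases eq_or_ne (x : ℝ) y with h | h
      · rwa [h, gridDist_self]
      · obtain ⟨n, hn, -⟩ := exists_gridDist_eq hpos hv hlim (hA x.2) (hA y.2) h
        exact hn ▸ hvA n
    rcases min_choice (gridDist v x y) (max (x : ℝ) y) with h | h <;> rw [h]
    exacts [hgrid, hmax]
  · intro hr
    refine ⟨⟨r, hr⟩, ⟨0, h0⟩, ?_⟩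
    change min (gridDist v r 0) (max r 0) = r
    have hle := abs_sub_le_gridDist hpos hv hlim (hA hr) (hA h0)
    rw [sub_zero, abs_of_nonneg (hA hr).1] at hle
    rw [max_eq_left (hA hr).1, min_eq_right hle]

end gridDist

/-- If `A ⊆ [0,∞)` with `0 ∈ A` is compact and has `0` as a limit point, then
`A` is the distance set of some compact metric space. -/
theorem stmt_12 (A : Set ℝ) (hnn : ∀ a ∈ A, 0 ≤ a) (h0 : (0 : ℝ) ∈ A)
    (hcomp : IsCompact A) (hlim : ∀ ε > 0, ∃ a ∈ A, a ≠ 0 ∧ |a| < ε) :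
    ∃ (X : Type) (_ : MetricSpace X), CompactSpace X ∧
      {r : ℝ | ∃ x y : X, dist x y = r} = A := by
  obtain ⟨M, hMA, hM⟩ := hcomp.exists_isGreatest ⟨0, h0⟩
  have hsmall : ∀ ε > 0, ∃ a ∈ A \ {0}, a < ε := fun ε hε => by
    obtain ⟨a, ha, hne, hlt⟩ := hlim ε hε
    exact ⟨a, ⟨ha, hne⟩, (le_abs_self a).trans_lt hlt⟩
  have hglb : IsGLB (A \ {0}) 0 := by
    refine ⟨fun a ha => hnn a ha.1, fun b hb => ?_⟩
    by_contra! hb0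
    obtain ⟨a, ha, hlt⟩ := hsmall b hb0
    exact (hb ha).not_gt hlt
  obtain ⟨u, hu, hupos, hu0, huA⟩ := hglb.exists_seq_strictAnti_tendsto_of_notMem
    (by simp) (let ⟨a, ha, _⟩ := hsmall 1 one_pos; ⟨a, ha⟩)
  let v : ℕ → ℝ := fun n => Nat.casesOn n M u
  have hvA : ∀ k, v k ∈ A := by
    rintro (_ | k)
    exacts [hMA, (huA k).1]
  have hpos : ∀ k, 0 < v k := by
    rintro (_ | k)
    exacts [(hupos 0).trans_le (hM (huA 0).1), hupos k]
  have hv : Antitone v := by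
    refine antitone_nat_of_succ_le ?_
    rintro (_ | k)
    exacts [hM (huA 0).1, (hu k.lt_succ_self).le]
  have hv0 : Filter.Tendsto v Filter.atTop (nhds 0) :=
    (Filter.tendsto_add_atTop_iff_nat 1).1 hu0
  have hA : A ⊆ Set.Icc 0 (v 0) := fun a ha => ⟨hnn a ha, hM ha⟩
  have hdist := distSet_gridMetricSpace hpos hv hv0 A hA h0 hvA
  obtain ⟨X, hX, hXc, hXd⟩ := @exists_compactSpace_of_totallyBounded A
    (gridMetricSpace hpos hv hv0 A hA) (totallyBounded_gridMetricSpace hpos hv hv0 A hA)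
    (hdist.symm ▸ hcomp.isClosed)
  exact ⟨X, hX, hXc, hXd.trans hdist⟩
end

section
/- A set A of non-negative real numbers with 0 ∈ A is the distance set of some compact metric space if and only if A is finite, or A is compact and 0 is a limit point of A. -/
open Set Filter Topology

/-- If `δ` is an ultrametric on `C` and `f ≥ 0` is `1`-Lipschitz for `δ`, then
`min (δ x y) (max (f x) (f y))` satisfies the triangle inequality. -/
theorem min_max_triangle {C : Type*} {δ : C → C → ℝ} {f : C → ℝ}
    (hultra : ∀ x y z, δ x z ≤ max (δ x y) (δ y z)) (hδ : ∀ x y, 0 ≤ δ x y)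
    (hf : ∀ x, 0 ≤ f x) (hlip : ∀ x y, |f x - f y| ≤ δ x y) (x y z : C) :
    min (δ x z) (max (f x) (f z)) ≤
      min (δ x y) (max (f x) (f y)) + min (δ y z) (max (f y) (f z)) := by
  have h₁ := abs_le.1 (hlip x y)
  have h₂ := abs_le.1 (hlip y z)
  have := hultra x y z
  have := hδ x y
  have := hδ y z
  have := hf x
  have := hf y
  have := hf z
  grind

/-- A compact space with an ultrametric-like function `δ` valued in `A` and a `1`-Lipschitz
surjection onto `A` yields a compact metric space with distance set `A`. -/
theorem exists_compact_metricSpace_of_ultrametric {A : Set ℝ} (hnn : ∀ a ∈ A, 0 ≤ a)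
    (h0 : (0 : ℝ) ∈ A) (C : Type) [TopologicalSpace C] [CompactSpace C]
    (δ : C → C → ℝ) (f : C → ℝ) (hself : ∀ x, δ x x = 0) (hcomm : ∀ x y, δ x y = δ y x)
    (hultra : ∀ x y z, δ x z ≤ max (δ x y) (δ y z)) (hδA : ∀ x y, δ x y ∈ A)
    (hlip : ∀ x y, |f x - f y| ≤ δ x y) (hrange : range f = A)
    (hnhds : ∀ x, ∀ ε > 0, ∀ᶠ y in 𝓝 x, δ y x < ε) :
    ∃ (X : Type) (_ : MetricSpace X), CompactSpace X ∧
      {r : ℝ | ∃ x y : X, dist x y = r} = A := by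
  have hfA : ∀ x, f x ∈ A := fun x => hrange ▸ mem_range_self x
  have hf : ∀ x, 0 ≤ f x := fun x => hnn _ (hfA x)
  have hδ : ∀ x y, 0 ≤ δ x y := fun x y => hnn _ (hδA x y)
  obtain ⟨D, ⟨e⟩⟩ : ∃ D : Type, Nonempty (D ≃ C) := ⟨C, ⟨Equiv.refl C⟩⟩
  let : PseudoMetricSpace D :=
    { dist := fun x y => min (δ (e x) (e y)) (max (f (e x)) (f (e y)))
      dist_self := fun x => by simp [hself, hf]
      dist_comm := fun x y => by rw [hcomm, max_comm]
      dist_triangle := fun _ _ _ => min_max_triangle hultra hδ hf hlip _ _ _ }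
  have hdist : ∀ x y : D, dist x y = min (δ (e x) (e y)) (max (f (e x)) (f (e y))) :=
    fun _ _ => rfl
  have he : Continuous e.symm := by
    refine continuous_iff_continuousAt.2 fun x => Metric.tendsto_nhds.2 fun ε hε => ?_
    filter_upwards [hnhds x ε hε] with y hy
    rw [hdist, e.apply_symm_apply, e.apply_symm_apply]
    exact (min_le_left _ _).trans_lt hy
  have hD : CompactSpace D := e.symm.surjective.compactSpace he
  refine ⟨SeparationQuotient D, inferInstance,
    SeparationQuotient.surjective_mk.compactSpace SeparationQuotient.continuous_mk, ?_⟩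
  ext r
  constructor
  · rintro ⟨x, y, rfl⟩
    obtain ⟨x, rfl⟩ := SeparationQuotient.surjective_mk x
    obtain ⟨y, rfl⟩ := SeparationQuotient.surjective_mk y
    rw [SeparationQuotient.dist_mk, hdist]
    rcases min_choice (δ (e x) (e y)) (max (f (e x)) (f (e y))) with h | h <;> rw [h]
    · exact hδA _ _
    · rcases max_choice (f (e x)) (f (e y)) with h | h <;> rw [h] <;> exact hfA _
  · intro hr
    obtain ⟨c, rfl⟩ := hrange.symm ▸ hr
    obtain ⟨c₀, hc₀⟩ := hrange.symm ▸ h0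
    refine ⟨SeparationQuotient.mk (e.symm c), SeparationQuotient.mk (e.symm c₀), ?_⟩
    have h := (le_abs_self _).trans (hlip c c₀)
    rw [hc₀, sub_zero] at h
    rw [SeparationQuotient.dist_mk, hdist, e.apply_symm_apply, e.apply_symm_apply, hc₀,
      max_eq_left (hf c), min_eq_right h]

/-- Every finite set of non-negative reals containing `0` is the distance set of a compact
metric space. -/
theorem Set.Finite.exists_compact_metricSpace {A : Set ℝ} (hA : A.Finite)
    (hnn : ∀ a ∈ A, 0 ≤ a) (h0 : (0 : ℝ) ∈ A) :
    ∃ (X : Type) (_ : MetricSpace X), CompactSpace X ∧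
      {r : ℝ | ∃ x y : X, dist x y = r} = A := by
  classical
  obtain ⟨M, hMA, hM⟩ := hA.exists_maximal ⟨0, h0⟩
  have hM' : ∀ a ∈ A, a ≤ M := fun a ha => (le_total a M).elim id (hM ha)
  have hM0 : 0 ≤ M := hnn M hMA
  have := hA.to_subtype
  refine exists_compact_metricSpace_of_ultrametric hnn h0 A
    (fun x y => if x = y then 0 else M) (fun x => x) ?_ ?_ ?_ ?_ ?_ ?_ ?_
  · simp
  · intro x y
    simp only [eq_comm]
  · intro x y z
    grind
  · intro x y
    split_ifs <;> assumption
  · intro x y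
    split_ifs with h
    · simp [h]
    · rw [abs_le]
      have := hM' x x.2
      have := hM' y y.2
      have := hnn x x.2
      have := hnn y y.2
      constructor <;> linarith
  · simp
  · intro x ε hε
    rw [nhds_discrete]
    simpa using hε

/-- Every compact set of non-negative reals containing `0` as a limit point is the distance set
of a compact metric space. -/
theorem IsCompact.exists_compact_metricSpace {A : Set ℝ} (hA : IsCompact A)
    (hnn : ∀ a ∈ A, 0 ≤ a) (h0 : (0 : ℝ) ∈ A) (hlim : ∀ ε > 0, ∃ a ∈ A, a ≠ 0 ∧ |a| < ε) :
    ∃ (X : Type) (_ : MetricSpace X), CompactSpace X ∧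
      {r : ℝ | ∃ x y : X, dist x y = r} = A := by
  obtain ⟨M, hMA, hM⟩ := hA.exists_isGreatest ⟨0, h0⟩
  have hM0 : 0 < M := by
    obtain ⟨a, ha, hne, -⟩ := hlim 1 one_pos
    exact ((hnn a ha).lt_of_ne' hne).trans_le (hM ha)
  have hg : ∀ t : ℝ, ∃ b, t ≤ M → IsLeast (A ∩ Ici t) b := fun t => by
    by_cases ht : t ≤ M
    · obtain ⟨b, hb⟩ := (hA.inter_right isClosed_Ici).exists_isLeast ⟨M, hMA, ht⟩
      exact ⟨b, fun _ => hb⟩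
    · exact ⟨0, fun h => absurd h ht⟩
  choose g hg using hg
  have hmono : ∀ s t, s ≤ t → t ≤ M → g s ≤ g t := fun s t hst ht =>
    (hg s (hst.trans ht)).2 ⟨(hg t ht).1.1, hst.trans (hg t ht).1.2⟩
  have hg0 : g 0 = 0 := le_antisymm ((hg 0 hM0.le).2 ⟨h0, self_mem_Ici⟩) (hg 0 hM0.le).1.2
  let : Dist (ℕ → Fin 2) := PiNat.dist
  have hle : ∀ x y : ℕ → Fin 2, M * dist x y ≤ M := fun x y =>
    mul_le_of_le_one_right hM0.le (PiNat.dist_le_one x y)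
  let f : (ℕ → Fin 2) → ℝ := fun x => M * Real.ofDigits x
  have hf : Continuous f := continuous_const.mul Real.continuous_ofDigits
  have hC : CompactSpace (f ⁻¹' A) :=
    isCompact_iff_compactSpace.1 (hA.isClosed.preimage hf).isCompact
  refine exists_compact_metricSpace_of_ultrametric hnn h0 (f ⁻¹' A)
    (fun x y => g (M * dist x.1 y.1)) (fun x => f x) ?_ ?_ ?_ ?_ ?_ ?_ ?_
  · intro x
    simp only [PiNat.dist_self, mul_zero, hg0]
  · intro x y
    simp only [PiNat.dist_comm]
  · intro x y z
    rcases le_max_iff.1 (PiNat.dist_triangle_nonarch x.1 y.1 z.1) with h | h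
    · exact le_max_of_le_left (hmono _ _ (mul_le_mul_of_nonneg_left h hM0.le) (hle _ _))
    · exact le_max_of_le_right (hmono _ _ (mul_le_mul_of_nonneg_left h hM0.le) (hle _ _))
  · intro x y
    exact (hg _ (hle _ _)).1.1
  · intro x y
    refine le_trans ?_ (hg _ (hle _ _)).1.2
    simp only [f]
    rw [← mul_sub, abs_mul, abs_of_pos hM0]
    refine mul_le_mul_of_nonneg_left ?_ hM0.le
    rcases eq_or_ne x.1 y.1 with h | h
    · rw [h, sub_self, abs_zero]
      exact PiNat.dist_nonneg _ _
    · rw [PiNat.dist_eq_of_ne h]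
      simpa using Real.abs_ofDigits_sub_ofDigits_le (x := x.1) (y := y.1)
        fun i (hi : i < PiNat.firstDiff x.1 y.1) => PiNat.apply_eq_of_lt_firstDiff hi
  · ext a
    constructor
    · rintro ⟨x, rfl⟩
      exact x.2
    · intro ha
      obtain ⟨x, -, hx⟩ := Real.ofDigits_SurjOn (b := 2) one_lt_two
        (show a / M ∈ Icc (0 : ℝ) 1 from
          ⟨div_nonneg (hnn a ha) hM0.le, (div_le_one hM0).2 (hM ha)⟩)
      have hfx : f x = a := by
        simp only [f, hx]
        field_simp
      exact ⟨⟨x, by rwa [mem_preimage, hfx]⟩, hfx⟩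
  · intro x ε hε
    obtain ⟨a, ha, hne, haε⟩ := hlim ε hε
    have ha0 : 0 < a := (hnn a ha).lt_of_ne' hne
    obtain ⟨n, hn⟩ := exists_pow_lt_of_lt_one (div_pos ha0 hM0) (one_half_lt_one (α := ℝ))
    have hcyl : ∀ᶠ y in 𝓝 x.1, y ∈ PiNat.cylinder x.1 n :=
      (PiNat.isOpen_cylinder _ x.1 n).mem_nhds (PiNat.self_mem_cylinder x.1 n)
    filter_upwards [continuous_subtype_val.continuousAt.eventually hcyl] with y hy
    have hd : M * dist y.1 x.1 ≤ a := by
      have := (PiNat.mem_cylinder_iff_dist_le.1 hy).trans hn.le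
      rwa [le_div_iff₀' hM0] at this
    exact ((hg _ (hle _ _)).2 ⟨ha, hd⟩).trans_lt ((le_abs_self a).trans_lt haε)

/-- A compact metric space whose nonzero distances are bounded away from `0` is finite. -/
theorem finite_of_compactSpace_of_le_dist {X : Type*} [MetricSpace X] [CompactSpace X] {ε : ℝ}
    (hε : 0 < ε) (h : ∀ x y : X, x ≠ y → ε ≤ dist x y) : Finite X := by
  have := DiscreteTopology.of_forall_le_dist hε (fun x y hxy => h x y hxy)
  exact finite_of_compact_of_discrete

/-- A set `A ⊆ [0,∞)` with `0 ∈ A` is the distance set of some compact metric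
space iff `A` is finite, or `A` is compact and `0` is a limit point of `A`. -/
theorem stmt_14 (A : Set ℝ) (hnn : ∀ a ∈ A, 0 ≤ a) (h0 : (0 : ℝ) ∈ A) :
    (∃ (X : Type) (_ : MetricSpace X), CompactSpace X ∧
      {r : ℝ | ∃ x y : X, dist x y = r} = A) ↔
    (A.Finite ∨ (IsCompact A ∧ ∀ ε > 0, ∃ a ∈ A, a ≠ 0 ∧ |a| < ε)) := by
  constructor
  · rintro ⟨X, _, _, rfl⟩
    have hr : {r : ℝ | ∃ x y : X, dist x y = r} = range fun p : X × X => dist p.1 p.2 := by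
      ext r
      simp
    by_cases h : ∀ ε > 0, ∃ a ∈ {r : ℝ | ∃ x y : X, dist x y = r}, a ≠ 0 ∧ |a| < ε
    · right
      refine ⟨?_, h⟩
      rw [hr]
      exact isCompact_range continuous_dist
    · left
      push Not at h
      obtain ⟨ε, hε, h⟩ := h
      have : Finite X := finite_of_compactSpace_of_le_dist hε fun x y hxy => by
        simpa using h (dist x y) ⟨x, y, rfl⟩ (dist_ne_zero.2 hxy)
      rw [hr]
      exact finite_range _
  · rintro (h | ⟨h, hlim⟩)
    · exact h.exists_compact_metricSpace hnn h0
    · exact h.exists_compact_metricSpace hnn h0 hlim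
end

section
/- A set A of non-negative real numbers with 0 ∈ A is the distance set of some countable compact metric space if and only if A is countable and compact, and either A is finite or 0 is a limit point of A. -/
open Topology Filter

theorem compactSpace_of_surjective_of_eventually_dist_lt {Y X : Type*} [TopologicalSpace Y]
    [CompactSpace Y] [MetricSpace X] (f : Y → X) (hf : Function.Surjective f)
    (hc : ∀ y, ∀ ε > 0, ∀ᶠ z in 𝓝 y, dist (f z) (f y) < ε) : CompactSpace X :=
  hf.compactSpace (continuous_iff_continuousAt.2 fun y => Metric.tendsto_nhds.2 (hc y))

/-- If a compact set `A ⊆ [0,∞)` containing `0` carries an `A`-valued metric `ρ` which dominates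
the usual one and induces the usual topology, then `min (ρ a b) (max a b)` is a metric on `A`
whose distance set is exactly `A`. -/
theorem exists_metricSpace_of_dominating {A : Set ℝ} (hnn : ∀ a ∈ A, 0 ≤ a) (h0 : (0 : ℝ) ∈ A)
    (hA : A.Countable) (hc : IsCompact A) (ρ : A → A → ℝ) (hmem : ∀ a b, ρ a b ∈ A)
    (hself : ∀ a, ρ a a = 0) (hsymm : ∀ a b, ρ a b = ρ b a)
    (htri : ∀ a b c, ρ a c ≤ ρ a b + ρ b c) (hle : ∀ a b : A, |(a : ℝ) - b| ≤ ρ a b)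
    (hcont : ∀ a, ∀ ε > 0, ∀ᶠ b in 𝓝 a, ρ b a < ε) :
    ∃ (X : Type) (_ : MetricSpace X), Countable X ∧ CompactSpace X ∧
      {r : ℝ | ∃ x y : X, dist x y = r} = A := by
  have hnn' : ∀ a : A, (0 : ℝ) ≤ a := fun a => hnn a a.2
  have hρ : ∀ a b, 0 ≤ ρ a b := fun a b => hnn _ (hmem a b)
  let m : MetricSpace A :=
    { dist := fun a b => min (ρ a b) (max (a : ℝ) b)
      dist_self := fun a => by simp [hself, hnn']
      dist_comm := fun a b => by rw [hsymm, max_comm]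
      dist_triangle := fun a b c => by
        have h1 := htri a b c
        have h2 := (le_abs_self _).trans (hle a b)
        have h3 := (neg_le_abs _).trans (hle b c)
        have ha := hnn' a
        have hb := hnn' b
        have hc := hnn' c
        have hab := hρ a b
        have hbc := hρ b c
        change min (ρ a c) (max (a : ℝ) c) ≤ min (ρ a b) (max (a : ℝ) b) +
          min (ρ b c) (max (b : ℝ) c)
        grind
      eq_of_dist_eq_zero := fun {a b} h => by
        change min (ρ a b) (max (a : ℝ) b) = 0 at h
        have ha := hnn' a
        have hb := hnn' b
        have h1 := hle a b
        refine Subtype.ext ?_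
        grind }
  refine ⟨A, m, hA.to_subtype, ?_, ?_⟩
  · have : CompactSpace A := isCompact_iff_compactSpace.1 hc
    exact @compactSpace_of_surjective_of_eventually_dist_lt A A _ this m id
      Function.surjective_id fun a ε hε =>
        (hcont a ε hε).mono fun b hb => (min_le_left _ _).trans_lt hb
  · ext r
    constructor
    · rintro ⟨x, y, rfl⟩
      change min (ρ x y) (max (x : ℝ) y) ∈ A
      rcases min_choice (ρ x y) (max (x : ℝ) y) with h | h <;> rw [h]
      · exact hmem x y
      · rcases max_choice (x : ℝ) y with h | h <;> rw [h]
        exacts [x.2, y.2]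
    · intro hr
      refine ⟨⟨r, hr⟩, ⟨0, h0⟩, ?_⟩
      change min (ρ ⟨r, hr⟩ ⟨0, h0⟩) (max r 0) = r
      have h := hle ⟨r, hr⟩ ⟨0, h0⟩
      have hr0 := hnn r hr
      simp only [sub_zero, abs_of_nonneg hr0] at h
      rw [max_eq_left hr0, min_eq_right h]

theorem abs_sub_le_of_nonneg_of_le_bound {a b M : ℝ} (ha : 0 ≤ a) (hb : 0 ≤ b) (haM : a ≤ M)
    (hbM : b ≤ M) : |a - b| ≤ M :=
  abs_le.2 ⟨by linarith, by linarith⟩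

/-- A shift for which the grid of mesh `δ` misses a given countable set. -/
theorem Set.Countable.exists_grid_avoiding {A : Set ℝ} (hA : A.Countable) (δ : ℝ) :
    ∃ s : ℝ, ∀ a ∈ A, ∀ k : ℤ, a ≠ s + k * δ := by
  have h : (⋃ k : ℤ, (fun a => a - k * δ) '' A).Countable :=
    Set.countable_iUnion fun k => hA.image _
  obtain ⟨s, hs⟩ := h.dense_compl ℝ |>.nonempty
  refine ⟨s, fun a ha k hk => hs (Set.mem_iUnion.2 ⟨k, a, ha, ?_⟩)⟩
  simp [hk]

theorem Set.Countable.exists_locallyConstant_int {A : Set ℝ} (hA : A.Countable) {δ : ℝ}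
    (hδ : 0 < δ) :
    ∃ f : A → ℤ, (∀ a, ∀ᶠ b in 𝓝 a, f b = f a) ∧ ∀ a b, f a = f b → |(a : ℝ) - b| ≤ δ := by
  obtain ⟨s, hs⟩ := hA.exists_grid_avoiding δ
  refine ⟨fun a => ⌊((a : ℝ) - s) / δ⌋, fun a => ?_, fun a b h => ?_⟩
  · have hne : (⌊((a : ℝ) - s) / δ⌋ : ℝ) < ((a : ℝ) - s) / δ := by
      refine lt_of_le_of_ne (Int.floor_le _) fun h => hs a a.2 ⌊((a : ℝ) - s) / δ⌋ ?_
      rw [h]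
      field_simp
      ring
    have hc : ContinuousAt (fun b : A => ((b : ℝ) - s) / δ) a := by fun_prop
    filter_upwards [hc.eventually (lt_mem_nhds hne),
      hc.eventually (gt_mem_nhds (Int.lt_floor_add_one _))] with b h1 h2
    exact Int.floor_eq_iff.2 ⟨h1.le, h2⟩
  · have h1 := Int.abs_sub_lt_one_of_floor_eq_floor h
    rw [← sub_div, abs_div, abs_of_pos hδ, div_lt_one hδ] at h1
    have h2 : (a : ℝ) - s - (b - s) = a - b := by ring
    exact (h2 ▸ h1).le

theorem exists_halving_sequence {A : Set ℝ} (hnn : ∀ a ∈ A, 0 ≤ a)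
    (hlim : ∀ ε > 0, ∃ a ∈ A, a ≠ 0 ∧ |a| < ε) {M : ℝ} (hM : M ∈ A) (hM0 : 0 < M) :
    ∃ c : ℕ → ℝ, c 0 = M ∧ (∀ n, c n ∈ A) ∧ (∀ n, 0 < c n) ∧ Antitone c ∧
      Tendsto c atTop (𝓝 0) := by
  have hstep : ∀ x : {x : ℝ // x ∈ A ∧ 0 < x}, ∃ y : {y : ℝ // y ∈ A ∧ 0 < y},
      (y : ℝ) ≤ 1 / 2 * x := by
    intro x
    obtain ⟨a, ha, ha0, hlt⟩ := hlim (1 / 2 * x) (by linarith [x.2.2])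
    exact ⟨⟨a, ha, (hnn a ha).lt_of_ne' ha0⟩, (le_abs_self a).trans hlt.le⟩
  choose g hg using hstep
  let c : ℕ → {x : ℝ // x ∈ A ∧ 0 < x} := fun n => g^[n] ⟨M, hM, hM0⟩
  have hc : ∀ n, (c (n + 1) : ℝ) ≤ 1 / 2 * c n := fun n => by
    simp only [c, Function.iterate_succ_apply']
    exact hg _
  have hbound : ∀ n, (c n : ℝ) ≤ (1 / 2) ^ n * M := by
    intro n
    induction n with
    | zero => simp [c]
    | succ n ih => rw [pow_succ]; linarith [hc n]
  refine ⟨fun n => c n, rfl, fun n => (c n).2.1, fun n => (c n).2.2,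
    antitone_nat_of_succ_le fun n => by linarith [hc n, (c n).2.2], ?_⟩
  refine squeeze_zero (fun n => (c n).2.2.le) hbound ?_
  simpa using (tendsto_pow_atTop_nhds_zero_of_lt_one (r := (1 / 2 : ℝ)) (by norm_num)
    (by norm_num)).mul_const M

open Classical in
theorem exists_dominating_metric_of_zero_limit {A : Set ℝ} (hnn : ∀ a ∈ A, 0 ≤ a)
    (h0 : (0 : ℝ) ∈ A) (hA : A.Countable) {M : ℝ} (hM : M ∈ A) (hAM : ∀ a ∈ A, a ≤ M)
    (hlim : ∀ ε > 0, ∃ a ∈ A, a ≠ 0 ∧ |a| < ε) :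
    ∃ ρ : A → A → ℝ, (∀ a b, ρ a b ∈ A) ∧ (∀ a, ρ a a = 0) ∧ (∀ a b, ρ a b = ρ b a) ∧
      (∀ a b c, ρ a c ≤ ρ a b + ρ b c) ∧ (∀ a b : A, |(a : ℝ) - b| ≤ ρ a b) ∧
      ∀ a, ∀ ε > 0, ∀ᶠ b in 𝓝 a, ρ b a < ε := by
  have hM0 : 0 < M := by
    obtain ⟨a, ha, ha0, -⟩ := hlim 1 one_pos
    exact ((hnn a ha).lt_of_ne' ha0).trans_le (hAM a ha)
  obtain ⟨c, hc0, hcA, hcpos, hanti, hctend⟩ := exists_halving_sequence hnn hlim hM hM0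
  choose f hfloc hf using fun n => hA.exists_locallyConstant_int (hcpos (n + 1))
  let F : A → ℕ → ℤ := fun a n => f n a
  have hFinj : Function.Injective F := by
    intro a b hab
    have h : |(a : ℝ) - b| ≤ 0 :=
      ge_of_tendsto' (hctend.comp (tendsto_add_atTop_nat 1)) fun n => hf n a b (congrFun hab n)
    exact Subtype.ext (sub_eq_zero.1 (abs_nonpos_iff.1 h))
  let ρ : A → A → ℝ := fun a b => if a = b then 0 else c (PiNat.firstDiff (F a) (F b))
  have hρnn : ∀ a b, 0 ≤ ρ a b := fun a b => by
    simp only [ρ]; split_ifs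
    exacts [le_rfl, (hcpos _).le]
  refine ⟨ρ, fun a b => ?_, fun a => by simp [ρ], fun a b => ?_, fun a b d => ?_, fun a b => ?_,
    fun a ε hε => ?_⟩
  · simp only [ρ]; split_ifs
    exacts [h0, hcA _]
  · simp only [ρ, PiNat.firstDiff_comm (F a), eq_comm (a := a)]
  · by_cases had : a = d
    · simpa [ρ, had] using add_nonneg (hρnn d b) (hρnn b d)
    by_cases hab : a = b
    · simp [ρ, hab]
    by_cases hbd : b = d
    · simp [ρ, hbd]
    have h := PiNat.min_firstDiff_le (F a) (F b) (F d) (hFinj.ne had)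
    simp only [ρ, had, hab, hbd, if_false]
    rcases min_le_iff.1 h with h | h
    · linarith [hanti h, hcpos (PiNat.firstDiff (F b) (F d))]
    · linarith [hanti h, hcpos (PiNat.firstDiff (F a) (F b))]
  · by_cases hab : a = b
    · simp [ρ, hab]
    simp only [ρ, hab, if_false]
    rcases hn : PiNat.firstDiff (F a) (F b) with _ | n
    · rw [hc0]
      exact abs_sub_le_of_nonneg_of_le_bound (hnn a a.2) (hnn b b.2) (hAM a a.2) (hAM b b.2)
    · exact hf n a b (PiNat.apply_eq_of_lt_firstDiff (x := F a) (y := F b) (by omega))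
  · obtain ⟨n, hn⟩ := (hctend.eventually (gt_mem_nhds hε)).exists
    have hev : ∀ᶠ b in 𝓝 a, ∀ k ∈ Set.Iio n, f k b = f k a :=
      (eventually_all_finite (Set.finite_Iio n)).2 fun k _ => hfloc k a
    filter_upwards [hev] with b hb
    by_cases hba : b = a
    · simpa [ρ, hba] using hε
    simp only [ρ, hba, if_false]
    refine (hanti ?_).trans_lt hn
    by_contra! hlt
    exact PiNat.apply_firstDiff_ne (hFinj.ne hba) (hb _ hlt)

open Classical in
theorem exists_dominating_metric_of_finite {A : Set ℝ} (hnn : ∀ a ∈ A, 0 ≤ a)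
    (h0 : (0 : ℝ) ∈ A) (hA : A.Finite) {M : ℝ} (hM : M ∈ A) (hAM : ∀ a ∈ A, a ≤ M) :
    ∃ ρ : A → A → ℝ, (∀ a b, ρ a b ∈ A) ∧ (∀ a, ρ a a = 0) ∧ (∀ a b, ρ a b = ρ b a) ∧
      (∀ a b c, ρ a c ≤ ρ a b + ρ b c) ∧ (∀ a b : A, |(a : ℝ) - b| ≤ ρ a b) ∧
      ∀ a, ∀ ε > 0, ∀ᶠ b in 𝓝 a, ρ b a < ε := by
  have : Finite A := hA
  have hM0 := hnn M hM
  refine ⟨fun a b => if a = b then 0 else M, fun a b => ?_, fun a => by simp, fun a b => ?_,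
    fun a b c => ?_, fun a b => ?_, fun a ε hε => ?_⟩
  · dsimp only; split_ifs
    exacts [h0, hM]
  · simp only [eq_comm (a := a)]
  · dsimp only; grind
  · dsimp only; split_ifs with h
    · simp [h]
    · exact abs_sub_le_of_nonneg_of_le_bound (hnn a a.2) (hnn b b.2) (hAM a a.2) (hAM b b.2)
  · rw [nhds_discrete]
    simpa using hε

/-- A compact metric space with infinitely many distances has arbitrarily small positive ones. -/
theorem exists_dist_pos_lt_of_infinite {X : Type*} [MetricSpace X] [CompactSpace X]
    (h : {r : ℝ | ∃ x y : X, dist x y = r}.Infinite) {ε : ℝ} (hε : 0 < ε) :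
    ∃ x y : X, x ≠ y ∧ dist x y < ε := by
  by_contra! hsep
  have : DiscreteTopology X := DiscreteTopology.of_forall_le_dist hε hsep
  have : Finite X := finite_of_compact_of_discrete
  refine h ((Set.finite_range fun p : X × X => dist p.1 p.2).subset ?_)
  rintro _ ⟨x, y, rfl⟩
  exact ⟨(x, y), rfl⟩

/-- A set `A ⊆ [0,∞)` with `0 ∈ A` is the distance set of some countable
compact metric space iff `A` is countable and compact, and either `A` is finite or `0` is a
limit point of `A`. -/
theorem stmt_15 (A : Set ℝ) (hnn : ∀ a ∈ A, 0 ≤ a) (h0 : (0 : ℝ) ∈ A) :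
    (∃ (X : Type) (_ : MetricSpace X), Countable X ∧ CompactSpace X ∧
      {r : ℝ | ∃ x y : X, dist x y = r} = A) ↔
    (A.Countable ∧ IsCompact A ∧
      (A.Finite ∨ ∀ ε > 0, ∃ a ∈ A, a ≠ 0 ∧ |a| < ε)) := by
  constructor
  · rintro ⟨X, _, _, _, rfl⟩
    have hrange : {r : ℝ | ∃ x y : X, dist x y = r} =
        Set.range fun p : X × X => dist p.1 p.2 := by
      ext r
      simp
    refine ⟨hrange ▸ Set.countable_range _, hrange ▸ isCompact_range continuous_dist, ?_⟩
    refine or_iff_not_imp_left.2 fun hinf ε hε => ?_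
    obtain ⟨x, y, hxy, hlt⟩ := exists_dist_pos_lt_of_infinite hinf hε
    exact ⟨dist x y, ⟨x, y, rfl⟩, dist_ne_zero.2 hxy, by rwa [abs_of_nonneg dist_nonneg]⟩
  · rintro ⟨hA, hcomp, hfin⟩
    obtain ⟨M, hM, hAM⟩ := hcomp.exists_isGreatest ⟨0, h0⟩
    obtain ⟨ρ, h1, h2, h3, h4, h5, h6⟩ := hfin.elim
      (fun hf => exists_dominating_metric_of_finite hnn h0 hf hM fun a ha => hAM ha)
      (fun hl => exists_dominating_metric_of_zero_limit hnn h0 hA hM (fun a ha => hAM ha) hl)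
    exact exists_metricSpace_of_dominating hnn h0 hA hcomp ρ h1 h2 h3 h4 h5 h6
end

section
/- For a set A of non-negative real numbers with 0 ∈ A, the following are equivalent: (1) A is the distance set of some locally compact, complete, separable metric space; (2) A is the distance set of some σ-compact, complete, separable metric space; (3) A is countable, or A is a countable union of compact subsets of ℝ (a K_σ set) and 0 is a limit point of A. -/
open Set Filter Topology

namespace DistanceSet

/-- A metric space partitioned into countably many compact pieces, points in distinct pieces being
at distance at least `δ > 0`, is locally compact, complete and separable. -/
theorem locallyCompact_complete_separable_of_compact_pieces {Y ι : Type*} [MetricSpace Y]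
    [Countable ι] (π : Y → ι) (hπ : ∀ i, IsCompact (π ⁻¹' {i})) {δ : ℝ} (hδ : 0 < δ)
    (hdist : ∀ p q, dist p q < δ → π p = π q) :
    LocallyCompactSpace Y ∧ CompleteSpace Y ∧ TopologicalSpace.SeparableSpace Y := by
  refine ⟨?_, ?_, ?_⟩
  · have : WeaklyLocallyCompactSpace Y := ⟨fun p => ⟨_, hπ (π p),
      Filter.mem_of_superset (Metric.ball_mem_nhds p hδ) fun q hq => hdist q p hq⟩⟩
    infer_instance
  · refine Metric.complete_of_convergent_controlled_sequences (fun n => δ / 2 ^ n)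
      (fun n => by positivity) fun u hu => ?_
    have hcau : CauchySeq u := by
      refine cauchySeq_of_le_tendsto_0 (fun n => δ / 2 ^ n)
        (fun n m N hn hm => (hu N n m hn hm).le) ?_
      simpa [div_eq_mul_inv] using (tendsto_pow_atTop_nhds_zero_of_lt_one
        (by norm_num : (0 : ℝ) ≤ 2⁻¹) (by norm_num)).const_mul δ
    have hmem : ∀ n, u n ∈ π ⁻¹' {π (u 0)} := fun n =>
      hdist _ _ (by simpa using hu 0 n 0 n.zero_le le_rfl)
    obtain ⟨x, -, hx⟩ := cauchySeq_tendsto_of_isComplete (hπ (π (u 0))).isComplete hmem hcau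
    exact ⟨x, hx⟩
  · have : SigmaCompactSpace Y := isSigmaCompact_univ_iff.1 (by
      rw [show (univ : Set Y) = ⋃ i, π ⁻¹' {i} by ext; simp]
      exact isSigmaCompact_iUnion_of_isCompact _ hπ)
    infer_instance

/-- The disjoint union of a family of types, without the topology of `Sigma`. -/
structure Glued_s16 {ι : Type} (X : ι → Type) where
  fst : ι
  snd : X fst

/-- Compact metric spaces glued into one space, with the distance between points of distinct pieces
`i` and `j` equal to `max (c i) (c j)`. -/
theorem exists_glued_space {ι : Type} [Countable ι] (X : ι → Type) [∀ i, MetricSpace (X i)]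
    [∀ i, CompactSpace (X i)]
    [∀ i, Nonempty (X i)] (c : ι → ℝ) {δ : ℝ} (hδ : 0 < δ) (hc : ∀ i, δ ≤ c i)
    (hdiam : ∀ i, ∀ x y : X i, dist x y ≤ 2 * c i) :
    ∃ (Y : Type) (_ : MetricSpace Y), LocallyCompactSpace Y ∧ CompleteSpace Y ∧
      TopologicalSpace.SeparableSpace Y ∧
      {r : ℝ | ∃ x y : Y, dist x y = r} =
        {r | (∃ i, ∃ x y : X i, dist x y = r) ∨ ∃ i j, i ≠ j ∧ max (c i) (c j) = r} := by
  classical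
  let d : Glued_s16 X → Glued_s16 X → ℝ := fun p q =>
    if h : p.fst = q.fst then dist (h ▸ p.snd) q.snd else max (c p.fst) (c q.fst)
  have d_same : ∀ i (x y : X i), d ⟨i, x⟩ ⟨i, y⟩ = dist x y := fun i x y => by simp [d]
  have d_ne : ∀ i j (x : X i) (y : X j), i ≠ j → d ⟨i, x⟩ ⟨j, y⟩ = max (c i) (c j) :=
    fun i j x y h => by simp [d, h]
  let : MetricSpace (Glued_s16 X) :=
    { dist := d
      dist_self := fun ⟨i, x⟩ => by rw [d_same, dist_self]
      dist_comm := by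
        rintro ⟨i, x⟩ ⟨j, y⟩
        by_cases h : i = j
        · subst h
          rw [d_same, d_same, dist_comm]
        · rw [d_ne _ _ _ _ h, d_ne _ _ _ _ (Ne.symm h), max_comm]
      dist_triangle := by
        rintro ⟨i, x⟩ ⟨j, y⟩ ⟨k, z⟩
        by_cases hij : i = j
        · subst hij
          by_cases hik : i = k
          · subst hik
            simpa only [d_same] using dist_triangle x y z
          · rw [d_same, d_ne _ _ _ _ hik, d_ne _ _ _ _ hik]
            linarith [dist_nonneg (x := x) (y := y)]
        · by_cases hjk : j = k
          · subst hjk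
            rw [d_same, d_ne _ _ _ _ hij, d_ne _ _ _ _ hij]
            linarith [dist_nonneg (x := y) (y := z)]
          · rw [d_ne _ _ _ _ hij, d_ne _ _ _ _ hjk]
            by_cases hik : i = k
            · subst hik
              rw [d_same]
              linarith [hdiam i x z, le_max_left (c i) (c j), le_max_right (c j) (c i)]
            · rw [d_ne _ _ _ _ hik]
              have := hc j
              refine max_le ?_ ?_
              · linarith [le_max_left (c i) (c j), le_max_left (c j) (c k)]
              · linarith [le_max_right (c i) (c j), le_max_right (c j) (c k)]
      eq_of_dist_eq_zero := by
        rintro ⟨i, x⟩ ⟨j, y⟩ h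
        by_cases hij : i = j
        · subst hij
          rw [show x = y from dist_eq_zero.1 ((d_same i x y).symm.trans h)]
        · have h' : max (c i) (c j) = 0 := (d_ne i j x y hij).symm.trans h
          linarith [hc i, le_max_left (c i) (c j)] }
  have dist_same : ∀ i (x y : X i), dist (⟨i, x⟩ : Glued_s16 X) ⟨i, y⟩ = dist x y := d_same
  have dist_ne : ∀ i j (x : X i) (y : X j), i ≠ j →
      dist (⟨i, x⟩ : Glued_s16 X) ⟨j, y⟩ = max (c i) (c j) := d_ne
  have fst_eq : ∀ p q : Glued_s16 X, dist p q < δ → p.fst = q.fst := by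
    rintro ⟨i, x⟩ ⟨j, y⟩ h
    by_contra hij
    rw [dist_ne i j x y hij] at h
    linarith [hc i, le_max_left (c i) (c j)]
  obtain ⟨hlc, hcomp, hsep⟩ := locallyCompact_complete_separable_of_compact_pieces
    (fun p : Glued_s16 X => p.fst) (fun i => by
      convert isCompact_range (Isometry.of_dist_eq (dist_same i)).continuous using 1
      ext ⟨j, y⟩
      constructor
      · rintro rfl
        exact ⟨y, rfl⟩
      · rintro ⟨x, hx⟩
        exact (congrArg Glued_s16.fst hx).symm) hδ fst_eq
  refine ⟨Glued_s16 X, inferInstance, hlc, hcomp, hsep, ?_⟩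
  ext r
  constructor
  · rintro ⟨⟨i, x⟩, ⟨j, y⟩, h⟩
    by_cases hij : i = j
    · subst hij
      exact Or.inl ⟨i, x, y, (dist_same i x y).symm.trans h⟩
    · exact Or.inr ⟨i, j, hij, (dist_ne i j x y hij).symm.trans h⟩
  · rintro (⟨i, x, y, h⟩ | ⟨i, j, hij, h⟩)
    · exact ⟨⟨i, x⟩, ⟨i, y⟩, (dist_same i x y).trans h⟩
    · exact ⟨⟨i, Classical.arbitrary _⟩, ⟨j, Classical.arbitrary _⟩,
        (dist_ne i j _ _ hij).trans h⟩

/-- The codes of points of `K`: pairs `(x, s)` such that the integer `s n` locates `x` within the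
mesh `a (n + 1)`. -/
def codes (K : Set ℝ) (a : ℕ → ℝ) : Set (ℝ × (ℕ → ℤ)) :=
  {p | p.1 ∈ K ∧ ∀ n, p.2 n * a (n + 1) ≤ p.1 ∧ p.1 ≤ (p.2 n + 1) * a (n + 1)}

theorem isCompact_codes {K : Set ℝ} (hK : IsCompact K) {a : ℕ → ℝ} (ha : ∀ n, 0 < a n) :
    IsCompact (codes K a) := by
  obtain ⟨l, hl⟩ := hK.bddBelow
  obtain ⟨M, hM⟩ := hK.bddAbove
  have hbox : IsCompact (K ×ˢ (univ.pi fun n => Icc (⌊l / a (n + 1) - 1⌋) (⌈M / a (n + 1)⌉))) :=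
    hK.prod (isCompact_univ_pi fun n => (Set.finite_Icc _ _).isCompact)
  refine hbox.of_isClosed_subset ?_ ?_
  · have hcl : IsClosed {p : ℝ × (ℕ → ℤ) |
        ∀ n, p.2 n * a (n + 1) ≤ p.1 ∧ p.1 ≤ (p.2 n + 1) * a (n + 1)} := by
      simp only [ofPred_forall, ofPred_and]
      have hc : ∀ n, Continuous fun p : ℝ × (ℕ → ℤ) => (p.2 n : ℝ) := fun n =>
        continuous_of_discreteTopology.comp ((continuous_apply n).comp continuous_snd)
      refine isClosed_iInter fun n => ?_
      exact (isClosed_le ((hc n).mul continuous_const) continuous_fst).inter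
        (isClosed_le continuous_fst (((hc n).add continuous_const).mul continuous_const))
    exact (hK.isClosed.preimage continuous_fst).inter hcl
  · rintro ⟨x, s⟩ ⟨hx, hs⟩
    refine ⟨hx, fun n _ => ⟨?_, ?_⟩⟩
    · have h1 : l / a (n + 1) ≤ s n + 1 :=
        (div_le_iff₀ (ha _)).2 ((hl hx).trans (hs n).2)
      exact_mod_cast (Int.floor_le _).trans (by linarith : l / a (n + 1) - 1 ≤ (s n : ℝ))
    · have h1 : (s n : ℝ) ≤ M / a (n + 1) := (le_div_iff₀ (ha _)).2 ((hs n).1.trans (hM hx))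
      exact_mod_cast h1.trans (Int.le_ceil _)

theorem exists_mem_codes {K : Set ℝ} {a : ℕ → ℝ} (ha : ∀ n, 0 < a n) {x : ℝ} (hx : x ∈ K) :
    ∃ s, (x, s) ∈ codes K a := by
  refine ⟨fun n => ⌊x / a (n + 1)⌋, hx, fun n => ⟨?_, ?_⟩⟩
  · exact (le_div_iff₀ (ha _)).1 (Int.floor_le _)
  · exact (div_le_iff₀ (ha _)).1 (Int.lt_floor_add_one _).le

theorem abs_sub_le_of_code_eq {K : Set ℝ} {a : ℕ → ℝ} {p q : ℝ × (ℕ → ℤ)} (hp : p ∈ codes K a)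
    (hq : q ∈ codes K a) {n : ℕ} (h : p.2 n = q.2 n) : |p.1 - q.1| ≤ a (n + 1) := by
  obtain ⟨h1, h2⟩ := hp.2 n
  obtain ⟨h3, h4⟩ := hq.2 n
  rw [h] at h1 h2
  rw [abs_le]
  constructor <;> linarith

theorem code_injective {K : Set ℝ} {a : ℕ → ℝ} (ha : Tendsto a atTop (𝓝 0))
    {p q : ℝ × (ℕ → ℤ)} (hp : p ∈ codes K a) (hq : q ∈ codes K a) (h : p.2 = q.2) : p = q := by
  refine Prod.ext ?_ h
  have : |p.1 - q.1| ≤ 0 := ge_of_tendsto' (ha.comp (tendsto_add_atTop_nat 1)) fun n =>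
    abs_sub_le_of_code_eq hp hq (congrFun h n)
  exact sub_eq_zero.1 (abs_eq_zero.1 (le_antisymm this (abs_nonneg _)))

theorem abs_sub_le_firstDiff {K : Set ℝ} {a : ℕ → ℝ} (hdiam : ∀ x ∈ K, ∀ y ∈ K, |x - y| ≤ a 0)
    {p q : ℝ × (ℕ → ℤ)} (hp : p ∈ codes K a) (hq : q ∈ codes K a) :
    |p.1 - q.1| ≤ a (PiNat.firstDiff p.2 q.2) := by
  cases h : PiNat.firstDiff p.2 q.2 with
  | zero => exact hdiam _ hp.1 _ hq.1
  | succ n => exact abs_sub_le_of_code_eq hp hq (PiNat.apply_eq_of_lt_firstDiff (by omega))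

/-- A compact set `K` of reals is realized as distances from one point to the points of a compact
ultrametric space whose positive distances are the terms of a given null sequence. -/
theorem exists_compact_space {K : Set ℝ} (hK : IsCompact K) {a : ℕ → ℝ} (ha : ∀ n, 0 < a n)
    (hanti : Antitone a) (hlim : Tendsto a atTop (𝓝 0))
    (hdiam : ∀ x ∈ K, ∀ y ∈ K, |x - y| ≤ a 0) (hlow : ∀ x ∈ K, a 0 ≤ x) :
    ∃ (X : Type) (_ : MetricSpace X), CompactSpace X ∧ Nonempty X ∧
      (∀ r ∈ K, ∃ x y : X, dist x y = r) ∧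
      ∀ x y : X, dist x y = 0 ∨ dist x y ∈ K ∨ ∃ n, dist x y = a n := by
  classical
  let e : codes K a → codes K a → ℝ := fun p q =>
    if p = q then 0 else a (PiNat.firstDiff p.1.2 q.1.2)
  have e_self : ∀ p, e p p = 0 := fun p => by simp [e]
  have e_ne : ∀ {p q}, p ≠ q → e p q = a (PiNat.firstDiff p.1.2 q.1.2) := fun h => by simp [e, h]
  have e_comm : ∀ p q, e p q = e q p := fun p q => by
    simp only [e, PiNat.firstDiff_comm p.1.2, eq_comm]
  have e_nonneg : ∀ p q, 0 ≤ e p q := fun p q => by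
    by_cases h : p = q
    · rw [h, e_self]
    · rw [e_ne h]
      exact (ha _).le
  have e_le : ∀ p q, e p q ≤ a 0 := fun p q => by
    by_cases h : p = q
    · rw [h, e_self]
      exact (ha 0).le
    · rw [e_ne h]
      exact hanti (Nat.zero_le _)
  have e_lip : ∀ p q, |p.1.1 - q.1.1| ≤ e p q := fun p q => by
    by_cases h : p = q
    · simp [h, e_self]
    · rw [e_ne h]
      exact abs_sub_le_firstDiff hdiam p.2 q.2
  have e_tri : ∀ p q r, e p r ≤ e p q + e q r := fun p q r => by
    by_cases hpq : p = q
    · rw [hpq, e_self, zero_add]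
    by_cases hqr : q = r
    · rw [hqr, e_self, add_zero]
    by_cases hpr : p = r
    · rw [hpr, e_self]
      exact add_nonneg (e_nonneg _ _) (e_nonneg _ _)
    have hne : p.1.2 ≠ r.1.2 := fun h => hpr (Subtype.ext (code_injective hlim p.2 r.2 h))
    rw [e_ne hpq, e_ne hqr, e_ne hpr]
    have hmin := hanti (PiNat.min_firstDiff_le p.1.2 q.1.2 r.1.2 hne)
    rcases min_choice (PiNat.firstDiff p.1.2 q.1.2) (PiNat.firstDiff q.1.2 r.1.2) with h | h <;>
      rw [h] at hmin
    · linarith [ha (PiNat.firstDiff q.1.2 r.1.2)]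
    · linarith [ha (PiNat.firstDiff p.1.2 q.1.2)]
  have hf : ∀ p : codes K a, a 0 ≤ p.1.1 := fun p => hlow _ p.2.1
  let d : Option (codes K a) → Option (codes K a) → ℝ := fun x y =>
    match x, y with
    | none, none => 0
    | none, some p => p.1.1
    | some p, none => p.1.1
    | some p, some q => e p q
  let m : MetricSpace (Option (codes K a)) :=
    { dist := d
      dist_self := by
        rintro (_ | p)
        · rfl
        · exact e_self p
      dist_comm := by
        rintro (_ | p) (_ | q)
        · rfl
        · rfl
        · rfl
        · exact e_comm p q
      dist_triangle := by
        rintro (_ | p) (_ | q) (_ | r) <;> simp only [d]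
        · simp
        · simp
        · linarith [hf q, ha 0]
        · linarith [(abs_le.1 (e_lip q r)).1]
        · simp
        · linarith [hf p, hf r, e_le p r, ha 0]
        · linarith [(abs_le.1 (e_lip p q)).2]
        · exact e_tri p q r
      eq_of_dist_eq_zero := by
        rintro (_ | p) (_ | q) h
        · rfl
        · exact absurd h (((ha 0).trans_le (hf q)).ne')
        · exact absurd h (((ha 0).trans_le (hf p)).ne')
        · by_contra hne
          have hpq : p ≠ q := fun h' => hne (congrArg some h')
          exact (ha _).ne' ((e_ne hpq).symm.trans h) }
  have hcont : Continuous (some : codes K a → Option (codes K a)) := by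
    refine continuous_iff_continuousAt.2 fun p => Metric.tendsto_nhds.2 fun ε hε => ?_
    obtain ⟨N, hN⟩ := (hlim.eventually_lt_const hε).exists
    have hev : ∀ᶠ q : codes K a in 𝓝 p, ∀ n ∈ Finset.range N, q.1.2 n = p.1.2 n := by
      refine (Finset.eventually_all _).2 fun n _ => ?_
      have hc : Continuous fun q : codes K a => q.1.2 n :=
        (continuous_apply n).comp (continuous_snd.comp continuous_subtype_val)
      exact hc.continuousAt.eventually_mem ((isOpen_discrete {p.1.2 n}).mem_nhds rfl)
    filter_upwards [hev] with q hq
    change e q p < ε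
    by_cases hqp : q = p
    · rwa [hqp, e_self]
    · rw [e_ne hqp]
      refine (hanti ?_).trans_lt hN
      by_contra! hlt
      have hne : q.1.2 ≠ p.1.2 := fun h => hqp (Subtype.ext (code_injective hlim q.2 p.2 h))
      exact PiNat.apply_firstDiff_ne hne (hq _ (Finset.mem_range.2 hlt))
  refine ⟨Option (codes K a), m, ⟨?_⟩, ⟨none⟩, ?_, ?_⟩
  · have : CompactSpace (codes K a) := isCompact_iff_compactSpace.1 (isCompact_codes hK ha)
    rw [← Set.insert_none_range_some]
    exact (isCompact_range hcont).insert none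
  · intro r hr
    obtain ⟨s, hs⟩ := exists_mem_codes ha hr
    exact ⟨none, some ⟨_, hs⟩, rfl⟩
  · rintro (_ | p) (_ | q)
    · exact Or.inl rfl
    · exact Or.inr (Or.inl q.2.1)
    · exact Or.inr (Or.inl p.2.1)
    · by_cases h : p = q
      · exact Or.inl (by rw [h, dist_self])
      · exact Or.inr (Or.inr ⟨_, e_ne h⟩)

/-- A countable set of nonnegative reals isolated from `0` is the distance set of a uniformly
discrete space. -/
theorem exists_space_of_countable {A : Set ℝ} (hnn : ∀ a ∈ A, 0 ≤ a) (h0 : (0 : ℝ) ∈ A)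
    (hA : A.Countable) {ε : ℝ} (hε : 0 < ε) (hiso : ∀ a ∈ A, a ≠ 0 → ε ≤ a) :
    ∃ (X : Type) (_ : MetricSpace X), LocallyCompactSpace X ∧ CompleteSpace X ∧
      TopologicalSpace.SeparableSpace X ∧ {r : ℝ | ∃ x y : X, dist x y = r} = A := by
  have : Countable A := hA.to_subtype
  obtain ⟨Y, hY, hlc, hcomp, hsep, heq⟩ := exists_glued_space (fun _ : A => PUnit)
    (fun a => max a.1 ε) hε (fun a => le_max_right _ _)
    (fun a x y => by
      rw [Subsingleton.elim x y, dist_self]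
      linarith [le_max_right a.1 ε])
  refine ⟨Y, hY, hlc, hcomp, hsep, heq.trans ?_⟩
  ext r
  constructor
  · rintro (⟨a, x, y, h⟩ | ⟨a, b, hab, h⟩)
    · rw [Subsingleton.elim x y, dist_self] at h
      rwa [← h]
    · have hmax : max a.1 b.1 ∈ A := by
        rcases max_choice a.1 b.1 with h | h <;> rw [h]
        exacts [a.2, b.2]
      have hpos : max a.1 b.1 ≠ 0 := fun h => hab (Subtype.ext (by
        rw [le_antisymm (h ▸ le_max_left _ _) (hnn _ a.2),
          le_antisymm (h ▸ le_max_right _ _) (hnn _ b.2)]))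
      have hle := hiso _ hmax hpos
      have : max a.1 b.1 = r := by
        rw [← h, max_max_max_comm, max_self, max_eq_left hle]
      rwa [← this]
  · intro hr
    by_cases hr0 : r = 0
    · exact Or.inl ⟨⟨0, h0⟩, PUnit.unit, PUnit.unit, by rw [dist_self, hr0]⟩
    · refine Or.inr ⟨⟨0, h0⟩, ⟨r, hr⟩, fun h => hr0 (congrArg Subtype.val h).symm, ?_⟩
      have := hiso r hr hr0
      change max (max 0 ε) (max r ε) = r
      rw [max_eq_right hε.le, max_eq_left this, max_eq_right this]

/-- A `K_σ` set of nonnegative reals having `0` as a member and as a limit point is the distance set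
of a locally compact Polish metric space. -/
theorem exists_space_of_iUnion_compact {K : ℕ → Set ℝ} (hK : ∀ n, IsCompact (K n))
    (hnn : ∀ a ∈ ⋃ n, K n, 0 ≤ a) (h0 : (0 : ℝ) ∈ ⋃ n, K n)
    (hlim : ∀ ε > 0, ∃ a ∈ ⋃ n, K n, a ≠ 0 ∧ |a| < ε) :
    ∃ (X : Type) (_ : MetricSpace X), LocallyCompactSpace X ∧ CompleteSpace X ∧
      TopologicalSpace.SeparableSpace X ∧ {r : ℝ | ∃ x y : X, dist x y = r} = ⋃ n, K n := by
  set A := ⋃ n, K n with hA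
  have hglb : IsGLB {a ∈ A | 0 < a} 0 := by
    refine ⟨fun a ha => ha.2.le, fun ε hε => ?_⟩
    by_contra! hpos
    obtain ⟨a, haA, ha0, halt⟩ := hlim ε hpos
    have := hε ⟨haA, lt_of_le_of_ne (hnn a haA) ha0.symm⟩
    linarith [le_abs_self a]
  have hne : {a ∈ A | 0 < a}.Nonempty := by
    obtain ⟨a, haA, ha0, -⟩ := hlim 1 one_pos
    exact ⟨a, haA, lt_of_le_of_ne (hnn a haA) ha0.symm⟩
  obtain ⟨b, hbanti, hbpos, hblim, hbA⟩ :=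
    hglb.exists_seq_strictAnti_tendsto_of_notMem (fun h => lt_irrefl _ h.2) hne
  let L : ℕ × ℕ × ℕ → Set ℝ := fun i => K i.1 ∩ Icc ((i.2.2 + 1) * b i.2.1) ((i.2.2 + 2) * b i.2.1)
  have hL : ∀ i, IsCompact (L i) := fun i => (hK _).inter_right isClosed_Icc
  have hLA : ∀ i, L i ⊆ A := fun i x hx => mem_iUnion.2 ⟨_, hx.1⟩
  have hLcover : ∀ x ∈ A, x ≠ 0 → ∃ i, x ∈ L i := by
    intro x hx hx0
    have hxpos : 0 < x := lt_of_le_of_ne (hnn x hx) hx0.symm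
    obtain ⟨n, hn⟩ := mem_iUnion.1 hx
    obtain ⟨k, hk⟩ := (hblim.eventually_lt_const hxpos).exists
    obtain ⟨m, hm⟩ : ∃ m, ⌊x / b k⌋₊ = m + 1 := Nat.exists_eq_succ_of_ne_zero
      (Nat.floor_pos.2 ((one_le_div (hbpos k)).2 hk.le)).ne'
    refine ⟨(n, k, m), hn, ?_, ?_⟩
    · have := Nat.floor_le (div_pos hxpos (hbpos k)).le
      rw [hm] at this
      push_cast at this
      exact (le_div_iff₀ (hbpos k)).1 this
    · have := (Nat.lt_floor_add_one (x / b k)).le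
      rw [hm] at this
      push_cast at this
      have := (div_le_iff₀ (hbpos k)).1 this
      change x ≤ (m + 2) * b k
      linarith
  let ι := {i // (L i).Nonempty}
  have hX : ∀ i : ι, ∃ (X : Type) (_ : MetricSpace X), CompactSpace X ∧ Nonempty X ∧
      (∀ r ∈ L i, ∃ x y : X, dist x y = r) ∧
      ∀ x y : X, dist x y = 0 ∨ dist x y ∈ L i ∨ ∃ n, dist x y = b (n + i.1.2.1) := by
    intro i
    refine exists_compact_space (hL i) (a := fun n => b (n + i.1.2.1)) (fun n => hbpos _)
      (fun m n h => hbanti.antitone (by omega))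
      (hblim.comp (tendsto_add_atTop_nat _)) ?_ ?_
    · intro x hx y hy
      obtain ⟨hx1, hx2⟩ := hx.2
      obtain ⟨hy1, hy2⟩ := hy.2
      simp only [zero_add]
      rw [abs_le]
      constructor <;> linarith
    · intro x hx
      simp only [zero_add]
      have h1 := hx.2.1
      have h2 : (0 : ℝ) ≤ i.1.2.2 * b i.1.2.1 := mul_nonneg (Nat.cast_nonneg _) (hbpos _).le
      linarith
  choose X hXm hXc hXn hXK hXd using hX
  have hmax : ∀ i : ι, ∃ M, IsGreatest (L i) M := fun i => (hL i).exists_isGreatest i.2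
  choose M hM using hmax
  obtain ⟨Y, hY, hlc, hcomp, hsep, heq⟩ := exists_glued_space X (fun i => max (M i) (b 0)) (hbpos 0)
    (fun i => le_max_right _ _) (fun i x y => by
      have h1 := le_max_left (M i) (b 0)
      have h2 := le_max_right (M i) (b 0)
      have h3 := hbpos 0
      rcases hXd i x y with h | h | ⟨n, h⟩
      · linarith
      · linarith [(hM i).2 h]
      · linarith [hbanti.antitone (Nat.zero_le (n + i.1.2.1))])
  have hcA : ∀ i : ι, max (M i) (b 0) ∈ A := fun i => by
    rcases max_choice (M i) (b 0) with h | h <;> rw [h]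
    exacts [hLA _ (hM i).1, (hbA 0).1]
  refine ⟨Y, hY, hlc, hcomp, hsep, heq.trans ?_⟩
  ext r
  constructor
  · rintro (⟨i, x, y, rfl⟩ | ⟨i, j, -, rfl⟩)
    · rcases hXd i x y with h | h | ⟨n, h⟩
      · rwa [h]
      · exact hLA _ h
      · rw [h]
        exact (hbA _).1
    · rcases max_choice (max (M i) (b 0)) (max (M j) (b 0)) with h | h <;> rw [h]
      exacts [hcA i, hcA j]
  · intro hr
    left
    by_cases hr0 : r = 0
    · obtain ⟨i, hi⟩ := hLcover (b 0) (hbA 0).1 (hbpos 0).ne'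
      let j : ι := ⟨i, _, hi⟩
      exact ⟨j, (hXn j).some, (hXn j).some, by rw [dist_self, hr0]⟩
    · obtain ⟨i, hi⟩ := hLcover r hr hr0
      exact ⟨⟨i, r, hi⟩, hXK ⟨i, r, hi⟩ r hi⟩

/-- A separable uniformly discrete metric space is countable. -/
theorem countable_of_separable_of_dist {X : Type*} [MetricSpace X]
    [TopologicalSpace.SeparableSpace X] {ε : ℝ} (hε : 0 < ε)
    (h : ∀ x y : X, x ≠ y → ε ≤ dist x y) : Countable X := by
  have : DiscreteTopology X := DiscreteTopology.of_forall_le_dist hε fun x y hxy => h x y hxy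
  exact TopologicalSpace.separableSpace_iff_countable.1 inferInstance

/-- The distance set of a σ-compact metric space is `K_σ`. -/
theorem distances_eq_iUnion_compact (X : Type*) [MetricSpace X] [SigmaCompactSpace X] :
    ∃ K : ℕ → Set ℝ, (∀ n, IsCompact (K n)) ∧ {r : ℝ | ∃ x y : X, dist x y = r} = ⋃ n, K n := by
  refine ⟨fun n => (fun p : X × X => dist p.1 p.2) '' compactCovering (X × X) n,
    fun n => (isCompact_compactCovering _ n).image continuous_dist, ?_⟩
  rw [← image_iUnion, iUnion_compactCovering]
  ext r
  simp

end DistanceSet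

open DistanceSet


/-- For `A ⊆ [0,∞)` with `0 ∈ A`, the following are equivalent:
(1) `A` is the distance set of a locally compact complete separable metric space;
(2) `A` is the distance set of a σ-compact complete separable metric space;
(3) `A` is countable, or `A` is a countable union of compact subsets of `ℝ` (a `K_σ` set)
and `0` is a limit point of `A`. -/
theorem stmt_16 (A : Set ℝ) (hnn : ∀ a ∈ A, 0 ≤ a) (h0 : (0 : ℝ) ∈ A) :
    ((∃ (X : Type) (_ : MetricSpace X), LocallyCompactSpace X ∧ CompleteSpace X ∧
        TopologicalSpace.SeparableSpace X ∧ {r : ℝ | ∃ x y : X, dist x y = r} = A) ↔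
      (∃ (X : Type) (_ : MetricSpace X), SigmaCompactSpace X ∧ CompleteSpace X ∧
        TopologicalSpace.SeparableSpace X ∧ {r : ℝ | ∃ x y : X, dist x y = r} = A)) ∧
    ((∃ (X : Type) (_ : MetricSpace X), LocallyCompactSpace X ∧ CompleteSpace X ∧
        TopologicalSpace.SeparableSpace X ∧ {r : ℝ | ∃ x y : X, dist x y = r} = A) ↔
      (A.Countable ∨
        ((∃ K : ℕ → Set ℝ, (∀ n, IsCompact (K n)) ∧ A = ⋃ n, K n) ∧
          ∀ ε > 0, ∃ a ∈ A, a ≠ 0 ∧ |a| < ε))) := by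
  have sigmaCompact_of_locallyCompact : (∃ (X : Type) (_ : MetricSpace X), LocallyCompactSpace X ∧ CompleteSpace X ∧
        TopologicalSpace.SeparableSpace X ∧ {r : ℝ | ∃ x y : X, dist x y = r} = A) →
      (∃ (X : Type) (_ : MetricSpace X), SigmaCompactSpace X ∧ CompleteSpace X ∧
        TopologicalSpace.SeparableSpace X ∧ {r : ℝ | ∃ x y : X, dist x y = r} = A) := by
    rintro ⟨X, _, _, hc, hs, hA⟩
    have := UniformSpace.secondCountable_of_separable X
    exact ⟨X, inferInstance, inferInstance, hc, hs, hA⟩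
  have cond_of_sigmaCompact : (∃ (X : Type) (_ : MetricSpace X), SigmaCompactSpace X ∧ CompleteSpace X ∧
        TopologicalSpace.SeparableSpace X ∧ {r : ℝ | ∃ x y : X, dist x y = r} = A) →
      (A.Countable ∨
        ((∃ K : ℕ → Set ℝ, (∀ n, IsCompact (K n)) ∧ A = ⋃ n, K n) ∧
          ∀ ε > 0, ∃ a ∈ A, a ≠ 0 ∧ |a| < ε)) := by
    rintro ⟨X, _, _, -, _, rfl⟩
    refine or_iff_not_imp_right.2 fun h => ?_
    have hiso := not_and.1 h (distances_eq_iUnion_compact X)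
    push Not at hiso
    obtain ⟨ε, hε, hiso⟩ := hiso
    have : Countable X := countable_of_separable_of_dist hε fun x y hxy => by
      simpa using hiso _ ⟨x, y, rfl⟩ (dist_ne_zero.2 hxy)
    convert countable_range fun p : X × X => dist p.1 p.2 using 1
    ext r
    simp
  have locallyCompact_of_cond : (A.Countable ∨
        ((∃ K : ℕ → Set ℝ, (∀ n, IsCompact (K n)) ∧ A = ⋃ n, K n) ∧
          ∀ ε > 0, ∃ a ∈ A, a ≠ 0 ∧ |a| < ε)) →
      (∃ (X : Type) (_ : MetricSpace X), LocallyCompactSpace X ∧ CompleteSpace X ∧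
        TopologicalSpace.SeparableSpace X ∧ {r : ℝ | ∃ x y : X, dist x y = r} = A) := by
    intro h
    by_cases hlim : ∀ ε > 0, ∃ a ∈ A, a ≠ 0 ∧ |a| < ε
    · have hKσ : ∃ K : ℕ → Set ℝ, (∀ n, IsCompact (K n)) ∧ A = ⋃ n, K n := by
        rcases h with h | h
        · obtain ⟨f, rfl⟩ := h.exists_eq_range ⟨0, h0⟩
          exact ⟨fun n => {f n}, fun n => isCompact_singleton, (iUnion_singleton_eq_range f).symm⟩
        · exact h.1
      obtain ⟨K, hK, rfl⟩ := hKσ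
      exact exists_space_of_iUnion_compact hK hnn h0 hlim
    · have hA : A.Countable := h.resolve_right fun h => hlim h.2
      push Not at hlim
      obtain ⟨ε, hε, hiso⟩ := hlim
      exact exists_space_of_countable hnn h0 hA hε fun a ha ha0 => by
        simpa [abs_of_nonneg (hnn a ha)] using hiso a ha ha0
  exact ⟨⟨sigmaCompact_of_locallyCompact, locallyCompact_of_cond ∘ cond_of_sigmaCompact⟩,
    cond_of_sigmaCompact ∘ sigmaCompact_of_locallyCompact, locallyCompact_of_cond⟩
end

section
/- Let A be a set of non-negative real numbers with 0 ∈ A such that A is a countable union of compact subsets of ℝ (a K_σ set) and 0 is a limit point of A. Then there exists a locally compact, complete, separable metric space (X,d) whose distance set equals A. -/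
open Set Filter Topology

/-- Digit expansions of the points of `K` relative to the scales `a (n + 1)`. -/
@[ext]
structure DigitCode (K : Set ℝ) (a : ℕ → ℝ) where
  /-- the encoded real number -/
  val : ℝ
  /-- the digit sequence -/
  digits : ℕ → ℤ
  val_mem : val ∈ K
  lower : ∀ n, digits n * a (n + 1) ≤ val
  upper : ∀ n, val ≤ (digits n + 1) * a (n + 1)

namespace DigitCode

variable {K : Set ℝ} {a : ℕ → ℝ}

lemma abs_val_sub_le_of_digits_eq (x y : DigitCode K a) {n : ℕ} (h : x.digits n = y.digits n) :
    |x.val - y.val| ≤ a (n + 1) := by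
  have h1 := x.lower n
  have h2 := x.upper n
  have h3 := y.lower n
  have h4 := y.upper n
  rw [h] at h1 h2
  rw [abs_le]
  constructor <;> linarith

lemma eq_of_digits_eq (ha : Tendsto a atTop (𝓝 0)) {x y : DigitCode K a}
    (h : x.digits = y.digits) : x = y := by
  refine DigitCode.ext ?_ h
  have h0 : |x.val - y.val| ≤ 0 :=
    ge_of_tendsto' (ha.comp (tendsto_add_atTop_nat 1))
      fun n => abs_val_sub_le_of_digits_eq x y (congrFun h n)
  exact sub_eq_zero.mp (abs_nonpos_iff.mp h0)

lemma exists_val_eq (hpos : ∀ n, 0 < a n) {k : ℝ} (hk : k ∈ K) :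
    ∃ x : DigitCode K a, x.val = k := by
  refine ⟨⟨k, fun n => ⌊k / a (n + 1)⌋, hk, fun n => ?_, fun n => ?_⟩, rfl⟩
  · exact (le_div_iff₀ (hpos _)).mp (Int.floor_le _)
  · exact (div_le_iff₀ (hpos _)).mp (Int.lt_floor_add_one _).le

open Classical in
/-- The ultrametric on digit codes: the scale of the first digit that differs. -/
noncomputable def codeDist (x y : DigitCode K a) : ℝ :=
  if x.digits = y.digits then 0 else a (PiNat.firstDiff x.digits y.digits)

lemma codeDist_of_ne {x y : DigitCode K a} (h : x.digits ≠ y.digits) :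
    codeDist x y = a (PiNat.firstDiff x.digits y.digits) := if_neg h

lemma codeDist_of_eq {x y : DigitCode K a} (h : x.digits = y.digits) : codeDist x y = 0 := if_pos h

lemma codeDist_nonneg (hpos : ∀ n, 0 < a n) (x y : DigitCode K a) : 0 ≤ codeDist x y := by
  unfold codeDist
  split_ifs
  exacts [le_rfl, (hpos _).le]

lemma codeDist_triangle (hpos : ∀ n, 0 < a n) (hanti : Antitone a) (x y z : DigitCode K a) :
    codeDist x z ≤ codeDist x y + codeDist y z := by
  by_cases hxz : x.digits = z.digits
  · rw [codeDist_of_eq hxz]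
    exact add_nonneg (codeDist_nonneg hpos _ _) (codeDist_nonneg hpos _ _)
  by_cases hxy : x.digits = y.digits
  · rw [codeDist_of_eq hxy, codeDist_of_ne hxz, codeDist_of_ne (hxy ▸ hxz), hxy, zero_add]
  by_cases hyz : y.digits = z.digits
  · rw [codeDist_of_eq hyz, codeDist_of_ne hxz, codeDist_of_ne hxy, hyz, add_zero]
  rw [codeDist_of_ne hxy, codeDist_of_ne hyz, codeDist_of_ne hxz]
  refine (hanti (PiNat.min_firstDiff_le x.digits y.digits z.digits hxz)).trans ?_
  have h1 := hpos (PiNat.firstDiff x.digits y.digits)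
  have h2 := hpos (PiNat.firstDiff y.digits z.digits)
  rcases min_choice (PiNat.firstDiff x.digits y.digits) (PiNat.firstDiff y.digits z.digits)
    with h | h <;> rw [h] <;> linarith

/-- The metric space of digit codes. -/
@[reducible]
noncomputable def metricSpace (hpos : ∀ n, 0 < a n) (hanti : Antitone a)
    (ha : Tendsto a atTop (𝓝 0)) : MetricSpace (DigitCode K a) where
  dist := codeDist
  dist_self x := codeDist_of_eq rfl
  dist_comm x y := by
    by_cases h : x.digits = y.digits
    · rw [codeDist_of_eq h, codeDist_of_eq h.symm]
    · rw [codeDist_of_ne h, codeDist_of_ne (Ne.symm h), PiNat.firstDiff_comm]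
  dist_triangle := codeDist_triangle hpos hanti
  eq_of_dist_eq_zero {x y} h := by
    by_contra hne
    have hd : x.digits ≠ y.digits := fun h => hne (eq_of_digits_eq ha h)
    exact (hpos _).ne' ((codeDist_of_ne hd).symm.trans h)

lemma abs_val_sub_le_codeDist (ha : Tendsto a atTop (𝓝 0))
    (hdiam : ∀ k ∈ K, ∀ l ∈ K, |k - l| ≤ a 0) (x y : DigitCode K a) :
    |x.val - y.val| ≤ codeDist x y := by
  by_cases h : x.digits = y.digits
  · rw [codeDist_of_eq h, eq_of_digits_eq ha h, sub_self, abs_zero]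
  rw [codeDist_of_ne h]
  rcases hn : PiNat.firstDiff x.digits y.digits with _ | n
  · exact hdiam _ x.val_mem _ y.val_mem
  · exact abs_val_sub_le_of_digits_eq x y (PiNat.apply_eq_of_lt_firstDiff (by omega))

/-- The pairs (value, digit sequence) coming from digit codes. -/
def graph (K : Set ℝ) (a : ℕ → ℝ) : Set (ℝ × (ℕ → ℤ)) :=
  {p | p.1 ∈ K ∧ ∀ n, p.2 n * a (n + 1) ≤ p.1 ∧ p.1 ≤ (p.2 n + 1) * a (n + 1)}

lemma isCompact_graph (hK : IsCompact K) (hpos : ∀ n, 0 < a n) : IsCompact (graph K a) := by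
  obtain ⟨R, hR⟩ := hK.isBounded.exists_norm_le
  have hc : IsCompact (K ×ˢ univ.pi fun n =>
      Icc (⌊-R / a (n + 1)⌋ - 1) ⌈R / a (n + 1)⌉ : Set (ℝ × (ℕ → ℤ))) :=
    hK.prod (isCompact_univ_pi fun n => (finite_Icc _ _).isCompact)
  have hclosed : IsClosed {p : ℝ × (ℕ → ℤ) |
      ∀ n, p.2 n * a (n + 1) ≤ p.1 ∧ p.1 ≤ (p.2 n + 1) * a (n + 1)} := by
    simp only [ofPred_forall, ofPred_and]
    have hcast : ∀ n, Continuous fun p : ℝ × (ℕ → ℤ) => (p.2 n : ℝ) := fun n =>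
      continuous_of_discreteTopology.comp ((continuous_apply n).comp continuous_snd)
    refine isClosed_iInter fun n => IsClosed.inter ?_ ?_
    · exact isClosed_le ((hcast n).mul continuous_const) continuous_fst
    · exact isClosed_le continuous_fst (((hcast n).add continuous_const).mul continuous_const)
  refine (hc.inter_right hclosed).of_isClosed_subset ?_ ?_
  · exact (hK.isClosed.preimage continuous_fst).inter hclosed
  · rintro p ⟨hp, h⟩
    refine ⟨⟨hp, fun n _ => ?_⟩, h⟩
    have hn := hpos (n + 1)
    have hb := abs_le.mp (hR _ hp)
    constructor
    · have : -R / a (n + 1) ≤ p.2 n + 1 := (div_le_iff₀ hn).mpr (hb.1.trans (h n).2)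
      have h' : (⌊-R / a (n + 1)⌋ : ℝ) ≤ ((p.2 n + 1 : ℤ) : ℝ) := by
        push_cast
        exact (Int.floor_le _).trans this
      have := Int.cast_le.mp h'
      omega
    · have : (p.2 n : ℝ) ≤ R / a (n + 1) := (le_div_iff₀ hn).mpr ((h n).1.trans hb.2)
      exact Int.cast_le.mp (this.trans (Int.le_ceil _))

/-- The digit code given by a point of the graph. -/
def ofGraph (p : graph K a) : DigitCode K a :=
  ⟨p.1.1, p.1.2, p.2.1, fun n => (p.2.2 n).1, fun n => (p.2.2 n).2⟩

lemma compactSpace (hK : IsCompact K) (hpos : ∀ n, 0 < a n) (hanti : Antitone a)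
    (ha : Tendsto a atTop (𝓝 0)) :
    @CompactSpace (DigitCode K a) (metricSpace hpos hanti ha).toUniformSpace.toTopologicalSpace := by
  let _ := metricSpace (K := K) hpos hanti ha
  have := isCompact_iff_compactSpace.mp (isCompact_graph hK hpos)
  have hsurj : Function.Surjective (ofGraph (K := K) (a := a)) := fun x =>
    ⟨⟨(x.val, x.digits), x.val_mem, fun n => ⟨x.lower n, x.upper n⟩⟩, rfl⟩
  have hcont : Continuous (ofGraph (K := K) (a := a)) := by
    refine continuous_iff_continuousAt.mpr fun p => Metric.tendsto_nhds.mpr fun ε hε => ?_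
    obtain ⟨N, hN⟩ := (ha.eventually (gt_mem_nhds hε)).exists
    have hdig : ∀ i, ∀ᶠ q : graph K a in 𝓝 p, q.1.2 i = p.1.2 i := fun i =>
      (((continuous_apply i).comp (continuous_snd.comp continuous_subtype_val)).tendsto
        p).eventually_mem ((isOpen_discrete {p.1.2 i}).mem_nhds rfl)
    have hall : ∀ᶠ q : graph K a in 𝓝 p, ∀ i ∈ Finset.range N, q.1.2 i = p.1.2 i :=
      (eventually_all_finset _).mpr fun i _ => hdig i
    filter_upwards [hall] with q hq
    change codeDist (ofGraph q) (ofGraph p) < ε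
    by_cases h : (ofGraph q).digits = (ofGraph p).digits
    · rwa [codeDist_of_eq h]
    rw [codeDist_of_ne h]
    refine (hanti ?_).trans_lt hN
    by_contra hlt
    exact PiNat.apply_firstDiff_ne h (hq _ (Finset.mem_range.mpr (not_le.mp hlt)))
  exact ⟨by rw [← hsurj.range_eq]; exact isCompact_range hcont⟩

end DigitCode

/-- Two copies of a type. -/
@[ext]
structure TwoCopies (S : Type) where
  /-- the label of the copy -/
  side : Bool
  /-- the underlying point -/
  pt : S

namespace TwoCopies

variable {S : Type} [MetricSpace S] {f : S → ℝ}

/-- The distance on two copies of `S` for which `x` and its twin are at distance `f x`. -/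
def twinDist (f : S → ℝ) (x y : TwoCopies S) : ℝ :=
  if x.side = y.side then dist x.pt y.pt else max (f x.pt) (f y.pt)

/-- The metric space structure given by `twinDist`. -/
@[reducible]
def metricSpace (hpos : ∀ x, 0 < f x) (hlip : ∀ x y, |f x - f y| ≤ dist x y)
    (hle : ∀ x y, dist x y ≤ f x) : MetricSpace (TwoCopies S) where
  dist := twinDist f
  dist_self x := by simp [twinDist]
  dist_comm x y := by
    simp only [twinDist, dist_comm, max_comm, eq_comm]
  dist_triangle := by
    rintro ⟨b, x⟩ ⟨c, y⟩ ⟨d, z⟩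
    have h1 := abs_le.mp (hlip x y)
    have h2 := abs_le.mp (hlip y z)
    have h3 := hle x z
    have h4 := dist_triangle x y z
    have h5 := hpos z
    have h6 := le_max_left (f x) (f y)
    have h7 := le_max_left (f y) (f z)
    have h8 := le_max_right (f x) (f y)
    have h9 := le_max_right (f y) (f z)
    change twinDist f _ _ ≤ twinDist f _ _ + twinDist f _ _
    cases b <;> cases c <;> cases d <;> simp [twinDist] <;>
      first
      | exact h4
      | linarith
      | constructor <;> linarith
  eq_of_dist_eq_zero := by
    rintro ⟨b, x⟩ ⟨c, y⟩ h
    change twinDist f _ _ = 0 at h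
    unfold twinDist at h
    split_ifs at h with hbc
    · exact TwoCopies.ext hbc (eq_of_dist_eq_zero h)
    · exact absurd h ((hpos x).trans_le (le_max_left _ _)).ne'

lemma compactSpace [CompactSpace S] (hpos : ∀ x, 0 < f x)
    (hlip : ∀ x y, |f x - f y| ≤ dist x y) (hle : ∀ x y, dist x y ≤ f x) :
    @CompactSpace (TwoCopies S)
      (metricSpace hpos hlip hle).toUniformSpace.toTopologicalSpace := by
  let _ := metricSpace hpos hlip hle
  have hiso : ∀ b, Isometry (TwoCopies.mk b : S → TwoCopies S) := fun b =>
    Isometry.of_dist_eq fun x y => if_pos rfl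
  have huniv : (univ : Set (TwoCopies S)) = ⋃ b, range (TwoCopies.mk b) := by
    ext ⟨b, x⟩
    simp
  exact ⟨by rw [huniv]; exact isCompact_iUnion fun b => isCompact_range (hiso b).continuous⟩

end TwoCopies

/-- A compact set of small diameter is realised by distances of a compact metric space, all of
whose other distances are taken from a given null sequence. -/
theorem exists_compact_metricSpace_dist {K : Set ℝ} {a : ℕ → ℝ} (hK : IsCompact K)
    (hpos : ∀ n, 0 < a n) (hanti : Antitone a) (ha : Tendsto a atTop (𝓝 0))
    (hdiam : ∀ k ∈ K, ∀ l ∈ K, |k - l| ≤ a 0) (hle : ∀ k ∈ K, a 0 ≤ k) :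
    ∃ (X : Type) (_ : MetricSpace X), CompactSpace X ∧
      (∀ x y : X, dist x y = 0 ∨ dist x y ∈ range a ∨ dist x y ∈ K) ∧
      ∀ k ∈ K, ∃ x y : X, dist x y = k := by
  let _ := DigitCode.metricSpace (K := K) hpos hanti ha
  have := DigitCode.compactSpace hK hpos hanti ha
  have hf : ∀ x : DigitCode K a, 0 < x.val := fun x => (hpos 0).trans_le (hle _ x.val_mem)
  have hd : ∀ x y : DigitCode K a, dist x y = 0 ∨ dist x y ∈ range a := fun x y => by
    by_cases h : x.digits = y.digits
    · exact Or.inl (DigitCode.codeDist_of_eq h)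
    · exact Or.inr ⟨_, (DigitCode.codeDist_of_ne h).symm⟩
  have hdf : ∀ x y : DigitCode K a, dist x y ≤ x.val := fun x y => by
    rcases hd x y with h | ⟨n, h⟩
    · exact h.trans_le (hf x).le
    · exact h ▸ (hanti n.zero_le).trans (hle _ x.val_mem)
  have hlip : ∀ x y : DigitCode K a, |x.val - y.val| ≤ dist x y :=
    DigitCode.abs_val_sub_le_codeDist ha hdiam
  refine ⟨TwoCopies (DigitCode K a), TwoCopies.metricSpace hf hlip hdf,
    TwoCopies.compactSpace hf hlip hdf, ?_, fun k hk => ?_⟩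
  · intro x y
    change TwoCopies.twinDist _ x y = 0 ∨ TwoCopies.twinDist _ x y ∈ _ ∨
      TwoCopies.twinDist _ x y ∈ _
    unfold TwoCopies.twinDist
    split_ifs
    · exact (hd _ _).imp_right Or.inl
    · refine Or.inr (Or.inr ?_)
      rcases max_choice x.pt.val y.pt.val with h | h <;> rw [h]
      exacts [x.pt.val_mem, y.pt.val_mem]
  · obtain ⟨x, rfl⟩ := DigitCode.exists_val_eq hpos hk
    exact ⟨⟨false, x⟩, ⟨true, x⟩, by simp [dist, TwoCopies.twinDist]⟩

/-- A disjoint union of metric spaces. -/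
structure SeparatedUnion {ι : Type} (X : ι → Type) where
  /-- the index of the component -/
  idx : ι
  /-- the point of the component -/
  pt : X idx

namespace SeparatedUnion

variable {ι : Type} {X : ι → Type} [∀ i, MetricSpace (X i)] {M : ι → ℝ}

open Classical in
/-- Points of distinct components `i`, `j` are at distance `max (M i) (M j)`. -/
noncomputable def unionDist (M : ι → ℝ) (x y : SeparatedUnion X) : ℝ :=
  if h : x.idx = y.idx then dist (h ▸ x.pt) y.pt else max (M x.idx) (M y.idx)

lemma unionDist_same (i : ι) (x y : X i) : unionDist M ⟨i, x⟩ ⟨i, y⟩ = dist x y := by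
  simp [unionDist]

lemma unionDist_of_ne {i j : ι} (h : i ≠ j) (x : X i) (y : X j) :
    unionDist M ⟨i, x⟩ ⟨j, y⟩ = max (M i) (M j) := dif_neg h

/-- The metric space structure given by `unionDist`. -/
@[reducible]
noncomputable def metricSpace (hpos : ∀ i, 0 < M i) (hM : ∀ i, ∀ x y : X i, dist x y ≤ M i) :
    MetricSpace (SeparatedUnion X) where
  dist := unionDist M
  dist_self := fun ⟨i, x⟩ => by rw [unionDist_same, dist_self]
  dist_comm := by
    rintro ⟨i, x⟩ ⟨j, y⟩
    rcases eq_or_ne i j with rfl | h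
    · rw [unionDist_same, unionDist_same, dist_comm]
    · rw [unionDist_of_ne h, unionDist_of_ne h.symm, max_comm]
  dist_triangle := by
    rintro ⟨i, x⟩ ⟨j, y⟩ ⟨k, z⟩
    rcases eq_or_ne i j with rfl | hij
    · rcases eq_or_ne i k with rfl | hik
      · simp only [unionDist_same]
        exact dist_triangle _ _ _
      · rw [unionDist_same, unionDist_of_ne hik, unionDist_of_ne hik]
        exact le_add_of_nonneg_left dist_nonneg
    · have hMi := hpos i
      have hMk := hpos k
      have h1 := le_max_left (M i) (M j)
      have h2 := le_max_right (M j) (M k)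
      rcases eq_or_ne j k with rfl | hjk
      · rw [unionDist_same, unionDist_of_ne hij, unionDist_of_ne hij]
        exact le_add_of_nonneg_right dist_nonneg
      · rw [unionDist_of_ne hij, unionDist_of_ne hjk]
        rcases eq_or_ne i k with rfl | hik
        · rw [unionDist_same]
          have := hM i x z
          linarith
        · rw [unionDist_of_ne hik]
          exact max_le (by linarith) (by linarith)
  eq_of_dist_eq_zero := by
    rintro ⟨i, x⟩ ⟨j, y⟩ h
    change unionDist M _ _ = 0 at h
    rcases eq_or_ne i j with rfl | hij
    · rw [unionDist_same] at h
      rw [eq_of_dist_eq_zero h]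
    · rw [unionDist_of_ne hij] at h
      exact absurd h ((hpos i).trans_le (le_max_left _ _)).ne'

end SeparatedUnion

/-- Countably many compact metric spaces can be put together at uniformly positive distances. -/
theorem exists_separated_union {ι : Type} [Countable ι] (X : ι → Type) [∀ i, MetricSpace (X i)]
    [∀ i, CompactSpace (X i)] {M : ι → ℝ} {c : ℝ} (hc : 0 < c) (hcM : ∀ i, c ≤ M i)
    (hM : ∀ i, ∀ x y : X i, dist x y ≤ M i) :
    ∃ (Y : Type) (_ : MetricSpace Y), LocallyCompactSpace Y ∧ CompleteSpace Y ∧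
      TopologicalSpace.SeparableSpace Y ∧ (∀ i, ∀ x y : X i, ∃ z w : Y, dist z w = dist x y) ∧
      ∀ z w : Y, (∃ i, ∃ x y : X i, dist z w = dist x y) ∨
        ∃ i j, dist z w = max (M i) (M j) := by
  have hpos : ∀ i, 0 < M i := fun i => hc.trans_le (hcM i)
  let _ := SeparatedUnion.metricSpace hpos hM
  have hiso : ∀ i, Isometry (SeparatedUnion.mk i : X i → SeparatedUnion X) := fun i =>
    Isometry.of_dist_eq fun x y => SeparatedUnion.unionDist_same i x y
  have hcomp : ∀ i, IsCompact (range (SeparatedUnion.mk i : X i → SeparatedUnion X)) := fun i =>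
    isCompact_range (hiso i).continuous
  have hball : ∀ x y : SeparatedUnion X, dist y x < c →
      y ∈ range (SeparatedUnion.mk x.idx : X x.idx → SeparatedUnion X) := by
    rintro ⟨i, x⟩ ⟨j, y⟩ h
    rcases eq_or_ne j i with rfl | hij
    · exact ⟨y, rfl⟩
    · have h' : dist (⟨j, y⟩ : SeparatedUnion X) ⟨i, x⟩ = max (M j) (M i) :=
        SeparatedUnion.unionDist_of_ne hij _ _
      exact absurd ((hcM j).trans (le_max_left _ (M i))) (not_le.mpr (h' ▸ h))
  have : WeaklyLocallyCompactSpace (SeparatedUnion X) :=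
    ⟨fun x => ⟨_, hcomp x.idx, mem_of_superset (Metric.ball_mem_nhds x hc) (hball x)⟩⟩
  have : SigmaCompactSpace (SeparatedUnion X) := by
    refine SigmaCompactSpace.of_countable (range fun i => range (SeparatedUnion.mk (X := X) i))
      (countable_range _) ?_ ?_
    · rintro _ ⟨i, rfl⟩
      exact hcomp i
    · exact eq_univ_of_forall fun ⟨i, x⟩ => ⟨_, ⟨i, rfl⟩, x, rfl⟩
  have : SecondCountableTopology (SeparatedUnion X) :=
    EMetric.secondCountable_of_sigmaCompact _
  refine ⟨SeparatedUnion X, inferInstance, inferInstance, ?_, inferInstance, fun i x y =>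
    ⟨⟨i, x⟩, ⟨i, y⟩, SeparatedUnion.unionDist_same i x y⟩, ?_⟩
  · refine Metric.complete_of_cauchySeq_tendsto fun u hu => ?_
    obtain ⟨N, hN⟩ := Metric.cauchySeq_iff'.mp hu c hc
    obtain ⟨y, -, hy⟩ := cauchySeq_tendsto_of_isComplete (hcomp (u N).idx).isComplete
      (fun n => hball (u N) (u (n + N)) (hN _ (Nat.le_add_left _ _)))
      (hu.comp_tendsto (tendsto_add_atTop_nat N))
    exact ⟨y, (tendsto_add_atTop_iff_nat N).mp hy⟩
  · rintro ⟨i, x⟩ ⟨j, y⟩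
    rcases eq_or_ne i j with rfl | hij
    · exact Or.inl ⟨i, x, y, SeparatedUnion.unionDist_same i x y⟩
    · exact Or.inr ⟨i, j, SeparatedUnion.unionDist_of_ne hij _ _⟩

/-- If `A ⊆ [0,∞)` with `0 ∈ A` is a countable union of compact subsets of
`ℝ` (a `K_σ` set) and `0` is a limit point of `A`, then `A` is the distance set of some
locally compact complete separable metric space. -/
theorem stmt_17 (A : Set ℝ) (hnn : ∀ a ∈ A, 0 ≤ a) (h0 : (0 : ℝ) ∈ A)
    (hKσ : ∃ K : ℕ → Set ℝ, (∀ n, IsCompact (K n)) ∧ A = ⋃ n, K n)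
    (hlim : ∀ ε > 0, ∃ a ∈ A, a ≠ 0 ∧ |a| < ε) :
    ∃ (X : Type) (_ : MetricSpace X), LocallyCompactSpace X ∧ CompleteSpace X ∧
      TopologicalSpace.SeparableSpace X ∧
      {r : ℝ | ∃ x y : X, dist x y = r} = A := by
  obtain ⟨K, hK, hA⟩ := hKσ
  have hsmall : ∀ ε > 0, ∃ a ∈ {a ∈ A | 0 < a}, a < ε := fun ε hε => by
    obtain ⟨a, haA, hne, hlt⟩ := hlim ε hε
    exact ⟨a, ⟨haA, (hnn a haA).lt_of_ne' hne⟩, (le_abs_self a).trans_lt hlt⟩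
  have hglb : IsGLB {a ∈ A | 0 < a} 0 := by
    refine ⟨fun a ha => ha.2.le, fun b hb => not_lt.mp fun hlt => ?_⟩
    obtain ⟨a, ha, hab⟩ := hsmall b hlt
    exact absurd (hb ha) (not_le.mpr hab)
  obtain ⟨u, huanti, hupos, hu, huA⟩ := hglb.exists_seq_strictAnti_tendsto_of_notMem
    (fun h => lt_irrefl _ h.2) ((hsmall 1 one_pos).imp fun _ h => h.1)
  let P : ℕ × ℕ × ℤ → Set ℝ := fun i =>
    K i.1 ∩ (Ici (u i.2.1) ∩ Icc (i.2.2 * u i.2.1) ((i.2.2 + 1) * u i.2.1))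
  have hPA : ∀ i, P i ⊆ A := fun i k hk => hA ▸ mem_iUnion.mpr ⟨i.1, hk.1⟩
  have hPc : ∀ i, IsCompact (P i) := fun i =>
    (hK i.1).inter_right (isClosed_Ici.inter isClosed_Icc)
  have hpiece := fun i : ℕ × ℕ × ℤ => exists_compact_metricSpace_dist
    (a := fun n => u (n + i.2.1)) (hPc i) (fun n => hupos _)
    (fun m n h => huanti.antitone (Nat.add_le_add_right h _))
    (hu.comp (tendsto_add_atTop_nat _))
    (fun k hk l hl => by
      have h1 := hk.2.2.1
      have h2 := hk.2.2.2
      have h3 := hl.2.2.1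
      have h4 := hl.2.2.2
      rw [zero_add, abs_le]
      constructor <;> linarith)
    (fun k hk => by rw [zero_add]; exact hk.2.1)
  choose X mX hXc hXd hXK using hpiece
  have hXA : ∀ i, ∀ x y : X i, dist x y ∈ A := fun i x y => by
    rcases hXd i x y with h | ⟨n, h⟩ | h
    · exact h ▸ h0
    · exact h ▸ (huA _).1
    · exact hPA i h
  have hbound : ∀ i, ∃ M ∈ A, u 0 ≤ M ∧ ∀ x y : X i, dist x y ≤ M := fun i => by
    rcases isEmpty_or_nonempty (X i) with hE | hE
    · exact ⟨u 0, (huA 0).1, le_rfl, fun x => (hE.false x).elim⟩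
    obtain ⟨p, -, hp⟩ := isCompact_univ.exists_isMaxOn univ_nonempty
      (continuous_dist (α := X i)).continuousOn
    refine ⟨max (u 0) (dist p.1 p.2), ?_, le_max_left _ _, fun x y =>
      (hp (mem_univ (x, y))).trans (le_max_right _ _)⟩
    rcases max_choice (u 0) (dist p.1 p.2) with h | h <;> rw [h]
    exacts [(huA 0).1, hXA i _ _]
  choose M hMA hcM hM using hbound
  obtain ⟨Y, mY, hY1, hY2, hY3, hYX, hYd⟩ := exists_separated_union X (hupos 0) hcM hM
  refine ⟨Y, mY, hY1, hY2, hY3, Subset.antisymm ?_ fun r hr => ?_⟩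
  · rintro _ ⟨z, w, rfl⟩
    rcases hYd z w with ⟨i, x, y, h⟩ | ⟨i, j, h⟩
    · exact h ▸ hXA i x y
    · rw [h]
      rcases max_choice (M i) (M j) with h | h <;> rw [h]
      exacts [hMA i, hMA j]
  · have hposmem : ∀ r ∈ A, 0 < r → ∃ z w : Y, dist z w = r := fun r hr hr0 => by
      obtain ⟨m, hm⟩ := (hu.eventually (gt_mem_nhds hr0)).exists
      obtain ⟨N, hN⟩ := mem_iUnion.mp (hA ▸ hr)
      obtain ⟨x, y, hxy⟩ := hXK (N, m, ⌊r / u m⌋) r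
        ⟨hN, hm.le, (le_div_iff₀ (hupos m)).mp (Int.floor_le _),
          (div_le_iff₀ (hupos m)).mp (Int.lt_floor_add_one _).le⟩
      exact hxy ▸ hYX _ x y
    rcases (hnn r hr).eq_or_lt with rfl | hr0
    · obtain ⟨z, -, -⟩ := hposmem (u 0) (huA 0).1 (hupos 0)
      exact ⟨z, z, dist_self z⟩
    · exact hposmem r hr hr0
end
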